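/- Suppose (G_n, c_n), K > 1, γ_n > 0 and δ_n → 0 satisfy Assumption (LL), the network c_n is connected, and G_n is simple. Then for X uniform on V(G_n), every fixed radius r and every finite rooted tree (T,1) of height r with k vertices, |P(B_{WST(c_n)}(X, r) ≅ T) − Σ_{v_k ∈ C^T(W_n^{(tc)})} (F_{c_n}(T(v_k))/|Stab_T|) · ∏_{j=2}^k c(v_{p_T(j)}, v_j)| = o(1) as n → ∞. -/

import Mathlib

open MeasureTheory Filter Finset

noncomputable section

set_option linter.unusedSectionVars false

namespace WSTPaper

variable {V : Type} [Fintype V] [DecidableEq V]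

/-- The conductance `C_v = Σ_{u ~ v} c(u,v)` of a vertex in the electric network `(G, c)`. -/
def vertCond (G : SimpleGraph V) [DecidableRel G.Adj] (c : Sym2 V → ℝ) (v : V) : ℝ :=
  ∑ u ∈ G.neighborFinset v, c s(u, v)

open scoped Classical in
/-- The edge sets of spanning trees of `G`. -/
def spanningTrees (G : SimpleGraph V) : Finset (Finset (Sym2 V)) :=
  Finset.univ.filter
    (fun T => ↑T ⊆ G.edgeSet ∧ (SimpleGraph.fromEdgeSet (↑T : Set (Sym2 V))).IsTree)

/-- Weight of a spanning tree: product of its edge conductances. -/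
def treeWeight (c : Sym2 V → ℝ) (T : Finset (Sym2 V)) : ℝ := ∏ e ∈ T, c e

/-- Partition function of the weighted spanning tree measure. -/
def partZ (G : SimpleGraph V) (c : Sym2 V → ℝ) : ℝ := ∑ T ∈ spanningTrees G, treeWeight c T

/-- The ball of radius `r` around `x` in `G`, as a set of vertices. -/
def ballSet (G : SimpleGraph V) (x : V) (r : ℕ) : Set V :=
  {y | G.Reachable x y ∧ G.dist x y ≤ r}

lemma mem_ballSet_self (G : SimpleGraph V) (x : V) (r : ℕ) : x ∈ ballSet G x r :=
  ⟨SimpleGraph.Reachable.refl x, by simp [SimpleGraph.dist_self]⟩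

/-- The `r`-ball of `G` around `x` is rooted-isomorphic to the rooted graph `(H, w)`. -/
def BallIso (G : SimpleGraph V) (x : V) (r : ℕ) {W : Type} (H : SimpleGraph W) (w : W) : Prop :=
  ∃ φ : SimpleGraph.induce (ballSet G x r) G ≃g H, φ ⟨x, mem_ballSet_self G x r⟩ = w

open scoped Classical in
/-- `P(B_{WST(c)}(X, r) ≅ (H, w))`, where `X` is a uniform random vertex of `G`. -/
def wstBallProb (G : SimpleGraph V) (c : Sym2 V → ℝ) (r : ℕ)
    {W : Type} (H : SimpleGraph W) (w : W) : ℝ :=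
  (Fintype.card V : ℝ)⁻¹ *
    ∑ x : V, (∑ T ∈ spanningTrees G,
      if BallIso (SimpleGraph.fromEdgeSet (↑T : Set (Sym2 V))) x r H w then treeWeight c T else 0)
      / partZ G c

/-- `b_c(v) := Σ_{u ~ v} c(u,v)/C_u`. -/
def bFun (G : SimpleGraph V) [DecidableRel G.Adj] (c : Sym2 V → ℝ) (v : V) : ℝ :=
  ∑ u ∈ G.neighborFinset v, c s(u, v) / vertCond G c u

open scoped Classical

section RootedTree

variable {k : ℕ}

/-- Depth of a vertex in the rooted tree on `Fin k` encoded by the parent map `p`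
(computed with fuel; correct whenever `p j < j` for `j ≠ root`). -/
def depthAux (p : Fin k → Fin k) (root : Fin k) : ℕ → Fin k → ℕ
  | 0, _ => 0
  | fuel + 1, j => if j = root then 0 else depthAux p root fuel (p j) + 1

/-- Depth of a vertex in the rooted tree on `Fin k` with parent map `p` and root `root`. -/
def depth (p : Fin k → Fin k) (root : Fin k) (j : Fin k) : ℕ := depthAux p root k j

/-- The adjacency relation of the tree encoded by the parent map `p` with root `root`. -/
def treeAdj (p : Fin k → Fin k) (root : Fin k) (i j : Fin k) : Prop :=
  (i ≠ root ∧ p i = j) ∨ (j ≠ root ∧ p j = i)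

/-- The rooted tree on `Fin k` encoded by the parent map `p` with root `root`,
as a simple graph. -/
def treeGraph (p : Fin k → Fin k) (root : Fin k) : SimpleGraph (Fin k) :=
  SimpleGraph.fromRel (fun i j => j ≠ root ∧ p j = i)

/-- Number of root-preserving automorphisms `|Stab_T|` of the rooted tree encoded by `p`. -/
def stabCard (p : Fin k → Fin k) (root : Fin k) : ℕ :=
  Nat.card {φ : Equiv.Perm (Fin k) //
    φ root = root ∧ ∀ i j, treeAdj p root i j ↔ treeAdj p root (φ i) (φ j)}

/-- A `T`-compatible tuple with all entries in `W`: the vertices are distinct, every tree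
edge is mapped to an edge of `G`, and all entries lie in `W`. -/
def Compatible (G : SimpleGraph V) (p : Fin k → Fin k) (root : Fin k) (W : Set V)
    (vv : Fin k → V) : Prop :=
  Function.Injective vv ∧ (∀ j, j ≠ root → G.Adj (vv (p j)) (vv j)) ∧ ∀ j, vv j ∈ W

/-- The quantity `F_c(T(v_k))`: with `I` the set of tree vertices of depth `< r`
(the ball `B_T(root, r-1)`),
`F = |V|⁻¹ · exp(-Σ_{j ∈ I} b_c(v_j)) · (Σ_{j ∉ I} C_{v_j}) / ∏_j C_{v_j}`. -/
def Ffun (G : SimpleGraph V) [DecidableRel G.Adj] (c : Sym2 V → ℝ)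
    (p : Fin k → Fin k) (root : Fin k) (r : ℕ) (vv : Fin k → V) : ℝ :=
  (Fintype.card V : ℝ)⁻¹ *
    Real.exp (-(∑ j ∈ Finset.univ.filter (fun j => depth p root j < r), bFun G c (vv j))) *
    (∑ j ∈ Finset.univ.filter (fun j => ¬ depth p root j < r), vertCond G c (vv j)) /
    ∏ j : Fin k, vertCond G c (vv j)

end RootedTree

/-! ### Electrical networks as symmetric weight functions -/

/-- The Laplacian of the weights `a`, as an operator on functions. -/
def lapOp (a : V → V → ℝ) (h : V → ℝ) (v : V) : ℝ := ∑ u, a v u * (h v - h u)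

/-- Symmetric nonnegative loopless weights whose support is connected. -/
structure IsNet (a : V → V → ℝ) : Prop where
  symm : ∀ u v, a u v = a v u
  nonneg : ∀ u v, 0 ≤ a u v
  loop : ∀ v, a v v = 0
  conn : ∀ f : V → ℝ, (∀ u v, 0 < a u v → f u = f v) → ∀ u v, f u = f v

/-- The Laplacian with Dirichlet boundary condition on `S`: rows and columns indexed by `S` are
replaced by those of the identity matrix. -/
def dirLap (a : V → V → ℝ) (S : Finset V) : Matrix V V ℝ :=
  Matrix.of fun u v => if u ∈ S ∨ v ∈ S then (if u = v then 1 else 0)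
    else (if u = v then ∑ w, a u w else 0) - a u v

lemma lapOp_eq (a : V → V → ℝ) (h : V → ℝ) (v : V) :
    lapOp a h v = (∑ u, a v u) * h v - ∑ u, a v u * h u := by
  simp [lapOp, mul_sub, Finset.sum_sub_distrib, Finset.sum_mul]

lemma lapOp_sub (a : V → V → ℝ) (h k : V → ℝ) (v : V) :
    lapOp a (fun w => h w - k w) v = lapOp a h v - lapOp a k v := by
  simp only [lapOp, ← Finset.sum_sub_distrib]
  exact Finset.sum_congr rfl fun u _ => by ring

lemma lapOp_sub_const (a : V → V → ℝ) (h : V → ℝ) (t : ℝ) (v : V) :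
    lapOp a (fun w => h w - t) v = lapOp a h v := by
  simp [lapOp]

lemma lapOp_mul_const (a : V → V → ℝ) (h : V → ℝ) (t : ℝ) (v : V) :
    lapOp a (fun w => h w * t) v = lapOp a h v * t := by
  simp only [lapOp, Finset.sum_mul]
  exact Finset.sum_congr rfl fun u _ => by ring

lemma dirLap_mulVec_of_mem (a : V → V → ℝ) (S : Finset V) (h : V → ℝ) {v : V} (hv : v ∈ S) :
    (dirLap a S).mulVec h v = h v := by
  simp [dirLap, Matrix.mulVec, dotProduct, hv]

lemma dirLap_mulVec_of_notMem (a : V → V → ℝ) (S : Finset V) (h : V → ℝ) {v : V} (hv : v ∉ S) :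
    (dirLap a S).mulVec h v = lapOp a (fun w => if w ∈ S then 0 else h w) v := by
  rw [lapOp_eq]
  simp only [dirLap, Matrix.mulVec, dotProduct, hv, false_or, Matrix.of_apply, if_false]
  have : ∀ x, (if x ∈ S then if v = x then (1:ℝ) else 0
      else (if v = x then ∑ w, a v w else 0) - a v x) * h x =
      (if v = x then (∑ w, a v w) * h x else 0) - a v x * (if x ∈ S then 0 else h x) := by
    intro x
    by_cases hx : x ∈ S
    · have : v ≠ x := fun e => hv (e ▸ hx)
      simp [hx, this]
    · by_cases hvx : v = x <;> simp [hx, hvx, sub_mul]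
  simp [this, Finset.sum_sub_distrib]

namespace IsNet

variable {a : V → V → ℝ}

lemma sum_mul_lapOp (ha : IsNet a) (h : V → ℝ) :
    ∑ v, h v * lapOp a h v = (1 / 2) * ∑ u, ∑ v, a u v * (h u - h v) ^ 2 := by
  have h1 : ∑ v, h v * lapOp a h v = ∑ u, ∑ v, a u v * (h u * (h u - h v)) := by
    simp only [lapOp, Finset.mul_sum]
    exact Finset.sum_congr rfl fun u _ => Finset.sum_congr rfl fun v _ => by ring
  have h2 : ∑ v, h v * lapOp a h v = ∑ u, ∑ v, a u v * (h v * (h v - h u)) := by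
    rw [h1, Finset.sum_comm]
    exact Finset.sum_congr rfl fun u _ => Finset.sum_congr rfl fun v _ => by rw [ha.symm]
  have h3 : ∑ u, ∑ v, a u v * (h u - h v) ^ 2 =
      ∑ u, ∑ v, a u v * (h u * (h u - h v)) + ∑ u, ∑ v, a u v * (h v * (h v - h u)) := by
    simp only [← Finset.sum_add_distrib]
    exact Finset.sum_congr rfl fun u _ => Finset.sum_congr rfl fun v _ => by ring
  rw [h3, ← h1, ← h2]; ring

lemma sum_mul_lapOp_nonneg (ha : IsNet a) (h : V → ℝ) : 0 ≤ ∑ v, h v * lapOp a h v := by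
  rw [ha.sum_mul_lapOp]
  have : ∀ u v, 0 ≤ a u v * (h u - h v) ^ 2 := fun u v =>
    mul_nonneg (ha.nonneg u v) (sq_nonneg _)
  have := Finset.sum_nonneg fun u (_ : u ∈ Finset.univ) =>
    Finset.sum_nonneg fun v (_ : v ∈ Finset.univ) => this u v
  linarith

lemma eq_of_sum_mul_lapOp_eq_zero (ha : IsNet a) (h : V → ℝ)
    (h0 : ∑ v, h v * lapOp a h v = 0) (u v : V) :
    h u = h v := by
  refine ha.conn h ?_ u v
  intro u v huv
  rw [ha.sum_mul_lapOp] at h0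
  have nn : ∀ u v, 0 ≤ a u v * (h u - h v) ^ 2 := fun u v =>
    mul_nonneg (ha.nonneg u v) (sq_nonneg _)
  have h1 : ∑ u, ∑ v, a u v * (h u - h v) ^ 2 = 0 := by linarith
  rw [Finset.sum_eq_zero_iff_of_nonneg fun u _ => Finset.sum_nonneg fun v _ => nn u v] at h1
  have h2 := h1 u (Finset.mem_univ _)
  rw [Finset.sum_eq_zero_iff_of_nonneg fun v _ => nn u v] at h2
  have h3 := h2 v (Finset.mem_univ _)
  rcases mul_eq_zero.1 h3 with h4 | h4
  · exact absurd h4 huv.ne'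
  · have := pow_eq_zero_iff (two_ne_zero) |>.1 h4
    linarith

lemma sum_lapOp (ha : IsNet a) (h : V → ℝ) : ∑ v, lapOp a h v = 0 := by
  have : ∑ v, lapOp a h v = - ∑ v, lapOp a h v := by
    simp only [lapOp, ← Finset.sum_neg_distrib]
    rw [Finset.sum_comm]
    exact Finset.sum_congr rfl fun u _ => Finset.sum_congr rfl fun v _ => by rw [ha.symm]; ring
  linarith

lemma dirLap_isSymm (ha : IsNet a) (S : Finset V) (u v : V) : dirLap a S u v = dirLap a S v u := by
  simp only [dirLap, Matrix.of_apply]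
  by_cases huv : u = v
  · subst huv; rfl
  · simp [huv, Ne.symm huv, ha.symm u v, or_comm]

lemma dirLap_posDef (ha : IsNet a) {S : Finset V} (hS : S.Nonempty) : (dirLap a S).PosDef := by
  refine Matrix.PosDef.of_dotProduct_mulVec_pos ?_ ?_
  · ext u v
    simp [Matrix.conjTranspose_apply, ha.dirLap_isSymm S u v]
  · intro x hx
    set h : V → ℝ := fun w => if w ∈ S then 0 else x w with hh
    have key : star x ⬝ᵥ (dirLap a S).mulVec x =
        ∑ v ∈ S, x v ^ 2 + ∑ v, h v * lapOp a h v := by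
      rw [dotProduct, ← Finset.sum_filter_add_sum_filter_not Finset.univ (· ∈ S)]
      congr 1
      · rw [Finset.filter_mem_eq_inter, Finset.univ_inter]
        refine Finset.sum_congr rfl fun v hv => ?_
        rw [dirLap_mulVec_of_mem _ _ _ hv]; simp [sq]
      · rw [Finset.sum_filter]
        refine Finset.sum_congr rfl fun v _ => ?_
        by_cases hv : v ∈ S
        · simp [hv, hh]
        · rw [dirLap_mulVec_of_notMem _ _ _ hv]; simp [hv, hh]
    rw [key]
    have h1 : 0 ≤ ∑ v ∈ S, x v ^ 2 := Finset.sum_nonneg fun _ _ => sq_nonneg _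
    have h2 := ha.sum_mul_lapOp_nonneg h
    by_contra hcon
    have h3 : ∑ v ∈ S, x v ^ 2 = 0 := by linarith
    have h4 : ∑ v, h v * lapOp a h v = 0 := by linarith
    rw [Finset.sum_eq_zero_iff_of_nonneg fun _ _ => sq_nonneg _] at h3
    obtain ⟨s, hs⟩ := hS
    apply hx
    funext v
    by_cases hv : v ∈ S
    · simpa using h3 v hv
    · have := ha.eq_of_sum_mul_lapOp_eq_zero h h4 v s
      simpa [hh, hv, hs] using this

end IsNet

/-- The Green function with Dirichlet boundary condition on `S`. -/
def green (a : V → V → ℝ) (S : Finset V) : Matrix V V ℝ := (dirLap a S)⁻¹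

namespace IsNet

variable {a : V → V → ℝ}

lemma green_posDef (ha : IsNet a) {S : Finset V} (hS : S.Nonempty) : (green a S).PosDef :=
  (ha.dirLap_posDef hS).inv

lemma isUnit_det (ha : IsNet a) {S : Finset V} (hS : S.Nonempty) : IsUnit (dirLap a S).det :=
  (ha.dirLap_posDef hS).det_pos.ne'.isUnit

lemma green_symm (ha : IsNet a) {S : Finset V} (hS : S.Nonempty) (u v : V) :
    green a S u v = green a S v u := by
  have := (ha.green_posDef hS).isHermitian.apply u v
  simpa using this.symm

lemma green_pos (ha : IsNet a) {S : Finset V} (hS : S.Nonempty) (u : V) : 0 < green a S u u :=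
  (ha.green_posDef hS).diag_pos

lemma green_eq_of (ha : IsNet a) {S : Finset V} (hS : S.Nonempty) {y : V} (hy : y ∉ S) (h : V → ℝ)
    (h0 : ∀ v ∈ S, h v = 0) (h1 : ∀ v ∉ S, lapOp a h v = if v = y then 1 else 0) (v : V) :
    green a S v y = h v := by
  have e : (dirLap a S).mulVec h = Pi.single y 1 := by
    funext v
    by_cases hv : v ∈ S
    · rw [dirLap_mulVec_of_mem _ _ _ hv, h0 v hv, Pi.single_apply, if_neg]
      rintro rfl; exact hy hv
    · rw [dirLap_mulVec_of_notMem _ _ _ hv, Pi.single_apply, ← h1 v hv]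
      congr 1
      funext w
      by_cases hw : w ∈ S <;> simp [hw, h0]
  have : (green a S).mulVec ((dirLap a S).mulVec h) = h := by
    rw [Matrix.mulVec_mulVec, green, Matrix.nonsing_inv_mul _ (ha.isUnit_det hS), Matrix.one_mulVec]
  rw [e] at this
  rw [← this]
  simp

lemma dirLap_mulVec_green (ha : IsNet a) {S : Finset V} (hS : S.Nonempty) (y v : V) :
    (dirLap a S).mulVec (fun w => green a S w y) v = if v = y then 1 else 0 := by
  have := Matrix.mul_nonsing_inv _ (ha.isUnit_det hS)
  have := congrFun (congrFun this v) y
  rw [Matrix.one_apply] at this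
  rw [← this]
  rfl

lemma green_of_mem (ha : IsNet a) {S : Finset V} (hS : S.Nonempty) {y v : V} (hv : v ∈ S) :
    green a S v y = if v = y then 1 else 0 := by
  rw [← ha.dirLap_mulVec_green hS y v, dirLap_mulVec_of_mem _ _ _ hv]

lemma green_eq_zero (ha : IsNet a) {S : Finset V} (hS : S.Nonempty)
    {y v : V} (hv : v ∈ S) (hy : y ∉ S) :
    green a S v y = 0 := by
  rw [ha.green_of_mem hS hv, if_neg]
  rintro rfl; exact hy hv

lemma lapOp_green (ha : IsNet a) {S : Finset V} (hS : S.Nonempty)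
    {y v : V} (hy : y ∉ S) (hv : v ∉ S) :
    lapOp a (fun w => green a S w y) v = if v = y then 1 else 0 := by
  rw [← ha.dirLap_mulVec_green hS y v, dirLap_mulVec_of_notMem _ _ _ hv]
  congr 1
  funext w
  by_cases hw : w ∈ S
  · simp [hw, ha.green_eq_zero hS hw hy]
  · simp [hw]

lemma green_insert (ha : IsNet a) {S : Finset V} (hS : S.Nonempty) {u x y : V} (hu : u ∉ S)
    (hy : y ∉ S) (hyu : y ≠ u) :
    green a (insert u S) x y = green a S x y - green a S x u * (green a S u y / green a S u u) := by
  have hpos := ha.green_pos hS u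
  refine ha.green_eq_of (Finset.insert_nonempty u S) (by simp [hyu, hy])
    (fun v => green a S v y - green a S v u * (green a S u y / green a S u u)) ?_ ?_ x
  · intro v hv
    rcases Finset.mem_insert.1 hv with rfl | hv
    · field_simp; ring
    · simp [ha.green_eq_zero hS hv hy, ha.green_eq_zero hS hv hu]
  · intro v hv
    simp only [Finset.mem_insert, not_or] at hv
    rw [lapOp_sub, lapOp_mul_const, ha.lapOp_green hS hy hv.2, ha.lapOp_green hS hu hv.2]
    simp [hv.1]

lemma green_insert_le (ha : IsNet a) {S : Finset V} (hS : S.Nonempty) {u y : V} (hu : u ∉ S)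
    (hy : y ∉ S) (hyu : y ≠ u) : green a (insert u S) y y ≤ green a S y y := by
  rw [ha.green_insert hS hu hy hyu, ha.green_symm hS y u]
  have := ha.green_pos hS u
  have : 0 ≤ green a S u y * (green a S u y / green a S u u) := by
    rw [← mul_div_assoc]; exact div_nonneg (mul_self_nonneg _) this.le
  linarith

lemma green_mono (ha : IsNet a) {S S' : Finset V} (hS : S.Nonempty) (hSS' : S ⊆ S')
    {y : V} (hy : y ∉ S') :
    green a S' y y ≤ green a S y y := by
  have key : ∀ T : Finset V, y ∉ S ∪ T → green a (S ∪ T) y y ≤ green a S y y := by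
    intro T
    induction T using Finset.induction_on with
    | empty => simp
    | insert u T huT ih =>
      intro hy
      rw [Finset.union_insert] at hy ⊢
      simp only [Finset.mem_insert, not_or] at hy
      by_cases hu : u ∈ S ∪ T
      · rw [Finset.insert_eq_of_mem hu]
        exact ih hy.2
      · exact (ha.green_insert_le (hS.mono Finset.subset_union_left) hu hy.2 hy.1).trans (ih hy.2)
  have := key S'
  rw [Finset.union_eq_right.2 hSS'] at this
  exact this hy

lemma green_sq_le (ha : IsNet a) {S : Finset V} (hS : S.Nonempty) (u w : V) :
    green a S u w ^ 2 ≤ green a S u u * green a S w w := by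
  have h := ((ha.green_posDef hS).posSemidef.submatrix ![u, w]).det_nonneg
  rw [Matrix.det_fin_two] at h
  simp only [Matrix.submatrix_apply, Matrix.cons_val_zero, Matrix.cons_val_one] at h
  rw [ha.green_symm hS w u] at h
  linarith [sq (green a S u w)]

lemma det_dirLap_insert (ha : IsNet a) {S : Finset V} (hS : S.Nonempty) {u : V} :
    (dirLap a (insert u S)).det = (dirLap a S).det * green a S u u := by
  have h1 : (dirLap a S).det * green a S u u =
      ((dirLap a S).updateRow u (Pi.single u 1)).det := by
    rw [← Matrix.adjugate_apply, green, Matrix.inv_def]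
    have := (ha.dirLap_posDef hS).det_pos.ne'
    simp only [Ring.inverse_eq_inv', Matrix.smul_apply, smul_eq_mul]
    field_simp
  set B := (dirLap a S).updateRow u (Pi.single u 1) with hB
  have h2 : B.det = (B.updateCol u (Pi.single u 1)).det := by
    have e1 : B.adjugate u u = B.det := by
      rw [Matrix.adjugate_apply, hB, Matrix.updateRow_idem]
    have e2 : B.adjugate u u = (B.updateCol u (Pi.single u 1)).det := by
      rw [← Matrix.transpose_apply B.adjugate, Matrix.adjugate_transpose, Matrix.adjugate_apply,
        Matrix.updateRow_transpose, Matrix.det_transpose]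
    rw [← e1, e2]
  rw [h1, h2]
  congr 1
  ext i j
  simp only [hB, Matrix.updateCol_apply, Matrix.updateRow_apply, dirLap, Matrix.of_apply,
    Finset.mem_insert, Pi.single_apply]
  by_cases hj : j = u
  · subst hj; simp
  · by_cases hi : i = u
    · subst hi; simp [hj, Ne.symm hj]
    · simp [hi, hj]

end IsNet

/-! ### Effective resistances -/

/-- Total weight at a vertex. -/
def cond (a : V → V → ℝ) (v : V) : ℝ := ∑ w, a v w

/-- Effective resistance between two vertices. -/
def effRes (a : V → V → ℝ) (u v : V) : ℝ := if u = v then 0 else green a {u} v v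

/-- Deviation of the effective resistance from its value when both endpoints are joined to a
common short-circuited background. -/
def excess (a : V → V → ℝ) (u v : V) : ℝ := effRes a u v - 1 / cond a u - 1 / cond a v

/-- A symmetric potential kernel for the Laplacian, with all sinks at `ρ`. -/
structure IsPotential (a g : V → V → ℝ) (ρ : V) : Prop where
  symm : ∀ u v, g u v = g v u
  lap : ∀ y v, lapOp a (fun w => g w y) v =
    (if v = y then 1 else 0) - if v = ρ then 1 else 0

lemma effRes_self (a : V → V → ℝ) (u : V) : effRes a u u = 0 := by simp [effRes]

lemma effRes_of_ne (a : V → V → ℝ) {u v : V} (h : u ≠ v) : effRes a u v = green a {u} v v := by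
  simp [effRes, h]

lemma half_sum_ge_of_symm (F : V → V → ℝ) (hs : ∀ u v, F u v = F v u) (h0 : ∀ u v, 0 ≤ F u v)
    (hd : ∀ u, F u u = 0) {i j : V} (hij : i ≠ j) :
    ∑ w, F j w + ∑ u, F i u - F i j ≤ (1 / 2) * ∑ u, ∑ v, F u v := by
  have h1 : ∑ u, ∑ v, ((if u = i then F u v else 0) + (if u = j then F u v else 0)
      + (if v = i then F u v else 0) + (if v = j then F u v else 0)
      - (if u = i then if v = j then F u v else 0 else 0)
      - (if u = j then if v = i then F u v else 0 else 0)) ≤ ∑ u, ∑ v, F u v := by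
    refine Finset.sum_le_sum fun u _ => Finset.sum_le_sum fun v _ => ?_
    have := h0 u v
    by_cases h1 : u = i <;> by_cases h2 : u = j <;> by_cases h3 : v = i <;> by_cases h4 : v = j <;>
      simp_all
  simp only [Finset.sum_add_distrib, Finset.sum_sub_distrib] at h1
  have e1 : ∀ i, ∑ u, ∑ v, (if u = i then F u v else 0) = ∑ v, F i v := by
    intro i
    rw [Finset.sum_comm]; simp
  have e2 : ∀ i, ∑ u, ∑ v, (if v = i then F u v else 0) = ∑ v, F i v := by
    intro i
    simp [hs _ i]
  have e3 : ∀ i j, ∑ u, ∑ v, (if u = i then if v = j then F u v else 0 else 0) = F i j := by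
    intro i j
    rw [Finset.sum_eq_single i] <;> simp +contextual
  rw [e1, e1, e2, e2, e3, e3, hs j i] at h1
  linarith

namespace IsNet

variable {a : V → V → ℝ}

lemma exists_isPotential (ha : IsNet a) (ρ : V) : ∃ g, IsPotential a g ρ := by
  have hne : ({ρ} : Finset V).Nonempty := Finset.singleton_nonempty ρ
  refine ⟨fun u v => if u = ρ ∨ v = ρ then 0 else green a {ρ} u v, ?_, ?_⟩
  · intro u v
    simp only [or_comm, ha.green_symm hne u v]
  · intro y v
    by_cases hy : y = ρ
    · subst hy
      simp [lapOp]
    · have e : (fun w => if w = ρ ∨ y = ρ then 0 else green a {ρ} w y) =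
          fun w => green a {ρ} w y := by
        funext w
        by_cases hw : w = ρ
        · subst hw
          simp [ha.green_eq_zero hne (Finset.mem_singleton_self w) (by simpa using hy)]
        · simp [hw, hy]
      rw [e]
      by_cases hv : v = ρ
      · subst hv
        have h0 := ha.sum_lapOp (fun w => green a {v} w y)
        rw [← Finset.add_sum_erase _ _ (Finset.mem_univ v)] at h0
        have : ∑ x ∈ Finset.univ.erase v, lapOp a (fun w => green a {v} w y) x =
            ∑ x ∈ Finset.univ.erase v, if x = y then 1 else 0 := by
          refine Finset.sum_congr rfl fun x hx => ?_
          exact ha.lapOp_green hne (by simpa using hy) (by simpa using hx)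
        rw [this] at h0
        simp [hy] at h0
        simp [Ne.symm hy]
        linarith
      · rw [ha.lapOp_green hne (by simpa using hy) (by simpa using hv)]
        simp [hv]

lemma green_singleton (ha : IsNet a) {g : V → V → ℝ} {ρ : V} (hg : IsPotential a g ρ) {i x : V}
    (hx : x ≠ i) (v : V) : green a {i} v x = g v x - g v i - (g i x - g i i) := by
  refine ha.green_eq_of (Finset.singleton_nonempty i) (by simpa using hx)
    (fun v => g v x - g v i - (g i x - g i i)) ?_ ?_ v
  · intro v hv
    rw [Finset.mem_singleton.1 hv]; ring
  · intro v hv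
    rw [lapOp_sub_const, lapOp_sub, hg.lap, hg.lap]
    simp at hv
    simp [hv]

lemma effRes_eq (ha : IsNet a) {g : V → V → ℝ} {ρ : V} (hg : IsPotential a g ρ) (u v : V) :
    effRes a u v = g u u + g v v - 2 * g u v := by
  by_cases h : u = v
  · subst h; rw [effRes_self]; ring
  · rw [effRes_of_ne _ h, ha.green_singleton hg (Ne.symm h), hg.symm v u]; ring

lemma effRes_comm (ha : IsNet a) (u v : V) : effRes a u v = effRes a v u := by
  obtain ⟨g, hg⟩ := ha.exists_isPotential u
  rw [ha.effRes_eq hg, ha.effRes_eq hg, hg.symm u v]; ring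

lemma excess_comm (ha : IsNet a) (u v : V) : excess a u v = excess a v u := by
  rw [excess, excess, ha.effRes_comm]; ring

lemma effRes_nonneg (ha : IsNet a) (u v : V) : 0 ≤ effRes a u v := by
  by_cases h : u = v
  · subst h; rw [effRes_self]
  · rw [effRes_of_ne _ h]
    exact (ha.green_pos (Finset.singleton_nonempty u) v).le

lemma green_singleton_eq (ha : IsNet a) {i x v : V} (hx : x ≠ i) :
    green a {i} v x = (effRes a i x + effRes a i v - effRes a x v) / 2 := by
  obtain ⟨g, hg⟩ := ha.exists_isPotential i
  rw [ha.green_singleton hg hx, ha.effRes_eq hg, ha.effRes_eq hg, ha.effRes_eq hg, hg.symm x v,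
    hg.symm v i]
  ring

lemma excess_eq (ha : IsNet a) {i j : V} (hij : i ≠ j) (w : V) :
    excess a i w = excess a i j + excess a j w + 2 * (1 / cond a j - green a {j} w i) := by
  rw [ha.green_singleton_eq hij, excess, excess, excess, ha.effRes_comm i j]
  ring

/-- Foster's theorem. -/
lemma sum_mul_effRes [Nonempty V] (ha : IsNet a) :
    ∑ u, ∑ v, a u v * effRes a u v = 2 * (Fintype.card V - 1 : ℝ) := by
  obtain ⟨ρ⟩ := ‹Nonempty V›
  obtain ⟨g, hg⟩ := ha.exists_isPotential ρ
  have h1 : ∑ y, lapOp a (fun w => g w y) y = (Fintype.card V - 1 : ℝ) := by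
    simp [hg.lap, Finset.sum_sub_distrib]
  have h2 : ∑ y, lapOp a (fun w => g w y) y = ∑ u, ∑ v, a u v * (g u u - g v u) := rfl
  have h3 : ∑ y, lapOp a (fun w => g w y) y = ∑ u, ∑ v, a u v * (g v v - g u v) := by
    rw [h2, Finset.sum_comm]
    exact Finset.sum_congr rfl fun u _ => Finset.sum_congr rfl fun v _ => by rw [ha.symm]
  have h4 : ∑ u, ∑ v, a u v * effRes a u v = ∑ u, ∑ v, a u v * (g u u - g v u) +
      ∑ u, ∑ v, a u v * (g v v - g u v) := by
    simp only [← Finset.sum_add_distrib]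
    refine Finset.sum_congr rfl fun u _ => Finset.sum_congr rfl fun v _ => ?_
    rw [ha.effRes_eq hg, hg.symm v u]; ring
  rw [h4, ← h2, ← h3, h1]; ring

lemma energy_green (ha : IsNet a) {i j : V} (hij : i ≠ j) :
    (1 / 2) * ∑ u, ∑ v, a u v * (green a {j} u i - green a {j} v i) ^ 2 = effRes a i j := by
  rw [← ha.sum_mul_lapOp, ha.effRes_comm, effRes_of_ne _ hij.symm]
  have hne := Finset.singleton_nonempty j
  have hij' : i ∉ ({j} : Finset V) := by simpa using hij
  rw [Finset.sum_eq_single i]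
  · rw [ha.lapOp_green hne hij' hij']; simp
  · intro v _ hv
    by_cases hvj : v = j
    · subst hvj
      rw [ha.green_eq_zero hne (by simp) hij']; simp
    · rw [ha.lapOp_green hne hij' (by simpa using hvj)]; simp [hv]
  · simp

/-- The potential of the unit current from `i` to `j` is close to `1 / cond a j` on the neighbours
of `j` as soon as the effective resistance is close to its lower bound. -/
lemma sum_mul_green_sub_sq_le (ha : IsNet a) {i j : V} (hij : i ≠ j) (hi : 0 < cond a i)
    (hj : 0 < cond a j) :
    ∑ w, a j w * (green a {j} w i - 1 / cond a j) ^ 2 ≤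
      excess a i j + a i j * effRes a i j ^ 2 := by
  have hne := Finset.singleton_nonempty j
  have hij' : i ∉ ({j} : Finset V) := by simpa using hij
  set h : V → ℝ := fun v => green a {j} v i with hh
  have hhj : h j = 0 := ha.green_eq_zero hne (by simp) hij'
  have hhi : h i = effRes a i j := by rw [ha.effRes_comm, effRes_of_ne _ hij.symm]
  have lap_i : ∑ u, a i u * (h i - h u) = 1 := by
    have := ha.lapOp_green hne hij' hij'
    simpa [lapOp] using this
  have lap_j : ∑ w, a j w * h w = 1 := by
    have h0 := ha.sum_lapOp h
    rw [← Finset.add_sum_erase _ _ (Finset.mem_univ j)] at h0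
    have : ∑ x ∈ Finset.univ.erase j, lapOp a h x =
        ∑ x ∈ Finset.univ.erase j, if x = i then 1 else 0 := by
      refine Finset.sum_congr rfl fun x hx => ?_
      exact ha.lapOp_green hne hij' (by simpa using hx)
    rw [this] at h0
    simp [hij] at h0
    rw [lapOp_eq, hhj] at h0
    linarith
  have key := half_sum_ge_of_symm (fun u v => a u v * (h u - h v) ^ 2)
    (fun u v => by rw [ha.symm]; ring) (fun u v => mul_nonneg (ha.nonneg u v) (sq_nonneg _))
    (fun u => by simp) hij
  rw [ha.energy_green hij] at key
  simp only [hhj, hhi] at key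
  have hstar : 1 / cond a i ≤ ∑ u, a i u * (effRes a i j - h u) ^ 2 := by
    have h0 : 0 ≤ ∑ u, a i u * (effRes a i j - h u - 1 / cond a i) ^ 2 :=
      Finset.sum_nonneg fun u _ => mul_nonneg (ha.nonneg _ _) (sq_nonneg _)
    have e : ∑ u, a i u * (effRes a i j - h u - 1 / cond a i) ^ 2 =
        ∑ u, a i u * (effRes a i j - h u) ^ 2 - 2 / cond a i * ∑ u, a i u * (h i - h u)
          + (1 / cond a i) ^ 2 * ∑ u, a i u := by
      rw [Finset.mul_sum, Finset.mul_sum, ← Finset.sum_sub_distrib, ← Finset.sum_add_distrib]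
      refine Finset.sum_congr rfl fun u _ => ?_
      rw [hhi]; ring
    rw [lap_i, show ∑ u, a i u = cond a i from rfl] at e
    have : (1 / cond a i) ^ 2 * cond a i = 1 / cond a i := by field_simp
    rw [e, this] at h0
    have : 2 / cond a i = 2 * (1 / cond a i) := by ring
    linarith
  have e2 : ∑ w, a j w * (h w - 1 / cond a j) ^ 2 =
      ∑ w, a j w * (0 - h w) ^ 2 - 2 / cond a j * ∑ w, a j w * h w
        + (1 / cond a j) ^ 2 * ∑ w, a j w := by
    rw [Finset.mul_sum, Finset.mul_sum, ← Finset.sum_sub_distrib, ← Finset.sum_add_distrib]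
    exact Finset.sum_congr rfl fun w _ => by ring
  rw [lap_j, show ∑ u, a j u = cond a j from rfl] at e2
  have : (1 / cond a j) ^ 2 * cond a j = 1 / cond a j := by field_simp
  rw [this] at e2
  rw [e2, excess]
  have : 2 / cond a j = 2 * (1 / cond a j) := by ring
  simp only [sub_zero] at key
  linarith

lemma mul_effRes_sq_le (ha : IsNet a) (i j : V) : a i j * effRes a i j ^ 2 ≤ effRes a i j := by
  by_cases hij : i = j
  · subst hij; simp [effRes_self]
  have hne := Finset.singleton_nonempty j
  have hij' : i ∉ ({j} : Finset V) := by simpa using hij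
  have key := half_sum_ge_of_symm
    (fun u v => a u v * (green a {j} u i - green a {j} v i) ^ 2)
    (fun u v => by rw [ha.symm]; ring) (fun u v => mul_nonneg (ha.nonneg u v) (sq_nonneg _))
    (fun u => by simp) hij
  rw [ha.energy_green hij] at key
  have h1 : ∀ u v, 0 ≤ a u v * (green a {j} u i - green a {j} v i) ^ 2 :=
    fun u v => mul_nonneg (ha.nonneg u v) (sq_nonneg _)
  have h2 := Finset.single_le_sum (fun v _ => h1 i v) (Finset.mem_univ j)
  have h3 := Finset.single_le_sum (fun v _ => h1 j v) (Finset.mem_univ i)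
  have z : green a {j} j i = 0 := ha.green_eq_zero hne (by simp) hij'
  rw [z, ha.symm j i] at h3
  rw [z] at h2 key
  have e : green a {j} i i = effRes a i j := by rw [ha.effRes_comm, effRes_of_ne _ (Ne.symm hij)]
  rw [e] at h2 h3 key
  nlinarith

lemma effRes_le_two_mul (ha : IsNet a) (i j k : V) :
    effRes a i k ≤ 2 * effRes a i j + 2 * effRes a j k := by
  by_cases hij : i = j
  · subst hij
    have := ha.effRes_nonneg i k
    rw [effRes_self]; linarith
  by_cases hkj : k = j
  · subst hkj
    have := ha.effRes_nonneg i k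
    rw [effRes_self]; linarith
  have h1 := ha.green_sq_le (Finset.singleton_nonempty j) k i
  have h2 := ha.green_singleton_eq (v := k) hij
  rw [← effRes_of_ne a (Ne.symm hkj), ← effRes_of_ne a (Ne.symm hij)] at h1
  have h3 : |green a {j} k i| ≤ (effRes a j k + effRes a j i) / 2 := by
    apply abs_le_of_sq_le_sq
    · nlinarith [sq_nonneg (effRes a j k - effRes a j i)]
    · have := ha.effRes_nonneg j k
      have := ha.effRes_nonneg j i
      linarith
  have := (abs_le.1 h3).1
  rw [ha.effRes_comm i j]
  linarith

lemma green_le_effRes (ha : IsNet a) {S : Finset V} {s u : V} (hs : s ∈ S) (hu : u ∉ S) :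
    green a S u u ≤ effRes a s u := by
  have : s ≠ u := fun h => hu (h ▸ hs)
  rw [effRes_of_ne _ this]
  exact ha.green_mono (Finset.singleton_nonempty s) (Finset.singleton_subset_iff.2 hs) hu

end IsNet

/-! ### Balanced networks -/

/-- Vertices of typical conductance. -/
def core (a : V → V → ℝ) (K : ℝ) : Finset V := univ.filter fun v => cond a v ∈ Set.Icc 1 K

/-- A network which is `δ`-almost balanced at scale one. -/
structure IsBal (a : V → V → ℝ) (K δ : ℝ) : Prop extends IsNet a where
  le : ∀ u v, a u v ≤ δ
  card_core : (1 - δ) * Fintype.card V ≤ (core a K).card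
  sum_cond : ∑ v ∈ univ.filter (fun v => v ∉ core a K), cond a v ≤ δ * Fintype.card V

/-- Restriction of weights to pairs inside `W`. -/
def restr (a : V → V → ℝ) (W : Finset V) (u v : V) : ℝ := if u ∈ W ∧ v ∈ W then a u v else 0

/-- Absolute value of the excess, set to zero on the diagonal. -/
def dev (a : V → V → ℝ) (u v : V) : ℝ := if u = v then 0 else |excess a u v|

lemma dev_nonneg (a : V → V → ℝ) (u v : V) : 0 ≤ dev a u v := by
  unfold dev; split_ifs <;> positivity

lemma dev_of_ne (a : V → V → ℝ) {u v : V} (h : u ≠ v) : dev a u v = |excess a u v| := by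
  simp [dev, h]

lemma dev_self (a : V → V → ℝ) (u : V) : dev a u u = 0 := by simp [dev]

lemma IsNet.dev_comm {a : V → V → ℝ} (ha : IsNet a) (u v : V) : dev a u v = dev a v u := by
  simp [dev, eq_comm, ha.excess_comm u v]

lemma IsNet.cond_nonneg {a : V → V → ℝ} (ha : IsNet a) (v : V) : 0 ≤ cond a v :=
  Finset.sum_nonneg fun w _ => ha.nonneg v w

lemma IsNet.restr_nonneg {a : V → V → ℝ} (ha : IsNet a) (W : Finset V) (u v : V) :
    0 ≤ restr a W u v := by
  unfold restr; split_ifs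
  exacts [ha.nonneg u v, le_rfl]

lemma IsNet.restr_le {a : V → V → ℝ} (ha : IsNet a) (W : Finset V) (u v : V) :
    restr a W u v ≤ a u v := by
  unfold restr; split_ifs
  exacts [le_rfl, ha.nonneg u v]

lemma IsNet.restr_symm {a : V → V → ℝ} (ha : IsNet a) (W : Finset V) (u v : V) :
    restr a W u v = restr a W v u := by
  simp [restr, ha.symm u v, and_comm]

namespace IsBal

variable {a : V → V → ℝ} {K δ : ℝ}

lemma one_le (_ha : IsBal a K δ) {v : V} (hv : v ∈ core a K) : 1 ≤ cond a v := by
  simp only [core, mem_filter] at hv; exact hv.2.1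

lemma le_K (_ha : IsBal a K δ) {v : V} (hv : v ∈ core a K) : cond a v ≤ K := by
  simp only [core, mem_filter] at hv; exact hv.2.2

lemma inv_cond_le (ha : IsBal a K δ) {v : V} (hv : v ∈ core a K) : 1 / cond a v ≤ 1 := by
  have := ha.one_le hv
  rw [div_le_one (by linarith)]; exact this

lemma inv_cond_nonneg (ha : IsBal a K δ) (v : V) : 0 ≤ 1 / cond a v :=
  one_div_nonneg.2 (ha.cond_nonneg v)

lemma delta_nonneg [Nonempty V] (ha : IsBal a K δ) : 0 ≤ δ := by
  obtain ⟨v⟩ := ‹Nonempty V›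
  exact (ha.nonneg v v).trans (ha.le v v)

lemma mul_effRes_sq_le (ha : IsBal a K δ) {i j : V} (hi : i ∈ core a K) (hj : j ∈ core a K) :
    a i j * effRes a i j ^ 2 ≤ 16 * δ + 2 * |excess a i j| := by
  have h1 := ha.toIsNet.mul_effRes_sq_le i j
  have h2 := ha.inv_cond_le hi
  have h3 := ha.inv_cond_le hj
  have h4 := ha.nonneg i j
  have h5 := ha.le i j
  have h6 := ha.effRes_nonneg i j
  have h7 : excess a i j = effRes a i j - 1 / cond a i - 1 / cond a j := rfl
  have h8 := le_abs_self (excess a i j)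
  have h9 := abs_nonneg (excess a i j)
  by_cases h : effRes a i j ≤ 4
  · have : effRes a i j ^ 2 ≤ 16 := by nlinarith
    nlinarith
  · push Not at h
    nlinarith

lemma neg_le_excess (ha : IsBal a K δ) {i j : V} (hij : i ≠ j) (hi : i ∈ core a K)
    (hj : j ∈ core a K) : -(4 * δ) ≤ excess a i j := by
  have h0 := ha.sum_mul_green_sub_sq_le hij (by linarith [ha.one_le hi])
    (by linarith [ha.one_le hj])
  have h1 : 0 ≤ ∑ w, a j w * (green a {j} w i - 1 / cond a j) ^ 2 :=
    Finset.sum_nonneg fun w _ => mul_nonneg (ha.nonneg j w) (sq_nonneg _)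
  have h2 := ha.inv_cond_le hi
  have h3 := ha.inv_cond_le hj
  have h4 := ha.nonneg i j
  have h5 := ha.le i j
  have h6 := ha.effRes_nonneg i j
  have h7 : excess a i j = effRes a i j - 1 / cond a i - 1 / cond a j := rfl
  by_cases h : 0 ≤ excess a i j
  · linarith
  · push Not at h
    have : effRes a i j ^ 2 ≤ 4 := by nlinarith
    nlinarith

/-- On the core the potential of a unit current is nearly constant near the sink. -/
lemma sum_mul_green_sub_sq_le' (ha : IsBal a K δ) {i j : V} (hij : i ≠ j) (hi : i ∈ core a K)
    (hj : j ∈ core a K) :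
    ∑ w, a j w * (green a {j} w i - 1 / cond a j) ^ 2 ≤ 3 * dev a i j + 16 * δ := by
  have h0 := ha.sum_mul_green_sub_sq_le hij (by linarith [ha.one_le hi])
    (by linarith [ha.one_le hj])
  have h1 := ha.mul_effRes_sq_le hi hj
  have := le_abs_self (excess a i j)
  rw [dev_of_ne _ hij]
  linarith

lemma sum_restr_le (ha : IsBal a K δ) (hK : 0 ≤ K) (u : V) :
    ∑ v, restr a (core a K) u v ≤ K := by
  by_cases hu : u ∈ core a K
  · exact (Finset.sum_le_sum fun v _ => ha.restr_le _ u v).trans (ha.le_K hu)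
  · simp [restr, hu, hK]

lemma sum_cross_le (ha : IsBal a K δ) :
    ∑ u ∈ core a K, ∑ v ∈ univ.filter (fun v => v ∉ core a K), a u v ≤ δ * Fintype.card V := by
  rw [Finset.sum_comm]
  refine le_trans (Finset.sum_le_sum fun v _ => ?_) ha.sum_cond
  refine (Finset.sum_le_univ_sum_of_nonneg fun u => ha.nonneg u v).trans (le_of_eq ?_)
  exact Finset.sum_congr rfl fun u _ => ha.symm u v

/-- Foster's theorem shows that the total deviation of effective resistances is small. -/
lemma sum_defect_le [Nonempty V] (ha : IsBal a K δ) (hK : 1 ≤ K) :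
    ∑ u, ∑ v, (if u ∈ core a K ∧ v ∈ core a K then a u v * dev a u v
      else a u v * effRes a u v) ≤ 12 * K * δ * Fintype.card V := by
  set W := core a K with hW
  have hδ := ha.delta_nonneg
  set n : ℝ := (Fintype.card V : ℝ) with hn
  have hn0 : 0 ≤ n := Nat.cast_nonneg _
  have hWn : (W.card : ℝ) ≤ n := by rw [hn]; exact_mod_cast Finset.card_le_univ W
  have h1 : ∀ u v, (if u ∈ W ∧ v ∈ W then a u v * dev a u v else a u v * effRes a u v) ≤
      a u v * effRes a u v + 8 * δ * restr a W u v
        - restr a W u v * (1 / cond a u) - restr a W u v * (1 / cond a v) := by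
    intro u v
    unfold restr
    split_ifs with h
    · by_cases huv : u = v
      · subst huv; simp [ha.loop]
      · have h3 := ha.neg_le_excess huv h.1 h.2
        have h4 := ha.nonneg u v
        have h5 : |excess a u v| ≤ excess a u v + 8 * δ := abs_le.2 ⟨by linarith, by linarith⟩
        rw [dev_of_ne _ huv]
        have h6 := mul_le_mul_of_nonneg_left h5 h4
        have h7 : excess a u v = effRes a u v - 1 / cond a u - 1 / cond a v := rfl
        rw [h7] at h6 ⊢
        linarith
    · simp
  refine (Finset.sum_le_sum fun u _ => Finset.sum_le_sum fun v _ => h1 u v).trans ?_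
  simp only [Finset.sum_sub_distrib, Finset.sum_add_distrib, ← Finset.mul_sum]
  rw [ha.sum_mul_effRes]
  have h2 : ∑ u, ∑ v, restr a W u v * (1 / cond a v) =
        ∑ u, ∑ v, restr a W u v * (1 / cond a u) := by
    rw [Finset.sum_comm]
    exact Finset.sum_congr rfl fun u _ => Finset.sum_congr rfl fun v _ => by
      rw [ha.restr_symm]
  have h3 : ∑ u, ∑ v, restr a W u v ≤ K * n := by
    have e : ∀ u ∈ univ, ∑ v, restr a W u v ≤ K := fun u _ => ha.sum_restr_le (by linarith) u
    refine (Finset.sum_le_sum e).trans ?_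
    simp [hn, mul_comm]
  have h4 : n - 2 * δ * n ≤ ∑ u, ∑ v, restr a W u v * (1 / cond a u) := by
    have e1 : ∀ u ∈ W, 1 - ∑ v ∈ univ.filter (fun v => v ∉ W), a u v ≤
        ∑ v, restr a W u v * (1 / cond a u) := by
      intro u hu
      have h5 := ha.one_le hu
      have h6 : ∑ v, restr a W u v = cond a u - ∑ v ∈ univ.filter (fun v => v ∉ W), a u v := by
        rw [eq_sub_iff_add_eq, cond,
            ← Finset.sum_filter_add_sum_filter_not univ (fun v => v ∈ W) (fun w => a u w)]
        congr 1
        rw [Finset.sum_filter]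
        exact Finset.sum_congr rfl fun v _ => by simp [restr, hu]
      have h7 : 0 ≤ ∑ v ∈ univ.filter (fun v => v ∉ W), a u v :=
        Finset.sum_nonneg fun v _ => ha.nonneg u v
      rw [← Finset.sum_mul, h6, mul_one_div, sub_div, div_self (by linarith)]
      have := div_le_self h7 h5
      linarith
    have e2 : ∑ u ∈ W, ∑ v, restr a W u v * (1 / cond a u) ≤
        ∑ u, ∑ v, restr a W u v * (1 / cond a u) := by
      refine Finset.sum_le_univ_sum_of_nonneg fun u => Finset.sum_nonneg fun v _ => ?_
      exact mul_nonneg (ha.restr_nonneg W u v) (ha.inv_cond_nonneg u)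
    have e3 := Finset.sum_le_sum e1
    rw [Finset.sum_sub_distrib] at e3
    have e4 := ha.sum_cross_le
    have e5 := ha.card_core
    simp only [Finset.sum_const, nsmul_eq_mul, mul_one] at e3
    linarith
  have h5 := mul_le_mul_of_nonneg_left h3 (by positivity : 0 ≤ 8 * δ)
  have h6 : 0 ≤ δ * n := by positivity
  have h7 : 0 ≤ (K - 1) * (δ * n) := by
    have : 0 ≤ K - 1 := by linarith
    positivity
  rw [h2]
  linarith

lemma sum_restr_mul_dev_le [Nonempty V] (ha : IsBal a K δ) (hK : 1 ≤ K) :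
    ∑ u ∈ core a K, ∑ v, restr a (core a K) u v * dev a u v ≤ 12 * K * δ * Fintype.card V := by
  refine le_trans ?_ (ha.sum_defect_le hK)
  refine le_trans (Finset.sum_le_univ_sum_of_nonneg fun u => Finset.sum_nonneg fun v _ =>
    mul_nonneg (ha.restr_nonneg _ u v) (dev_nonneg a u v)) ?_
  refine Finset.sum_le_sum fun u _ => Finset.sum_le_sum fun v _ => ?_
  unfold restr
  split_ifs with h
  · exact le_rfl
  · simpa using mul_nonneg (ha.nonneg u v) (ha.effRes_nonneg u v)

end IsBal

/-- A finite measure `μ` with `W`-valued coordinates `X i` whose marginals are bounded by `M` and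
for which the average deviation between coordinates is at most `ω`. -/
structure Spread (a : V → V → ℝ) (W : Finset V) {Ω ι : Type} [Fintype Ω] (μ : Ω → ℝ)
    (X : ι → Ω → V) (M ω : ℝ) : Prop where
  nonneg : ∀ z, 0 ≤ μ z
  mem : ∀ z, μ z ≠ 0 → ∀ i, X i z ∈ W
  marg : ∀ i (ψ : V → ℝ), (∀ v, 0 ≤ ψ v) → ∑ z, μ z * ψ (X i z) ≤ M * ∑ v ∈ W, ψ v
  dev_le : ∀ i j, ∑ z, μ z * dev a (X i z) (X j z) ≤ ω * Fintype.card V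

namespace Spread

variable {a : V → V → ℝ} {K δ : ℝ} {Ω ι : Type} [Fintype Ω] {μ : Ω → ℝ} {X : ι → Ω → V} {M ω : ℝ}

lemma sum_le {W : Finset V} (h : Spread a W μ X M ω) (hM : 0 ≤ M) (i : ι) :
    ∑ z, μ z ≤ M * Fintype.card V := by
  have := h.marg i (fun _ => 1) (fun _ => zero_le_one)
  simp only [mul_one, Finset.sum_const, nsmul_eq_mul] at this
  refine this.trans (mul_le_mul_of_nonneg_left ?_ hM)
  exact_mod_cast Finset.card_le_univ W

lemma mono {W : Finset V} (h : Spread a W μ X M ω) {ω' : ℝ} (hω : ω ≤ ω') :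
    Spread a W μ X M ω' :=
  ⟨h.nonneg, h.mem, h.marg, fun i j => (h.dev_le i j).trans
    (mul_le_mul_of_nonneg_right hω (Nat.cast_nonneg _))⟩

lemma reindex {W : Finset V} (h : Spread a W μ X M ω) {Ω' ι' : Type} [Fintype Ω'] (e : Ω' ≃ Ω)
    (f : ι' → ι) {μ' : Ω' → ℝ} {X' : ι' → Ω' → V} (hμ : ∀ z, μ' z = μ (e z))
    (hX : ∀ i z, X' i z = X (f i) (e z)) : Spread a W μ' X' M ω := by
  constructor
  · intro z; rw [hμ]; exact h.nonneg _
  · intro z hz i; rw [hX]; rw [hμ] at hz; exact h.mem _ hz _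
  · intro i ψ hψ
    simp only [hμ, hX]
    rw [e.sum_comp (fun z => μ z * ψ (X (f i) z))]
    exact h.marg _ ψ hψ
  · intro i j
    simp only [hμ, hX]
    rw [e.sum_comp (fun z => μ z * dev a (X (f i) z) (X (f j) z))]
    exact h.dev_le _ _

/-- The deviation between an old coordinate and a neighbour of another one. -/
lemma sum_step_le (ha : IsBal a K δ) (hK : 1 ≤ K) {i j : V} (hij : i ≠ j) (hi : i ∈ core a K)
    (hj : j ∈ core a K) {t : ℝ} (ht : 0 < t) :
    ∑ w, restr a (core a K) j w * dev a i w ≤ K * dev a i j +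
      ∑ w, restr a (core a K) j w * dev a j w + (t * K + (3 * dev a i j + 16 * δ) / t) := by
  set W := core a K with hW
  have h1 : ∀ w, restr a W j w * dev a i w ≤ restr a W j w * dev a i j +
      restr a W j w * dev a j w + (t * restr a W j w +
        a j w * (green a {j} w i - 1 / cond a j) ^ 2 / t) := by
    intro w
    have h0 := ha.restr_nonneg W j w
    by_cases hjw : j = w
    · subst hjw
      simp [restr, ha.loop]
    have h2 : dev a i w ≤ dev a i j + dev a j w + 2 * |green a {j} w i - 1 / cond a j| := by
      have h3 := ha.excess_eq hij w
      have e1 : dev a i w ≤ |excess a i w| := by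
        unfold dev; split_ifs
        exacts [abs_nonneg _, le_rfl]
      rw [dev_of_ne a hij, dev_of_ne a hjw]
      refine e1.trans ?_
      rw [h3]
      refine (abs_add_le _ _).trans (add_le_add (abs_add_le _ _) ?_)
      rw [abs_mul, abs_sub_comm]; simp
    set s := green a {j} w i - 1 / cond a j
    have h3 : 2 * |s| ≤ t + s ^ 2 / t := by
      rw [← sq_abs s, ← sub_nonneg]
      have : t + |s| ^ 2 / t - 2 * |s| = (t - |s|) ^ 2 / t := by field_simp; ring
      rw [this]; positivity
    have h4 : restr a W j w * (s ^ 2 / t) ≤ a j w * s ^ 2 / t := by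
      rw [mul_div_assoc]
      exact mul_le_mul_of_nonneg_right (ha.restr_le W j w) (by positivity)
    have h5 := mul_le_mul_of_nonneg_left (h2.trans (add_le_add_right h3 _)) h0
    linarith
  refine (Finset.sum_le_sum fun w _ => h1 w).trans ?_
  simp only [Finset.sum_add_distrib, ← Finset.sum_mul, ← Finset.mul_sum, ← Finset.sum_div]
  have h2 := ha.sum_restr_le (by linarith) j
  have h3 := ha.sum_mul_green_sub_sq_le' hij hi hj
  have h4 := mul_le_mul_of_nonneg_right h2 (dev_nonneg a i j)
  have h5 := mul_le_mul_of_nonneg_left h2 ht.le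
  have h6 := div_le_div_of_nonneg_right h3 ht.le
  linarith

lemma extend [Nonempty V] (ha : IsBal a K δ) (hK : 1 ≤ K)
    (h : Spread a (core a K) μ X M ω) (hM : 0 ≤ M) (j : ι) {t : ℝ} (ht : 0 < t) :
    Spread a (core a K) (fun z : Ω × V => μ z.1 * restr a (core a K) (X j z.1) z.2)
      (fun (o : Option ι) z => o.elim z.2 fun i => X i z.1) (M * K)
      (K * ω + M * (12 * K * δ) + (t * K * M + (3 * ω + 16 * δ * M) / t)) := by
  set W := core a K with hW
  have hδ := ha.delta_nonneg
  set n : ℝ := (Fintype.card V : ℝ) with hn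
  have hn0 : 0 ≤ n := Nat.cast_nonneg _
  have hr := fun u v => ha.restr_nonneg W u v
  have hω : 0 ≤ ω * n := le_trans (Finset.sum_nonneg fun z _ =>
    mul_nonneg (h.nonneg z) (dev_nonneg _ _ _)) (h.dev_le j j)
  have hω' : 0 ≤ ω := by
    by_contra hneg
    push Not at hneg
    have : 0 < n := by rw [hn]; exact_mod_cast Fintype.card_pos
    nlinarith
  have hFoster := ha.sum_restr_mul_dev_le hK
  have hpsi : ∑ z, μ z * ∑ w, restr a W (X j z) w * dev a (X j z) w ≤ M * (12 * K * δ * n) :=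
    (h.marg j (fun v => ∑ w, restr a W v w * dev a v w)
      (fun v => Finset.sum_nonneg fun w _ => mul_nonneg (hr v w) (dev_nonneg a v w))).trans
      (mul_le_mul_of_nonneg_left hFoster hM)
  have hnew : ∀ i, ∑ z, μ z * ∑ w, restr a W (X j z) w * dev a (X i z) w ≤
      (K * ω + M * (12 * K * δ) + (t * K * M + (3 * ω + 16 * δ * M) / t)) * n := by
    intro i
    have e : ∀ z, μ z * ∑ w, restr a W (X j z) w * dev a (X i z) w ≤
        K * (μ z * dev a (X i z) (X j z)) + μ z * (∑ w, restr a W (X j z) w * dev a (X j z) w) +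
          (t * K * μ z + (3 * (μ z * dev a (X i z) (X j z)) + 16 * δ * μ z) / t) := by
      intro z
      have h0 := h.nonneg z
      by_cases hz : μ z = 0
      · simp [hz]
      by_cases hij : X i z = X j z
      · rw [hij, dev_self]
        have : 0 ≤ t * K * μ z + (3 * (μ z * 0) + 16 * δ * μ z) / t := by positivity
        linarith
      · have h1 := mul_le_mul_of_nonneg_left (sum_step_le ha hK hij (h.mem z hz i)
          (h.mem z hz j) ht) h0
        refine h1.trans (le_of_eq ?_)
        field_simp
        ring
    refine (Finset.sum_le_sum fun z _ => e z).trans ?_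
    simp only [Finset.sum_add_distrib, ← Finset.mul_sum, ← Finset.sum_div]
    have h1 := h.dev_le i j
    have h2 := h.sum_le hM j
    have h3 : t * K * ∑ z, μ z ≤ t * K * (M * n) := mul_le_mul_of_nonneg_left h2 (by positivity)
    have h4 : (3 * ∑ z, μ z * dev a (X i z) (X j z) + 16 * δ * ∑ z, μ z) / t ≤
        (3 * (ω * n) + 16 * δ * (M * n)) / t := by
      refine div_le_div_of_nonneg_right ?_ ht.le
      have := mul_le_mul_of_nonneg_left h2 (by positivity : 0 ≤ 16 * δ)
      linarith
    have h5 := mul_le_mul_of_nonneg_left h1 (by linarith : 0 ≤ K)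
    refine (add_le_add (add_le_add h5 hpsi) (add_le_add h3 h4)).trans (le_of_eq ?_)
    rw [← hn]
    field_simp
  constructor
  · exact fun z => mul_nonneg (h.nonneg _) (hr _ _)
  · intro z hz o
    have h1 : μ z.1 ≠ 0 := left_ne_zero_of_mul hz
    have h2 : restr a W (X j z.1) z.2 ≠ 0 := right_ne_zero_of_mul hz
    cases o with
    | none =>
      simp only [Option.elim]
      unfold restr at h2
      by_contra hc
      simp [hc] at h2
    | some i => exact h.mem _ h1 i
  · intro o ψ hψ
    rw [Fintype.sum_prod_type]
    cases o with
    | none =>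
      simp only [Option.elim, mul_assoc, ← Finset.mul_sum]
      refine (h.marg j (fun v => ∑ w, restr a W v w * ψ w)
        (fun v => Finset.sum_nonneg fun w _ => mul_nonneg (hr v w) (hψ w))).trans ?_
      refine mul_le_mul_of_nonneg_left ?_ hM
      refine (Finset.sum_le_univ_sum_of_nonneg fun v => Finset.sum_nonneg fun w _ =>
        mul_nonneg (hr v w) (hψ w)).trans ?_
      rw [Finset.sum_comm, Finset.mul_sum, ← Finset.sum_filter_add_sum_filter_not univ (· ∈ W)]
      have e0 : ∑ w ∈ univ.filter (fun w => w ∉ W), ∑ v, restr a W v w * ψ w = 0 := by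
        refine Finset.sum_eq_zero fun w hw => Finset.sum_eq_zero fun v _ => ?_
        simp at hw
        simp [restr, hw]
      rw [e0, add_zero]
      simp only [Finset.filter_mem_eq_inter, Finset.univ_inter]
      refine Finset.sum_le_sum fun w _ => ?_
      rw [← Finset.sum_mul]
      refine mul_le_mul_of_nonneg_right ?_ (hψ w)
      have := ha.sum_restr_le (by linarith) w
      simpa only [ha.restr_symm _ w] using this
    | some i =>
      simp only [Option.elim]
      have e : ∀ z ∈ univ, ∑ w, μ z * restr a W (X j z) w * ψ (X i z) ≤
          K * (μ z * ψ (X i z)) := by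
        intro z _
        rw [← Finset.sum_mul, ← Finset.mul_sum]
        have := mul_le_mul_of_nonneg_right (ha.sum_restr_le (by linarith) (X j z))
          (mul_nonneg (h.nonneg z) (hψ (X i z)))
        linarith
      refine (Finset.sum_le_sum e).trans ?_
      rw [← Finset.mul_sum]
      have := mul_le_mul_of_nonneg_left (h.marg i ψ hψ) (by linarith : 0 ≤ K)
      linarith
  · intro o o'
    rw [Fintype.sum_prod_type]
    cases o with
    | none =>
      cases o' with
      | none =>
        simp only [Option.elim, dev_self, mul_zero, Finset.sum_const_zero]
        positivity
      | some i =>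
        refine le_trans (le_of_eq ?_) (hnew i)
        simp only [Option.elim, mul_assoc, ← Finset.mul_sum, ha.dev_comm (X i _)]
    | some i =>
      cases o' with
      | none =>
        refine le_trans (le_of_eq ?_) (hnew i)
        simp only [Option.elim, mul_assoc, ← Finset.mul_sum]
      | some i' =>
        simp only [Option.elim]
        have e : ∀ z ∈ univ, ∑ w, μ z * restr a W (X j z) w * dev a (X i z) (X i' z) ≤
            K * (μ z * dev a (X i z) (X i' z)) := by
          intro z _
          rw [← Finset.sum_mul, ← Finset.mul_sum]
          have := mul_le_mul_of_nonneg_right (ha.sum_restr_le (by linarith) (X j z))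
            (mul_nonneg (h.nonneg z) (dev_nonneg a (X i z) (X i' z)))
          linarith
        refine (Finset.sum_le_sum e).trans ?_
        rw [← Finset.mul_sum]
        have h1 := mul_le_mul_of_nonneg_left (h.dev_le i i') (by linarith : 0 ≤ K)
        have h2 : 0 ≤ (M * (12 * K * δ) + (t * K * M + (3 * ω + 16 * δ * M) / t)) * n := by
          positivity
        linarith

end Spread

/-! ### Sums over tuples indexed by a tree -/

/-- Product of weights along the edges of the tree on `{0, …, m}` in which the parent of `j + 1`
is `P j`. -/
def treeProd (P : ℕ → ℕ) (hP : ∀ j, P j ≤ j) (w : ℕ → V → V → ℝ) (m : ℕ) (vv : Fin (m + 1) → V) :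
    ℝ :=
  ∏ j : Fin m, w j (vv ⟨P j, ((hP j).trans_lt j.2).trans (Nat.lt_succ_self m)⟩) (vv j.succ)

lemma treeProd_snoc (P : ℕ → ℕ) (hP : ∀ j, P j ≤ j) (w : ℕ → V → V → ℝ) (m : ℕ)
    (vv : Fin (m + 1) → V) (y : V) :
    treeProd P hP w (m + 1) (Fin.snoc vv y : Fin (m + 2) → V) =
      treeProd P hP w m vv * w m (vv ⟨P m, (hP m).trans_lt (Nat.lt_succ_self m)⟩) y := by
  rw [treeProd, Fin.prod_univ_castSucc]
  have e : ∀ i : ℕ, ∀ h : i < m + 1, ∀ h' : i < m + 2,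
      (Fin.snoc vv y : Fin (m + 2) → V) ⟨i, h'⟩ = vv ⟨i, h⟩ := by
    intro i h h'
    exact Fin.snoc_castSucc (α := fun _ => V) y vv ⟨i, h⟩
  congr 1
  · refine Finset.prod_congr rfl fun j _ => ?_
    congr 1
    · exact e _ _ _
    · exact e _ _ _
  · congr 1
    · exact e _ _ _
    · exact Fin.snoc_last (α := fun _ => V) y vv

lemma sum_snoc (m : ℕ) (f : (Fin (m + 1) → V) → ℝ) :
    ∑ vv, f vv = ∑ vv : Fin m → V, ∑ y, f (Fin.snoc vv y : Fin (m + 1) → V) := by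
  rw [← Fintype.sum_prod_type', ← (Fin.snocEquiv (fun _ : Fin (m + 1) => V)).sum_comp,
    Fintype.sum_prod_type, Finset.sum_comm, Fintype.sum_prod_type]
  rfl

lemma treeProd_nonneg (P : ℕ → ℕ) (hP : ∀ j, P j ≤ j) {w : ℕ → V → V → ℝ}
    (hw : ∀ j u v, 0 ≤ w j u v) (m : ℕ) (vv : Fin (m + 1) → V) : 0 ≤ treeProd P hP w m vv :=
  Finset.prod_nonneg fun _ _ => hw _ _ _

lemma sum_fin_one (f : (Fin (0 + 1) → V) → ℝ) : ∑ vv, f vv = ∑ v, f fun _ => v :=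
  ((Equiv.funUnique (Fin 1) V).symm.sum_comp f).symm

/-- Marginals of tree-indexed sums. -/
lemma sum_treeProd_mul_le (P : ℕ → ℕ) (hP : ∀ j, P j ≤ j) {w : ℕ → V → V → ℝ}
    (hw : ∀ j u v, 0 ≤ w j u v) {K : ℝ} (hK : 0 ≤ K) (I : ℕ → Prop)
    (hI : ∀ j, I (j + 1) → I (P j)) (hrow : ∀ j u, ∑ v, w j u v ≤ K)
    (hcol : ∀ j, I (j + 1) → ∀ v, ∑ u, w j u v ≤ K) (m : ℕ) :
    ∀ i : Fin (m + 1), I i → ∀ ψ : V → ℝ, (∀ v, 0 ≤ ψ v) →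
      ∑ vv, treeProd P hP w m vv * ψ (vv i) ≤ K ^ m * ∑ v, ψ v := by
  induction m with
  | zero =>
    intro i _ ψ _
    rw [sum_fin_one]
    simp [treeProd]
  | succ m ih =>
    intro i hi ψ hψ
    rw [sum_snoc]
    simp only [treeProd_snoc]
    rcases Fin.eq_castSucc_or_eq_last i with ⟨i, rfl⟩ | rfl
    swap
    · simp only [Fin.snoc_last, mul_assoc, ← Finset.mul_sum]
      have hi' : I (P m) := hI m (by simpa using hi)
      refine (ih ⟨P m, (hP m).trans_lt (Nat.lt_succ_self m)⟩ hi' (fun u => ∑ y, w m u y * ψ y)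
        (fun u => Finset.sum_nonneg fun y _ => mul_nonneg (hw _ _ _) (hψ y))).trans ?_
      rw [pow_succ, mul_assoc]
      refine mul_le_mul_of_nonneg_left ?_ (pow_nonneg hK m)
      rw [Finset.sum_comm, Finset.mul_sum]
      refine Finset.sum_le_sum fun y _ => ?_
      rw [← Finset.sum_mul]
      exact mul_le_mul_of_nonneg_right (hcol m (by simpa using hi) y) (hψ y)
    · simp only [Fin.snoc_castSucc]
      have e : ∀ vv ∈ univ, ∑ y, treeProd P hP w m vv *
          w m (vv ⟨P m, (hP m).trans_lt (Nat.lt_succ_self m)⟩) y * ψ (vv i) ≤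
          K * (treeProd P hP w m vv * ψ (vv i)) := by
        intro vv _
        rw [← Finset.sum_mul, ← Finset.mul_sum]
        have := mul_le_mul_of_nonneg_right
          (hrow m (vv ⟨P m, (hP m).trans_lt (Nat.lt_succ_self m)⟩))
          (mul_nonneg (treeProd_nonneg P hP hw m vv) (hψ (vv i)))
        linarith
      refine (Finset.sum_le_sum e).trans ?_
      rw [← Finset.mul_sum, pow_succ]
      have := mul_le_mul_of_nonneg_left (ih i hi ψ hψ) hK
      linarith

/-- The weight of an embedded tree inside `W`. -/
def coreWeight (a : V → V → ℝ) (W : Finset V) (P : ℕ → ℕ) (hP : ∀ j, P j ≤ j) (m : ℕ)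
    (vv : Fin (m + 1) → V) : ℝ :=
  (if vv 0 ∈ W then 1 else 0) * treeProd P hP (fun _ => restr a W) m vv

/-- In an almost balanced network the coordinates of a random embedded tree have small deviation. -/
lemma exists_spread (K : ℝ) (hK : 1 ≤ K) (m : ℕ) : ∀ η > 0, ∃ δ₀ > 0,
    ∀ (V : Type) [Fintype V] [DecidableEq V] [Nonempty V] (a : V → V → ℝ) (δ : ℝ), δ ≤ δ₀ →
      IsBal a K δ → ∀ (P : ℕ → ℕ) (hP : ∀ j, P j ≤ j),
      Spread a (core a K) (coreWeight a (core a K) P hP m) (fun (i : Fin (m + 1)) vv => vv i)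
        (K ^ m) η := by
  induction m with
  | zero =>
    intro η hη
    refine ⟨1, one_pos, ?_⟩
    intro V _ _ _ a δ hδ ha P hP
    have e : ∀ i : Fin (0 + 1), i = 0 := fun i => Fin.ext (by omega)
    constructor
    · intro vv
      simp only [coreWeight, treeProd, Finset.univ_eq_empty, Finset.prod_empty, mul_one]
      split_ifs <;> norm_num
    · intro vv h i
      rw [e i]
      by_contra hc
      simp [coreWeight, hc] at h
    · intro i ψ hψ
      rw [sum_fin_one]
      simp [coreWeight, treeProd]
    · intro i j
      rw [e i, e j]
      simp only [dev_self, mul_zero, Finset.sum_const_zero]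
      positivity
  | succ m ih =>
    intro η hη
    have hM : 0 < K ^ m := by positivity
    have hK0 : 0 < K := by linarith
    set t := η / (4 * K * K ^ m) with ht
    have htp : 0 < t := by positivity
    set ω := min (η / (8 * K)) (η * t / 24) with hω
    have hωp : 0 < ω := lt_min (by positivity) (by positivity)
    obtain ⟨δ₁, hδ₁, h⟩ := ih ω hωp
    refine ⟨min δ₁ (min (η / (48 * K ^ m * K)) (t * η / (64 * K ^ m))),
      lt_min hδ₁ (lt_min (by positivity) (by positivity)), ?_⟩
    intro V _ _ _ a δ hδ ha P hP
    have h1 := (h V a δ (hδ.trans (min_le_left _ _)) ha P hP).extend ha hK hM.le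
      ⟨P m, (hP m).trans_lt (Nat.lt_succ_self m)⟩ htp
    have hδ2 := (hδ.trans (min_le_right _ _)).trans (min_le_left _ _)
    have hδ3 := (hδ.trans (min_le_right _ _)).trans (min_le_right _ _)
    have h2 : K * ω + K ^ m * (12 * K * δ) +
        (t * K * K ^ m + (3 * ω + 16 * δ * K ^ m) / t) ≤ η := by
      have e1 : K * ω ≤ η / 8 := by
        have := min_le_left (η / (8 * K)) (η * t / 24)
        rw [← hω, le_div_iff₀ (by positivity)] at this
        linarith
      have e2 : 3 * ω / t ≤ η / 8 := by
        have := min_le_right (η / (8 * K)) (η * t / 24)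
        rw [← hω] at this
        rw [div_le_iff₀ htp]
        linarith
      have e3 : K ^ m * (12 * K * δ) ≤ η / 4 := by
        rw [le_div_iff₀ (by positivity)] at hδ2
        linarith
      have e4 : 16 * δ * K ^ m / t ≤ η / 4 := by
        rw [le_div_iff₀ (by positivity)] at hδ3
        rw [div_le_iff₀ htp]
        linarith
      have e5 : t * K * K ^ m = η / 4 := by
        rw [ht]; field_simp
      rw [add_div]
      linarith
    rw [pow_succ]
    refine (h1.mono h2).reindex ((Fin.snocEquiv (fun _ : Fin (m + 2) => V)).symm.trans
      (Equiv.prodComm _ _)) (fun i => Fin.lastCases none some i) ?_ ?_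
    · intro vv
      obtain ⟨⟨y, uu⟩, rfl⟩ := (Fin.snocEquiv (fun _ : Fin (m + 2) => V)).surjective vv
      simp only [Equiv.trans_apply, Equiv.symm_apply_apply, Equiv.prodComm_apply, Prod.swap]
      have e0 : (Fin.snocEquiv (fun _ : Fin (m + 2) => V)) (y, uu) 0 = uu 0 :=
        Fin.snoc_castSucc (α := fun _ => V) y uu 0
      unfold coreWeight
      rw [e0, mul_assoc]
      congr 1
      exact treeProd_snoc P hP (fun _ => restr a (core a K)) m uu y
    · intro i vv
      obtain ⟨⟨y, uu⟩, rfl⟩ := (Fin.snocEquiv (fun _ : Fin (m + 2) => V)).surjective vv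
      simp only [Equiv.trans_apply, Equiv.symm_apply_apply, Equiv.prodComm_apply, Prod.swap]
      refine Fin.lastCases ?_ (fun i => ?_) i
      · simp [Fin.snocEquiv]
      · simp [Fin.snocEquiv]

/-! ### Green functions of well spread sets -/

lemma abs_mul_div_sub_le {K e q r s q₀ r₀ s₀ : ℝ} (hK : 1 ≤ K) (he : e ≤ 1) (he' : e ≤ 1 / (2 * K))
    (hq₀ : |q₀| ≤ 1) (hr₀ : |r₀| ≤ 1) (hs₀ : 1 / K ≤ s₀) (hq : |q - q₀| ≤ e) (hr : |r - r₀| ≤ e)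
    (hs : |s - s₀| ≤ e) : |q * (r / s) - q₀ * (r₀ / s₀)| ≤ 8 * K ^ 2 * e := by
  have hK0 : 0 < K := by linarith
  have he0 : 0 ≤ e := (abs_nonneg _).trans hq
  have h1 : 1 / (2 * K) ≤ s := by
    have := (abs_le.1 hs).1
    have e1 : 1 / K = 1 / (2 * K) + 1 / (2 * K) := by field_simp; norm_num
    linarith
  have hs0 : 0 < s := lt_of_lt_of_le (by positivity) h1
  have hs₀0 : 0 < s₀ := lt_of_lt_of_le (by positivity) hs₀
  have h2 : 1 / s ≤ 2 * K := by
    rw [div_le_iff₀ hs0]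
    rw [div_le_iff₀ (by positivity)] at h1
    linarith
  have h3 : 1 / s₀ ≤ K := by
    rw [div_le_iff₀ hs₀0]
    rw [div_le_iff₀ (by positivity)] at hs₀
    linarith
  have h4 : q * (r / s) - q₀ * (r₀ / s₀) =
      ((q - q₀) * r₀ + (q - q₀) * (r - r₀) + q₀ * (r - r₀)) * (1 / s) +
        q₀ * r₀ * (s₀ - s) * ((1 / s) * (1 / s₀)) := by
    field_simp; ring
  have h5 : |(q - q₀) * r₀ + (q - q₀) * (r - r₀) + q₀ * (r - r₀)| ≤ 3 * e := by
    have a1 : |(q - q₀) * r₀| ≤ e := by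
      rw [abs_mul]
      exact (mul_le_mul hq hr₀ (abs_nonneg _) he0).trans (by linarith)
    have a2 : |(q - q₀) * (r - r₀)| ≤ e := by
      rw [abs_mul]
      exact (mul_le_mul hq (hr.trans he) (abs_nonneg _) he0).trans (by linarith)
    have a3 : |q₀ * (r - r₀)| ≤ e := by
      rw [abs_mul]
      exact (mul_le_mul hq₀ hr (abs_nonneg _) zero_le_one).trans (by linarith)
    exact (abs_add_three _ _ _).trans (by linarith)
  have h6 : |q₀ * r₀ * (s₀ - s)| ≤ e := by
    rw [abs_mul, abs_mul, abs_sub_comm]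
    have := mul_le_mul hq₀ hr₀ (abs_nonneg _) zero_le_one
    exact (mul_le_mul this hs (abs_nonneg _) (by norm_num)).trans (by linarith)
  rw [h4]
  refine (abs_add_le _ _).trans ?_
  have p1 : (0 : ℝ) ≤ 1 / s := by positivity
  have p2 : (0 : ℝ) ≤ 1 / s₀ := by positivity
  rw [abs_mul _ (1 / s), abs_mul _ (1 / s * (1 / s₀)), abs_of_nonneg p1,
    abs_of_nonneg (mul_nonneg p1 p2)]
  have h7 := mul_le_mul h5 h2 p1 (by linarith)
  have h8 := mul_le_mul h6 (mul_le_mul h2 h3 p2 (by linarith)) (mul_nonneg p1 p2) he0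
  have h9 : K * e ≤ K * K * e := by nlinarith [mul_nonneg hK0.le he0]
  nlinarith

/-- The vertices of `S` have typical conductance and pairwise deviations at most `θ`. -/
structure IsSpread (a : V → V → ℝ) (K θ : ℝ) (S : Finset V) : Prop where
  mem : ∀ v ∈ S, v ∈ core a K
  dev_le : ∀ u ∈ S, ∀ v ∈ S, dev a u v ≤ θ

lemma IsSpread.mono {a : V → V → ℝ} {K θ : ℝ} {S S' : Finset V} (h : IsSpread a K θ S)
    (hS : S' ⊆ S) : IsSpread a K θ S' :=
  ⟨fun v hv => h.mem v (hS hv), fun u hu v hv => h.dev_le u (hS hu) v (hS hv)⟩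

lemma one_le_cond_of_mem {a : V → V → ℝ} {K : ℝ} {v : V} (hv : v ∈ core a K) : 1 ≤ cond a v := by
  simp only [core, mem_filter] at hv; exact hv.2.1

lemma cond_le_of_mem {a : V → V → ℝ} {K : ℝ} {v : V} (hv : v ∈ core a K) : cond a v ≤ K := by
  simp only [core, mem_filter] at hv; exact hv.2.2

/-- Total conductance of a set. -/
def condSum (a : V → V → ℝ) (S : Finset V) : ℝ := ∑ v ∈ S, cond a v

lemma IsSpread.one_le_condSum {a : V → V → ℝ} {K θ : ℝ} {S : Finset V} (h : IsSpread a K θ S)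
    (hS : S.Nonempty) : 1 ≤ condSum a S := by
  obtain ⟨v, hv⟩ := hS
  exact (one_le_cond_of_mem (h.mem v hv)).trans (Finset.single_le_sum
    (fun u hu => zero_le_one.trans (one_le_cond_of_mem (h.mem u hu))) hv)

lemma exists_green_approx (K : ℝ) (hK : 1 ≤ K) (s : ℕ) : ∀ ε > 0, ∃ θ > 0,
    ∀ (V : Type) [Fintype V] [DecidableEq V] (a : V → V → ℝ), IsNet a →
      ∀ S : Finset V, S.card = s + 1 → ∀ x y, x ∉ S → y ∉ S →
        IsSpread a K θ (insert x (insert y S)) →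
        |green a S x y - (1 / condSum a S + if x = y then 1 / cond a x else 0)| ≤ ε := by
  induction s with
  | zero =>
    intro ε hε
    refine ⟨ε / 2, by positivity, ?_⟩
    intro V _ _ a ha S hS x y hx hy hsp
    obtain ⟨i, rfl⟩ := Finset.card_eq_one.1 (by simpa using hS)
    simp only [Finset.mem_singleton] at hx hy
    rw [ha.green_singleton_eq hy]
    have h1 := hsp.dev_le i (by simp) x (by simp)
    have h2 := hsp.dev_le i (by simp) y (by simp)
    have h3 := hsp.dev_le x (by simp) y (by simp)
    rw [dev_of_ne a (Ne.symm hx)] at h1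
    rw [dev_of_ne a (Ne.symm hy)] at h2
    simp only [condSum, Finset.sum_singleton]
    by_cases hxy : x = y
    · subst hxy
      rw [effRes_self, if_pos rfl]
      refine le_trans (le_of_eq ?_) (h1.trans (by linarith))
      congr 1
      rw [excess]; ring
    · rw [dev_of_ne a hxy] at h3
      have h4 := abs_le.1 h1
      have h5 := abs_le.1 h2
      have h6 := abs_le.1 h3
      rw [excess] at h4 h5 h6
      rw [if_neg hxy, ha.effRes_comm y x, abs_le]
      constructor <;> linarith
  | succ s ih =>
    intro ε hε
    have hK0 : 0 < K := by linarith
    set e := min (ε / (9 * K ^ 2)) (1 / (2 * K)) with he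
    have hep : 0 < e := lt_min (by positivity) (by positivity)
    obtain ⟨θ, hθ, h⟩ := ih e hep
    refine ⟨θ, hθ, ?_⟩
    intro V _ _ a ha S hS x y hx hy hsp
    obtain ⟨u, T, huT, rfl, hT⟩ := Finset.card_eq_succ.1 hS
    have hTne : T.Nonempty := Finset.card_pos.1 (by omega)
    simp only [Finset.mem_insert, not_or] at hx hy
    rw [ha.green_insert hTne huT hy.2 hy.1]
    have hxy := h V a ha T hT x y hx.2 hy.2 (hsp.mono (by intro z; simp; tauto))
    have hxu := h V a ha T hT x u hx.2 huT (hsp.mono (by intro z; simp; tauto))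
    have huy := h V a ha T hT u y huT hy.2 (hsp.mono (by intro z; simp; tauto))
    have huu := h V a ha T hT u u huT huT (hsp.mono (by intro z; simp; tauto))
    rw [if_neg hx.1, add_zero] at hxu
    rw [if_neg (Ne.symm hy.1), add_zero] at huy
    rw [if_pos rfl] at huu
    have hc := one_le_cond_of_mem (hsp.mem u (by simp))
    have hcK := cond_le_of_mem (hsp.mem u (by simp))
    have hT1 : 1 ≤ condSum a T :=
      (hsp.mono (show T ⊆ _ by intro z; simp; tauto)).one_le_condSum hTne
    have g1 : 1 / condSum a T ≤ 1 := by rw [div_le_one (by linarith)]; exact hT1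
    have g0 : 0 ≤ 1 / condSum a T := by positivity
    have e1 : e ≤ 1 / (2 * K) := min_le_right _ _
    have e2 : e ≤ 1 := e1.trans (by rw [div_le_one (by positivity)]; linarith)
    have e3 : 9 * K ^ 2 * e ≤ ε := by
      have := min_le_left (ε / (9 * K ^ 2)) (1 / (2 * K))
      rw [← he, le_div_iff₀ (by positivity)] at this
      linarith
    have key := abs_mul_div_sub_le hK e2 e1 (by rwa [abs_of_nonneg g0]) (by rwa [abs_of_nonneg g0])
      (s₀ := 1 / condSum a T + 1 / cond a u) (by
        have : 1 / K ≤ 1 / cond a u := one_div_le_one_div_of_le (by linarith) hcK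
        linarith) hxu huy huu
    have e4 : 1 / condSum a (insert u T) + (if x = y then 1 / cond a x else 0) =
        (1 / condSum a T + if x = y then 1 / cond a x else 0) -
          1 / condSum a T * (1 / condSum a T / (1 / condSum a T + 1 / cond a u)) := by
      have e5 : condSum a (insert u T) = cond a u + condSum a T := by
        rw [condSum, Finset.sum_insert huT, condSum]
      rw [e5]
      field_simp
      ring
    rw [e4]
    set A := green a T x y
    set B := (1 / condSum a T + if x = y then 1 / cond a x else 0)
    set F := green a T x u * (green a T u y / green a T u u)
    set F' := 1 / condSum a T * (1 / condSum a T / (1 / condSum a T + 1 / cond a u))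
    have e6 : A - F - (B - F') = (A - B) - (F - F') := by ring
    rw [e6]
    refine (abs_sub _ _).trans ?_
    have : e ≤ K ^ 2 * e := by nlinarith [mul_nonneg (by nlinarith : 0 ≤ K ^ 2 - 1) hep.le]
    linarith

/-- Determinant of the Dirichlet Laplacian relative to the tree partition function. -/
def detRatio (a : V → V → ℝ) (Z : ℝ) (S : Finset V) : ℝ := (dirLap a S).det / Z

lemma IsNet.detRatio_insert {a : V → V → ℝ} (ha : IsNet a) (Z : ℝ) {S : Finset V}
    (hS : S.Nonempty) (u : V) :
    detRatio a Z (insert u S) = detRatio a Z S * green a S u u := by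
  rw [detRatio, ha.det_dirLap_insert hS, detRatio]; ring

lemma IsNet.detRatio_nonneg {a : V → V → ℝ} (ha : IsNet a) {Z : ℝ} (hZ : 0 < Z) {S : Finset V}
    (hS : S.Nonempty) : 0 ≤ detRatio a Z S :=
  div_nonneg (ha.dirLap_posDef hS).det_pos.le hZ.le

lemma IsNet.detRatio_le {a : V → V → ℝ} (ha : IsNet a) {Z : ℝ} (hZ : 0 < Z) {x : V}
    (hZx : Z = (dirLap a {x}).det) {B : ℝ} (hB : 1 ≤ B) (S : Finset V) (hxS : x ∉ S)
    (h : ∀ u ∈ S, effRes a x u ≤ B) : detRatio a Z (insert x S) ≤ B ^ S.card := by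
  induction S using Finset.induction_on with
  | empty =>
    simp [detRatio, ← hZx, hZ.ne']
  | insert u S hu ih =>
    rw [Finset.mem_insert, not_or] at hxS
    rw [Finset.insert_comm, ha.detRatio_insert Z (Finset.insert_nonempty x S),
      Finset.card_insert_of_notMem hu, pow_succ]
    refine mul_le_mul (ih hxS.2 fun v hv => h v (Finset.mem_insert_of_mem hv)) ?_
      (ha.green_pos (Finset.insert_nonempty x S) u).le (by positivity)
    exact (ha.green_le_effRes (Finset.mem_insert_self x S) (by simp [Ne.symm hxS.1, hu])).trans
      (h u (Finset.mem_insert_self u S))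

lemma one_le_prod_of_one_le {ι : Type*} (S : Finset ι) (f : ι → ℝ) (h : ∀ i ∈ S, 1 ≤ f i) :
    1 ≤ ∏ i ∈ S, f i := by
  have := Finset.prod_le_prod (s := S) (fun _ _ => zero_le_one) h
  simpa using this

lemma condSum_div_prod_le {a : V → V → ℝ} {K θ : ℝ} {S : Finset V} (h : IsSpread a K θ S) :
    condSum a S / ∏ v ∈ S, cond a v ≤ S.card := by
  have hpos : ∀ v ∈ S, 1 ≤ cond a v := fun v hv => one_le_cond_of_mem (h.mem v hv)
  have hprod : 0 < ∏ v ∈ S, cond a v :=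
    Finset.prod_pos fun v hv => zero_lt_one.trans_le (hpos v hv)
  rw [div_le_iff₀ hprod, condSum, ← nsmul_eq_mul, ← Finset.sum_const]
  refine Finset.sum_le_sum fun v hv => ?_
  rw [← Finset.mul_prod_erase S _ hv]
  refine le_mul_of_one_le_right (by linarith [hpos v hv]) ?_
  exact one_le_prod_of_one_le _ _ fun u hu => hpos u (Finset.mem_of_mem_erase hu)

lemma exists_detRatio_approx (K : ℝ) (hK : 1 ≤ K) (s : ℕ) : ∀ ε > 0, ∃ θ > 0,
    ∀ (V : Type) [Fintype V] [DecidableEq V] (a : V → V → ℝ), IsNet a →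
      ∀ Z, 0 < Z → (∀ x, Z = (dirLap a {x}).det) →
      ∀ S : Finset V, S.card = s + 1 → IsSpread a K θ S →
        |detRatio a Z S - condSum a S / ∏ v ∈ S, cond a v| ≤ ε := by
  induction s with
  | zero =>
    intro ε hε
    refine ⟨1, one_pos, ?_⟩
    intro V _ _ a ha Z hZ hZx S hS hsp
    obtain ⟨i, rfl⟩ := Finset.card_eq_one.1 (by simpa using hS)
    have := one_le_cond_of_mem (hsp.mem i (by simp))
    simp only [detRatio, condSum, ← hZx i, Finset.sum_singleton, Finset.prod_singleton]
    rw [div_self hZ.ne', div_self (by linarith)]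
    simpa using hε.le
  | succ s ih =>
    intro ε hε
    set e := min (ε / (s + 4)) 1 with he
    have hep : 0 < e := lt_min (by positivity) one_pos
    obtain ⟨θ₁, hθ₁, h1⟩ := ih e hep
    obtain ⟨θ₂, hθ₂, h2⟩ := exists_green_approx K hK s e hep
    refine ⟨min θ₁ θ₂, lt_min hθ₁ hθ₂, ?_⟩
    intro V _ _ a ha Z hZ hZx S hS hsp
    obtain ⟨u, T, huT, rfl, hT⟩ := Finset.card_eq_succ.1 hS
    have hTne : T.Nonempty := Finset.card_pos.1 (by omega)
    have hspT := hsp.mono (Finset.subset_insert u T)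
    have k1 := h1 V a ha Z hZ hZx T hT
      ⟨hspT.mem, fun u hu v hv => (hspT.dev_le u hu v hv).trans (min_le_left _ _)⟩
    have k2 := h2 V a ha T hT u u huT huT (by
      rw [Finset.insert_idem]
      exact ⟨hsp.mem, fun u hu v hv => (hsp.dev_le u hu v hv).trans (min_le_right _ _)⟩)
    rw [if_pos rfl] at k2
    have k3 := condSum_div_prod_le hspT
    have hc := one_le_cond_of_mem (hsp.mem u (by simp))
    have hT1 := hspT.one_le_condSum hTne
    have hprod : 0 < ∏ v ∈ T, cond a v :=
      Finset.prod_pos fun v hv => zero_lt_one.trans_le (one_le_cond_of_mem (hspT.mem v hv))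
    rw [ha.detRatio_insert Z hTne]
    have e0 : condSum a (insert u T) / ∏ v ∈ insert u T, cond a v =
        (condSum a T / ∏ v ∈ T, cond a v) * (1 / condSum a T + 1 / cond a u) := by
      have e5 : condSum a (insert u T) = cond a u + condSum a T := by
        rw [condSum, Finset.sum_insert huT, condSum]
      rw [e5, Finset.prod_insert huT]
      field_simp
    rw [e0]
    set τ₀ := condSum a T / ∏ v ∈ T, cond a v
    set g₀ := 1 / condSum a T + 1 / cond a u with hg₀
    set τ := detRatio a Z T
    set g := green a T u u
    have hτ₀ : 0 ≤ τ₀ := by positivity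
    have hg2 : |g₀| ≤ 2 := by
      have a1 : 1 / condSum a T ≤ 1 := by rw [div_le_one (by linarith)]; exact hT1
      have a2 : 1 / cond a u ≤ 1 := by rw [div_le_one (by linarith)]; exact hc
      rw [abs_of_nonneg (by positivity)]; linarith
    have e1 : τ * g - τ₀ * g₀ = (τ - τ₀) * (g - g₀) + (τ - τ₀) * g₀ + τ₀ * (g - g₀) := by ring
    have he1 : e ≤ 1 := min_le_right _ _
    have b1 : |(τ - τ₀) * (g - g₀)| ≤ e := by
      rw [abs_mul]
      exact (mul_le_mul k1 (k2.trans he1) (abs_nonneg _) hep.le).trans (by linarith)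
    have b2 : |(τ - τ₀) * g₀| ≤ 2 * e := by
      rw [abs_mul]
      exact (mul_le_mul k1 hg2 (abs_nonneg _) hep.le).trans (by linarith)
    have b3 : |τ₀ * (g - g₀)| ≤ (s + 1) * e := by
      rw [abs_mul, abs_of_nonneg hτ₀]
      refine mul_le_mul (k3.trans ?_) k2 (abs_nonneg _) (by positivity)
      rw [hT]; push_cast; exact le_rfl
    rw [e1]
    refine (abs_add_three _ _ _).trans ((add_le_add (add_le_add b1 b2) b3).trans ?_)
    have := min_le_left (ε / (s + 4)) 1
    rw [← he, le_div_iff₀ (by positivity)] at this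
    linarith

/-! ### Killing walks when they enter a set -/

/-- Weights with the transitions into `I` removed. -/
def killed (a : V → V → ℝ) (I : Finset V) (u w : V) : ℝ := if w ∈ I then 0 else a u w

/-- Total weight of the removed transitions out of a vertex outside `S`. -/
def pull (a : V → V → ℝ) (S I : Finset V) (u : V) : ℝ := if u ∈ S then 0 else ∑ i ∈ I, a i u

/-- The Green function symmetrized by the removed transitions. -/
def pullMat (a : V → V → ℝ) (S I : Finset V) : Matrix V V ℝ :=
  Matrix.of fun u w => √(pull a S I u) * green a S u w * √(pull a S I w)

lemma IsNet.pull_nonneg {a : V → V → ℝ} (ha : IsNet a) (S I : Finset V) (u : V) :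
    0 ≤ pull a S I u := by
  unfold pull; split_ifs
  exacts [le_rfl, Finset.sum_nonneg fun i _ => ha.nonneg i u]

lemma IsNet.dirLap_killed {a : V → V → ℝ} (ha : IsNet a) {S I : Finset V} (hI : I ⊆ S) :
    dirLap (killed a I) S = dirLap a S - Matrix.diagonal (pull a S I) := by
  ext u w
  simp only [dirLap, Matrix.of_apply, Matrix.sub_apply, Matrix.diagonal_apply, pull]
  by_cases hu : u ∈ S
  · simp [hu]
  by_cases hw : w ∈ S
  · have : u ≠ w := by rintro rfl; exact hu hw
    simp [hw, this]
  have hwI : w ∉ I := fun h => hw (hI h)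
  simp only [hu, hw, or_self, if_false, killed, hwI]
  split_ifs with huw
  · have : ∑ x, (if x ∈ I then 0 else a u x) = ∑ x, a u x - ∑ i ∈ I, a i u := by
      rw [eq_sub_iff_add_eq, ← Finset.sum_filter_add_sum_filter_not univ (· ∈ I) (fun x => a u x),
        add_comm]
      congr 1
      · simp only [Finset.filter_mem_eq_inter, Finset.univ_inter]
        exact Finset.sum_congr rfl fun i _ => ha.symm i u
      · rw [Finset.sum_filter]
        exact Finset.sum_congr rfl fun i _ => by by_cases h : i ∈ I <;> simp [h]
    rw [this]; ring
  · ring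

lemma IsNet.det_dirLap_killed {a : V → V → ℝ} (ha : IsNet a) {S I : Finset V} (hS : S.Nonempty)
    (hI : I ⊆ S) : (dirLap (killed a I) S).det =
      (dirLap a S).det * (1 - pullMat a S I).det := by
  set B : Matrix V V ℝ := Matrix.diagonal fun u => √(pull a S I u) with hB
  have h1 : Matrix.diagonal (pull a S I) = B * B := by
    rw [hB, Matrix.diagonal_mul_diagonal]
    congr 1; funext u
    exact (Real.mul_self_sqrt (ha.pull_nonneg S I u)).symm
  have h2 : pullMat a S I = B * (green a S * B) := by
    ext u w
    rw [hB, Matrix.diagonal_mul, Matrix.mul_diagonal]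
    simp only [pullMat, Matrix.of_apply]; ring
  have h3 : dirLap a S - B * B = dirLap a S * (1 - green a S * B * B) := by
    rw [Matrix.mul_sub, mul_one, Matrix.mul_assoc (green a S), ← Matrix.mul_assoc (dirLap a S),
      green, Matrix.mul_nonsing_inv _ (ha.isUnit_det hS), Matrix.one_mul]
  rw [ha.dirLap_killed hI, h1, h3, Matrix.det_mul, Matrix.det_one_sub_mul_comm, h2]

lemma IsNet.sum_pull_mul_sq_le {a : V → V → ℝ} (ha : IsNet a) {S I : Finset V} (hI : I ⊆ S)
    (h : V → ℝ) (hS : ∀ v ∈ S, h v = 0) :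
    ∑ u, pull a S I u * h u ^ 2 ≤ ∑ v, h v * lapOp a h v := by
  rw [ha.sum_mul_lapOp]
  have e1 : ∀ u v, (if v ∈ I then if u ∈ S then 0 else a v u * h u ^ 2 else 0) +
      (if u ∈ I then if v ∈ S then 0 else a u v * h v ^ 2 else 0) ≤
      a u v * (h u - h v) ^ 2 := by
    intro u v
    have h0 := mul_nonneg (ha.nonneg u v) (sq_nonneg (h u - h v))
    by_cases huS : u ∈ S
    · by_cases hvS : v ∈ S
      · simpa [huS, hvS] using h0
      · have : v ∉ I := fun h => hvS (hI h)
        simp only [this, huS, hvS, if_false, zero_add, hS u huS, zero_sub, neg_sq]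
        split_ifs
        exacts [le_rfl, mul_nonneg (ha.nonneg u v) (sq_nonneg _)]
    · have : u ∉ I := fun h => huS (hI h)
      by_cases hvS : v ∈ S
      · simp only [this, huS, if_false, add_zero, hS v hvS, sub_zero, ha.symm v u]
        split_ifs
        exacts [le_rfl, mul_nonneg (ha.nonneg u v) (sq_nonneg _)]
      · have : v ∉ I := fun h => hvS (hI h)
        simp [*]
  have e2 := Finset.sum_le_sum fun u (_ : u ∈ univ) =>
    Finset.sum_le_sum fun v (_ : v ∈ univ) => e1 u v
  simp only [Finset.sum_add_distrib] at e2
  have e3 : ∑ u, ∑ v, (if v ∈ I then if u ∈ S then 0 else a v u * h u ^ 2 else 0) =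
      ∑ u, pull a S I u * h u ^ 2 := by
    refine Finset.sum_congr rfl fun u _ => ?_
    simp only [pull]
    by_cases hu : u ∈ S
    · simp [hu]
    · simp [hu, Finset.sum_ite_mem, Finset.sum_mul]
  have e4 : ∑ u, ∑ v, (if u ∈ I then if v ∈ S then 0 else a u v * h v ^ 2 else 0) =
      ∑ u, pull a S I u * h u ^ 2 := by
    rw [Finset.sum_comm, e3]
  rw [e3, e4] at e2
  linarith

lemma IsNet.pullMat_isHermitian {a : V → V → ℝ} (ha : IsNet a) {S : Finset V} (hS : S.Nonempty)
    (I : Finset V) : (pullMat a S I).IsHermitian := by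
  ext u w
  simp only [pullMat, Matrix.conjTranspose_apply, Matrix.of_apply, star_trivial,
    ha.green_symm hS w u]
  ring

lemma IsNet.pullMat_sq_le {a : V → V → ℝ} (ha : IsNet a) {S I : Finset V} (hS : S.Nonempty)
    (hI : I ⊆ S) (f : V → ℝ) :
    (pullMat a S I).mulVec f ⬝ᵥ (pullMat a S I).mulVec f ≤ f ⬝ᵥ (pullMat a S I).mulVec f := by
  set d := pull a S I with hd
  set h : V → ℝ := (green a S).mulVec (fun w => √(d w) * f w) with hh
  have h1 : (pullMat a S I).mulVec f = fun u => √(d u) * h u := by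
    funext u
    simp only [hh, pullMat, Matrix.mulVec, dotProduct, Matrix.of_apply, Finset.mul_sum]
    exact Finset.sum_congr rfl fun w _ => by ring
  have h2 : (dirLap a S).mulVec h = fun w => √(d w) * f w := by
    rw [hh, Matrix.mulVec_mulVec, green, Matrix.mul_nonsing_inv _ (ha.isUnit_det hS),
      Matrix.one_mulVec]
  have h3 : ∀ v ∈ S, h v = 0 := by
    intro v hv
    rw [← dirLap_mulVec_of_mem a S h hv, h2]
    simp [hd, pull, hv]
  have h4 : (fun w => if w ∈ S then 0 else h w) = h := by
    funext w
    split_ifs with hw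
    exacts [(h3 w hw).symm, rfl]
  have h5 : ∑ v, h v * lapOp a h v = ∑ v, h v * (√(d v) * f v) := by
    refine Finset.sum_congr rfl fun v _ => ?_
    by_cases hv : v ∈ S
    · simp [h3 v hv]
    · have := dirLap_mulVec_of_notMem a S h hv
      rw [h4, h2] at this
      rw [← this]
  have h6 := ha.sum_pull_mul_sq_le hI h h3
  rw [h5] at h6
  rw [h1]
  simp only [dotProduct]
  calc ∑ u, √(d u) * h u * (√(d u) * h u) = ∑ u, d u * h u ^ 2 :=
        Finset.sum_congr rfl fun u _ => by
          have := Real.mul_self_sqrt (ha.pull_nonneg S I u)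
          rw [← hd] at this
          linear_combination (h u ^ 2) * this
    _ ≤ ∑ v, h v * (√(d v) * f v) := h6
    _ = ∑ u, f u * (√(d u) * h u) := Finset.sum_congr rfl fun u _ => by ring

/-- Spectral data of a symmetric real matrix whose square is dominated by itself. -/
lemma exists_spectral_data (A : Matrix V V ℝ) (hA : A.IsHermitian)
    (hsq : ∀ f, A.mulVec f ⬝ᵥ A.mulVec f ≤ f ⬝ᵥ A.mulVec f) :
    ∃ l : V → ℝ, (∀ i, 0 ≤ l i) ∧ (∀ i, l i ≤ 1) ∧ (1 - A).det = ∏ i, (1 - l i) ∧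
      ∑ i, l i = A.trace ∧ ∑ i, l i ^ 2 = (A * A).trace ∧
      ∀ x : V → ℝ, ∀ m, (∀ i, l i ≤ m) → x ⬝ᵥ A.mulVec x ≤ m * (x ⬝ᵥ x) := by
  obtain ⟨U, l, h1, h2, h3⟩ : ∃ (U : Matrix V V ℝ) (l : V → ℝ), U * U.transpose = 1 ∧
      U.transpose * U = 1 ∧ A = U * Matrix.diagonal l * U.transpose := by
    refine ⟨hA.eigenvectorUnitary, hA.eigenvalues, ?_, ?_, ?_⟩
    · exact Unitary.coe_mul_star_self hA.eigenvectorUnitary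
    · exact Unitary.coe_star_mul_self hA.eigenvectorUnitary
    · have := hA.spectral_theorem
      rw [Unitary.conjStarAlgAut_apply] at this
      exact this
  have hcol : ∀ i, l i ^ 2 ≤ l i := by
    intro i
    have e2 : A.mulVec (U.mulVec (Pi.single i 1)) = U.mulVec (Pi.single i (l i)) := by
      rw [h3, Matrix.mulVec_mulVec, Matrix.mul_assoc, h2, mul_one, ← Matrix.mulVec_mulVec,
        Matrix.diagonal_mulVec_single, mul_one]
    have e3 : ∀ x y : V → ℝ, (U.mulVec x) ⬝ᵥ (U.mulVec y) = x ⬝ᵥ y := by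
      intro x y
      rw [Matrix.dotProduct_mulVec, ← Matrix.mulVec_transpose, Matrix.mulVec_mulVec, h2,
        Matrix.one_mulVec]
    have := hsq (U.mulVec (Pi.single i 1))
    rw [e2, e3, e3] at this
    simpa [sq] using this
  have h0 : ∀ i, 0 ≤ l i := fun i => (sq_nonneg _).trans (hcol i)
  refine ⟨l, h0, fun i => by nlinarith [hcol i, h0 i], ?_, ?_, ?_, ?_⟩
  · have : 1 - A = U * Matrix.diagonal (fun i => 1 - l i) * U.transpose := by
      have e : Matrix.diagonal (fun i => 1 - l i) = 1 - Matrix.diagonal l := by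
        rw [← Matrix.diagonal_one, Matrix.diagonal_sub]
      rw [e, Matrix.mul_sub, Matrix.sub_mul, mul_one, h1, ← h3]
    rw [this, Matrix.det_mul, mul_comm, ← Matrix.det_mul, ← Matrix.mul_assoc, h2, one_mul,
      Matrix.det_diagonal]
  · rw [h3, Matrix.trace_mul_comm, ← Matrix.mul_assoc, h2, one_mul, Matrix.trace_diagonal]
  · have : A * A = U * Matrix.diagonal (fun i => l i ^ 2) * U.transpose := by
      have e : Matrix.diagonal (fun i => l i ^ 2) = Matrix.diagonal l * Matrix.diagonal l := by
        rw [Matrix.diagonal_mul_diagonal]; simp [sq]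
      rw [h3, e]
      calc _ = U * Matrix.diagonal l * (U.transpose * U) * Matrix.diagonal l * U.transpose := by
            simp only [Matrix.mul_assoc]
        _ = _ := by rw [h2]; simp only [Matrix.mul_assoc, Matrix.one_mul]
    rw [this, Matrix.trace_mul_comm, ← Matrix.mul_assoc, h2, one_mul, Matrix.trace_diagonal]
  · intro x m hm
    have e1 : x ⬝ᵥ A.mulVec x = ∑ i, l i * (U.transpose.mulVec x i) ^ 2 := by
      rw [h3, ← Matrix.mulVec_mulVec, ← Matrix.mulVec_mulVec, Matrix.dotProduct_mulVec,
        ← Matrix.mulVec_transpose]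
      simp only [dotProduct, Matrix.mulVec_diagonal]
      exact Finset.sum_congr rfl fun i _ => by ring
    have e2 : x ⬝ᵥ x = ∑ i, (U.transpose.mulVec x i) ^ 2 := by
      have : x ⬝ᵥ x = U.transpose.mulVec x ⬝ᵥ U.transpose.mulVec x := by
        rw [Matrix.dotProduct_mulVec _ U.transpose, ← Matrix.mulVec_transpose,
          Matrix.transpose_transpose, Matrix.mulVec_mulVec, h1, Matrix.one_mulVec]
      rw [this]
      simp only [dotProduct, sq]
    rw [e1, e2, Finset.mul_sum]
    exact Finset.sum_le_sum fun i _ => mul_le_mul_of_nonneg_right (hm i) (sq_nonneg _)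

/-! ### Determinants of nearly rank-one perturbations -/

lemma abs_prod_sub_prod_le {ι : Type*} (s : Finset ι) (x y : ι → ℝ)
    (hx : ∀ i ∈ s, x i ∈ Set.Icc (0 : ℝ) 1) (hy : ∀ i ∈ s, y i ∈ Set.Icc (0 : ℝ) 1) :
    |∏ i ∈ s, x i - ∏ i ∈ s, y i| ≤ ∑ i ∈ s, |x i - y i| := by
  induction s using Finset.induction_on with
  | empty => simp
  | insert i s hi ih =>
    rw [Finset.prod_insert hi, Finset.prod_insert hi, Finset.sum_insert hi]
    have h1 := ih (fun j hj => hx j (Finset.mem_insert_of_mem hj))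
      (fun j hj => hy j (Finset.mem_insert_of_mem hj))
    have hxi := hx i (Finset.mem_insert_self i s)
    have hp0 : 0 ≤ ∏ i ∈ s, y i :=
      Finset.prod_nonneg fun j hj => (hy j (Finset.mem_insert_of_mem hj)).1
    have hp1 : ∏ i ∈ s, y i ≤ 1 :=
      Finset.prod_le_one (fun j hj => (hy j (Finset.mem_insert_of_mem hj)).1)
        (fun j hj => (hy j (Finset.mem_insert_of_mem hj)).2)
    have e : x i * ∏ i ∈ s, x i - y i * ∏ i ∈ s, y i =
        x i * (∏ i ∈ s, x i - ∏ i ∈ s, y i) + (x i - y i) * ∏ i ∈ s, y i := by ring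
    rw [e]
    refine (abs_add_le _ _).trans ?_
    rw [abs_mul, abs_mul, abs_of_nonneg hxi.1, abs_of_nonneg hp0]
    have h2 := mul_le_mul hxi.2 h1 (abs_nonneg _) zero_le_one
    have h3 := mul_le_mul_of_nonneg_left hp1 (abs_nonneg (x i - y i))
    linarith

lemma abs_exp_neg_sub_exp_neg_le {x y : ℝ} (hx : 0 ≤ x) (hy : 0 ≤ y) :
    |Real.exp (-x) - Real.exp (-y)| ≤ |x - y| := by
  have key : ∀ x y : ℝ, 0 ≤ x → x ≤ y → |Real.exp (-x) - Real.exp (-y)| ≤ |x - y| := by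
    intro x y hx hxy
    have h1 : Real.exp (-y) ≤ Real.exp (-x) := Real.exp_le_exp.2 (by linarith)
    have h2 : Real.exp (-y) = Real.exp (-x) * Real.exp (x - y) := by rw [← Real.exp_add]; ring_nf
    have h3 := Real.add_one_le_exp (x - y)
    have h4 : Real.exp (-x) ≤ 1 := Real.exp_le_one_iff.2 (by linarith)
    have h5 := Real.exp_pos (-x)
    rw [abs_of_nonneg (by linarith), abs_of_nonpos (by linarith), h2]
    nlinarith
  rcases le_total x y with h | h
  · exact key x y hx h
  · rw [abs_sub_comm, abs_sub_comm x]; exact key y x hy h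

lemma abs_prod_one_sub_sub_le {ι : Type*} [Fintype ι] [DecidableEq ι] (l : ι → ℝ) (i₀ : ι)
    {s b κ : ℝ} (h0 : ∀ i, 0 ≤ l i) (h1 : ∀ i, l i ≤ 1) (hs : 0 ≤ s) (hs1 : s ≤ 1) (hb : 0 ≤ b)
    (hκ : 0 ≤ κ) (hκ1 : κ ≤ 1) (hmax : s - κ ^ 2 ≤ l i₀) (hsq : ∑ i, l i ^ 2 ≤ s ^ 2 + κ ^ 2)
    (hsum : |∑ i, l i - (s + b)| ≤ κ ^ 2) :
    |∏ i, (1 - l i) - (1 - s) * Real.exp (-b)| ≤ 8 * κ := by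
  have hκ2 : κ ^ 2 ≤ κ := by nlinarith
  rw [← Finset.add_sum_erase univ _ (Finset.mem_univ i₀)] at hsq hsum
  rw [← Finset.mul_prod_erase univ _ (Finset.mem_univ i₀)]
  set T := univ.erase i₀
  have hT2 : 0 ≤ ∑ i ∈ T, l i ^ 2 := Finset.sum_nonneg fun i _ => sq_nonneg _
  have hT1 : 0 ≤ ∑ i ∈ T, l i := Finset.sum_nonneg fun i _ => h0 i
  have hup : l i₀ ≤ s + κ := by
    apply le_of_sq_le_sq _ (by linarith)
    nlinarith
  have hl0 := h0 i₀
  have h3 : ∑ i ∈ T, l i ^ 2 ≤ 3 * κ ^ 2 := by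
    have : s ^ 2 - 2 * κ ^ 2 ≤ l i₀ ^ 2 := by
      rcases le_total s (κ ^ 2) with h | h
      · nlinarith
      · nlinarith
    linarith
  have hd : |l i₀ - s| ≤ κ := abs_le.2 ⟨by linarith, by linarith⟩
  have hp : |∏ i ∈ T, (1 - l i) - ∏ i ∈ T, Real.exp (-l i)| ≤ 3 * κ ^ 2 := by
    refine (abs_prod_sub_prod_le T _ _ (fun i _ => ⟨by linarith [h1 i], by linarith [h0 i]⟩)
      fun i _ => ⟨(Real.exp_pos _).le, Real.exp_le_one_iff.2 (by linarith [h0 i])⟩).trans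
      (le_trans (Finset.sum_le_sum fun i _ => ?_) h3)
    have := Real.abs_exp_sub_one_sub_id_le (x := -l i)
      (by rw [abs_neg, abs_of_nonneg (h0 i)]; exact h1 i)
    rw [abs_sub_comm]
    calc |Real.exp (-l i) - (1 - l i)| = |Real.exp (-l i) - 1 - -l i| := by ring_nf
      _ ≤ _ := by simpa using this
  rw [← Real.exp_sum, Finset.sum_neg_distrib] at hp
  have he := abs_exp_neg_sub_exp_neg_le hT1 hb
  have hd2 : |∑ i ∈ T, l i - b| ≤ κ ^ 2 + κ := by
    have e : ∑ i ∈ T, l i - b = (l i₀ + ∑ i ∈ T, l i - (s + b)) - (l i₀ - s) := by ring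
    rw [e]
    exact (abs_sub _ _).trans (add_le_add hsum hd)
  have hexp0 := Real.exp_pos (-b)
  have hexp1 : Real.exp (-b) ≤ 1 := Real.exp_le_one_iff.2 (by linarith)
  have e : (1 - l i₀) * ∏ i ∈ T, (1 - l i) - (1 - s) * Real.exp (-b) =
      (1 - l i₀) * ((∏ i ∈ T, (1 - l i) - Real.exp (-∑ i ∈ T, l i)) +
        (Real.exp (-∑ i ∈ T, l i) - Real.exp (-b))) + (s - l i₀) * Real.exp (-b) := by ring
  rw [e]
  refine (abs_add_le _ _).trans ?_
  rw [abs_mul, abs_mul, abs_of_nonneg (by linarith [h1 i₀] : 0 ≤ 1 - l i₀), abs_of_pos hexp0,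
    abs_sub_comm s]
  have h5 := (abs_add_le (∏ i ∈ T, (1 - l i) - Real.exp (-∑ i ∈ T, l i))
    (Real.exp (-∑ i ∈ T, l i) - Real.exp (-b)))
  have h6 := mul_le_mul (by linarith : 1 - l i₀ ≤ 1) h5 (abs_nonneg _) zero_le_one
  have h7 := mul_le_mul hd hexp1 hexp0.le hκ
  linarith

set_option maxHeartbeats 400000 in
lemma IsNet.abs_det_one_sub_pullMat_sub_le {a : V → V → ℝ} (ha : IsNet a) {S I : Finset V}
    (hS : S.Nonempty) (hI : I ⊆ S) {g s b κ : ℝ} (hg : 0 ≤ g) (hs : 0 ≤ s) (hs1 : s ≤ 1)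
    (hb : 0 ≤ b) (hκ : 0 ≤ κ) (hκ1 : κ ≤ 1)
    (h1 : g * ∑ u, pull a S I u ≤ s) (h2 : s ≤ g * ∑ u, pull a S I u + κ ^ 2 / 2)
    (h3 : |∑ u, pull a S I u * green a S u u - (s + b)| ≤ κ ^ 2)
    (h4 : ∑ u, ∑ w, pull a S I u * pull a S I w * (green a S u w - g) ^ 2 ≤ (κ ^ 2 / 4) ^ 2) :
    |(1 - pullMat a S I).det - (1 - s) * Real.exp (-b)| ≤ 8 * κ := by
  obtain ⟨l, l0, l1, ldet, ltr, ltr2, lmax⟩ := exists_spectral_data (pullMat a S I)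
    (ha.pullMat_isHermitian hS I) (ha.pullMat_sq_le hS hI)
  have hd := ha.pull_nonneg S I
  set d := pull a S I with hdd
  set D := ∑ u, d u with hD
  have hD0 : 0 ≤ D := Finset.sum_nonneg fun u _ => hd u
  have hsqrt : ∀ u, √(d u) * √(d u) = d u := fun u => Real.mul_self_sqrt (hd u)
  obtain ⟨v, _⟩ := hS
  have : Nonempty V := ⟨v⟩
  obtain ⟨i₀, hi₀⟩ := Finite.exists_max l
  set E := ∑ u, ∑ w, d u * d w * (green a S u w - g) with hE
  have hDD : D * D = ∑ u, ∑ w, d u * d w := Finset.sum_mul_sum _ _ _ _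
  have hEsq : E ^ 2 ≤ (D * D) * (κ ^ 2 / 4) ^ 2 := by
    have hcs := Finset.sum_mul_sq_le_sq_mul_sq (univ : Finset (V × V))
      (fun z => √(d z.1) * √(d z.2))
      (fun z => √(d z.1) * √(d z.2) * (green a S z.1 z.2 - g))
    rw [Fintype.sum_prod_type, Fintype.sum_prod_type, Fintype.sum_prod_type] at hcs
    have e1 : ∑ u, ∑ w, √(d u) * √(d w) * (√(d u) * √(d w) * (green a S u w - g)) = E :=
      Finset.sum_congr rfl fun u _ => Finset.sum_congr rfl fun w _ => by
        linear_combination (√(d w) * √(d w) * (green a S u w - g)) * hsqrt u +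
          d u * (green a S u w - g) * hsqrt w
    have e2 : ∑ u, ∑ w, (√(d u) * √(d w)) ^ 2 = D * D := by
      rw [hDD]
      exact Finset.sum_congr rfl fun u _ => Finset.sum_congr rfl fun w _ => by
        rw [mul_pow, Real.sq_sqrt (hd u), Real.sq_sqrt (hd w)]
    have e3 : ∑ u, ∑ w, (√(d u) * √(d w) * (green a S u w - g)) ^ 2 =
        ∑ u, ∑ w, d u * d w * (green a S u w - g) ^ 2 :=
      Finset.sum_congr rfl fun u _ => Finset.sum_congr rfl fun w _ => by
        rw [mul_pow, mul_pow, Real.sq_sqrt (hd u), Real.sq_sqrt (hd w)]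
    simp only [] at hcs
    rw [e1, e2, e3] at hcs
    exact hcs.trans (mul_le_mul_of_nonneg_left h4 (mul_nonneg hD0 hD0))
  have hEabs : |E| ≤ D * (κ ^ 2 / 4) := by
    apply abs_le_of_sq_le_sq _ (by positivity)
    rw [mul_pow, sq D]; exact hEsq
  have htr : (pullMat a S I).trace = ∑ u, d u * green a S u u := by
    simp only [Matrix.trace, Matrix.diag, pullMat, Matrix.of_apply]
    exact Finset.sum_congr rfl fun u _ => by
      rw [← hdd]; linear_combination green a S u u * hsqrt u
  have htr2 : (pullMat a S I * pullMat a S I).trace =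
      ∑ u, ∑ w, d u * d w * green a S u w ^ 2 := by
    simp only [Matrix.trace, Matrix.diag, pullMat, Matrix.of_apply, Matrix.mul_apply]
    refine Finset.sum_congr rfl fun u _ => Finset.sum_congr rfl fun w _ => ?_
    rw [ha.green_symm ⟨v, ‹_›⟩ w u, ← hdd]
    linear_combination (√(d w) * √(d w) * green a S u w ^ 2) * hsqrt u +
      d u * green a S u w ^ 2 * hsqrt w
  have hG : ∑ u, ∑ w, d u * d w * green a S u w = g * (D * D) + E := by
    rw [hDD, hE, Finset.mul_sum, ← Finset.sum_add_distrib]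
    refine Finset.sum_congr rfl fun u _ => ?_
    rw [Finset.mul_sum, ← Finset.sum_add_distrib]
    exact Finset.sum_congr rfl fun w _ => by ring
  have hG2 : ∑ u, ∑ w, d u * d w * green a S u w ^ 2 = g ^ 2 * (D * D) + 2 * g * E +
      ∑ u, ∑ w, d u * d w * (green a S u w - g) ^ 2 := by
    rw [hDD, hE, Finset.mul_sum, Finset.mul_sum, ← Finset.sum_add_distrib,
      ← Finset.sum_add_distrib]
    refine Finset.sum_congr rfl fun u _ => ?_
    rw [Finset.mul_sum, Finset.mul_sum, ← Finset.sum_add_distrib, ← Finset.sum_add_distrib]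
    exact Finset.sum_congr rfl fun w _ => by ring
  rw [ldet]
  refine abs_prod_one_sub_sub_le l i₀ l0 l1 hs hs1 hb hκ hκ1 ?_ ?_ ?_
  · rcases hD0.eq_or_lt with h | h
    · rw [← h] at h2
      nlinarith [l0 i₀, sq_nonneg κ]
    · have hray := lmax (fun u => √(d u)) (l i₀) hi₀
      have e1 : (fun u => √(d u)) ⬝ᵥ (fun u => √(d u)) = D := by
        simp only [dotProduct, hsqrt, hD]
      have e2 : (fun u => √(d u)) ⬝ᵥ (pullMat a S I).mulVec (fun u => √(d u)) =
          g * (D * D) + E := by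
        rw [← hG]
        simp only [dotProduct, Matrix.mulVec, pullMat, Matrix.of_apply, Finset.mul_sum]
        refine Finset.sum_congr rfl fun u _ => Finset.sum_congr rfl fun w _ => ?_
        rw [← hdd]
        linear_combination (√(d w) * √(d w) * green a S u w) * hsqrt u +
          d u * green a S u w * hsqrt w
      rw [e1, e2] at hray
      have := (abs_le.1 hEabs).1
      have : (g * D - κ ^ 2 / 4) * D ≤ l i₀ * D := by nlinarith
      have := le_of_mul_le_mul_right this h
      nlinarith [sq_nonneg κ]
  · rw [ltr2, htr2, hG2]
    have h5 : g * E ≤ s * (κ ^ 2 / 4) := by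
      have h5 := mul_le_mul_of_nonneg_left ((le_abs_self E).trans hEabs) hg
      have h6 := mul_le_mul_of_nonneg_right h1 (by positivity : 0 ≤ κ ^ 2 / 4)
      linarith
    have h6 : g ^ 2 * (D * D) ≤ s ^ 2 := by
      have := mul_self_le_mul_self (mul_nonneg hg hD0) h1
      linarith [this]
    have h7 : κ ^ 2 ≤ 1 := pow_le_one₀ hκ hκ1
    have h8 : s * (κ ^ 2 / 4) ≤ κ ^ 2 / 4 := mul_le_of_le_one_left (by positivity) hs1
    have h9 : (κ ^ 2 / 4) ^ 2 ≤ κ ^ 2 / 4 := by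
      rw [sq]; exact mul_le_of_le_one_left (by positivity) (by linarith)
    linarith [sq_nonneg κ]
  · rw [ltr, htr]; exact h3

/-- The removed-transition determinant lies in the unit interval. -/
lemma IsNet.det_one_sub_pullMat_mem {a : V → V → ℝ} (ha : IsNet a) {S I : Finset V}
    (hS : S.Nonempty) (hI : I ⊆ S) : (1 - pullMat a S I).det ∈ Set.Icc (0 : ℝ) 1 := by
  obtain ⟨l, l0, l1, ldet, -⟩ := exists_spectral_data (pullMat a S I)
    (ha.pullMat_isHermitian hS I) (ha.pullMat_sq_le hS hI)
  rw [ldet]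
  exact ⟨Finset.prod_nonneg fun i _ => by linarith [l1 i],
    Finset.prod_le_one (fun i _ => by linarith [l1 i]) fun i _ => by linarith [l0 i]⟩

/-! ### Local approximation of hitting determinants -/

/-- The set `S` lies in the core and its neighbourhood is spread out. -/
structure IsLocal (a : V → V → ℝ) (K η : ℝ) (S : Finset V) : Prop where
  mem : ∀ v ∈ S, v ∈ core a K
  dev_le : ∀ u ∈ S, ∀ v ∈ S, dev a u v ≤ η
  small : ∀ u v, a u v ≤ η
  near : ∑ i ∈ S, ∑ j ∈ S, ∑ u, restr a (core a K) i u * dev a j u ≤ η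
  far : ∑ i ∈ S, ∑ u, (if u ∈ core a K then 0 else
    a i u * (effRes a i u + 1 / cond a u + 1)) ≤ η
  pair : ∑ i ∈ S, ∑ j ∈ S, ∑ u, ∑ w,
    restr a (core a K) i u * restr a (core a K) j w * dev a u w ≤ η

/-- Error attached to a vertex which is not well separated from `S`. -/
def vertexErr (a : V → V → ℝ) (K θ : ℝ) (S : Finset V) (u : V) : ℝ :=
  (1 + 4 / θ) * ∑ i ∈ S, ∑ j ∈ S, restr a (core a K) i u * dev a j u +
    ∑ i ∈ S, (if u ∈ core a K then 0 else a i u * (effRes a i u + 1 / cond a u + 1))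

/-- A vertex of the core which is well separated from `S`. -/
def IsGood (a : V → V → ℝ) (K θ : ℝ) (S : Finset V) (u : V) : Prop :=
  u ∈ core a K ∧ ∀ j ∈ S, dev a j u ≤ θ

section Local

variable {a : V → V → ℝ} {K θ η : ℝ} {S I : Finset V}

lemma IsNet.vertexErr_nonneg (ha : IsNet a) (hθ : 0 < θ) (S : Finset V) (u : V) :
    0 ≤ vertexErr a K θ S u := by
  refine add_nonneg (mul_nonneg (by positivity) (Finset.sum_nonneg fun i _ =>
    Finset.sum_nonneg fun j _ => mul_nonneg (ha.restr_nonneg _ _ _) (dev_nonneg _ _ _)))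
    (Finset.sum_nonneg fun i _ => ?_)
  split_ifs
  · exact le_rfl
  · have := ha.effRes_nonneg i u
    have := one_div_nonneg.2 (ha.cond_nonneg u)
    exact mul_nonneg (ha.nonneg i u) (by linarith)

lemma IsLocal.sum_vertexErr_le (h : IsLocal a K η S) (hθ : 0 < θ) :
    ∑ u, vertexErr a K θ S u ≤ (1 + 4 / θ) * η + η := by
  simp only [vertexErr, Finset.sum_add_distrib]
  rw [← Finset.mul_sum]
  refine add_le_add (mul_le_mul_of_nonneg_left (le_trans (le_of_eq ?_) h.near) (by positivity))
    (le_trans (le_of_eq Finset.sum_comm) h.far)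
  rw [Finset.sum_comm]
  exact Finset.sum_congr rfl fun i _ => Finset.sum_comm

lemma IsNet.pull_le (ha : IsNet a) (hI : I ⊆ S) (u : V) : pull a S I u ≤ ∑ i ∈ S, a i u := by
  unfold pull; split_ifs
  · exact Finset.sum_nonneg fun i _ => ha.nonneg i u
  · exact Finset.sum_le_sum_of_subset_of_nonneg hI fun i _ _ => ha.nonneg i u

lemma IsNet.pull_le_restr (ha : IsNet a) (hS : ∀ v ∈ S, v ∈ core a K) (hI : I ⊆ S) {u : V}
    (hu : u ∈ core a K) : pull a S I u ≤ ∑ i ∈ S, restr a (core a K) i u :=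
  (ha.pull_le hI u).trans (le_of_eq (Finset.sum_congr rfl fun i hi => by
    simp [restr, hS i hi, hu]))

lemma effRes_le_dev_add {i u : V} (hiu : i ≠ u) (hi : i ∈ core a K) (hu : u ∈ core a K) :
    effRes a i u ≤ dev a i u + 2 := by
  rw [dev_of_ne a hiu]
  have h1 := le_abs_self (excess a i u)
  have h2 : 1 / cond a i ≤ 1 := by
    rw [div_le_one (by linarith [one_le_cond_of_mem hi])]; exact one_le_cond_of_mem hi
  have h3 : 1 / cond a u ≤ 1 := by
    rw [div_le_one (by linarith [one_le_cond_of_mem hu])]; exact one_le_cond_of_mem hu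
  unfold excess at h1 ⊢
  linarith

/-- Vertices which are not well separated from `S` contribute little. -/
lemma IsLocal.pull_mul_le (ha : IsNet a) (h : IsLocal a K η S) (hθ : 0 < θ)
    (hI : I ⊆ S) {u : V} (hu : u ∉ S) (hbad : ¬ IsGood a K θ S u) :
    pull a S I u * (green a S u u + 1 / cond a u + 1) ≤ vertexErr a K θ S u := by
  have hnn1 : 0 ≤ ∑ i ∈ S, ∑ j ∈ S, restr a (core a K) i u * dev a j u :=
    Finset.sum_nonneg fun i _ => Finset.sum_nonneg fun j _ =>
      mul_nonneg (ha.restr_nonneg _ _ _) (dev_nonneg _ _ _)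
  by_cases huW : u ∈ core a K
  · simp only [IsGood, huW, true_and, not_forall, not_le] at hbad
    obtain ⟨j, hj, hju⟩ := hbad
    have hju' : j ≠ u := fun e => hu (e ▸ hj)
    have h1 := (ha.green_le_effRes hj hu).trans (effRes_le_dev_add hju' (h.mem j hj) huW)
    have h2 : 1 / cond a u ≤ 1 := by
      rw [div_le_one (by linarith [one_le_cond_of_mem huW])]; exact one_le_cond_of_mem huW
    have h3 : green a S u u + 1 / cond a u + 1 ≤ (1 + 4 / θ) * dev a j u := by
      have : 4 ≤ 4 / θ * dev a j u := by
        rw [div_mul_eq_mul_div, le_div_iff₀ hθ]; nlinarith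
      linarith
    have h4 : pull a S I u * dev a j u ≤
        ∑ i ∈ S, ∑ j ∈ S, restr a (core a K) i u * dev a j u := by
      refine (mul_le_mul_of_nonneg_right (ha.pull_le_restr h.mem hI huW)
        (dev_nonneg _ _ _)).trans ?_
      rw [Finset.sum_mul]
      exact Finset.sum_le_sum fun i _ => Finset.single_le_sum
        (f := fun j => restr a (core a K) i u * dev a j u)
        (fun j _ => mul_nonneg (ha.restr_nonneg _ _ _) (dev_nonneg _ _ _)) hj
    have h5 := mul_le_mul_of_nonneg_left h3 (ha.pull_nonneg S I u)
    have h6 := mul_le_mul_of_nonneg_left h4 (by positivity : 0 ≤ 1 + 4 / θ)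
    simp only [vertexErr, huW, if_true, Finset.sum_const_zero, add_zero]
    linarith
  · have h1 : pull a S I u * (green a S u u + 1 / cond a u + 1) ≤
        ∑ i ∈ S, a i u * (effRes a i u + 1 / cond a u + 1) := by
      have hS : 0 ≤ green a S u u + 1 / cond a u + 1 ∨ S = ∅ := by
        rcases S.eq_empty_or_nonempty with h | h
        · exact Or.inr h
        · left
          have := ha.green_pos h u
          have := one_div_nonneg.2 (ha.cond_nonneg u)
          linarith
      rcases hS with hS | hS
      · refine (mul_le_mul_of_nonneg_right (ha.pull_le hI u) hS).trans ?_
        rw [Finset.sum_mul]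
        refine Finset.sum_le_sum fun i hi => mul_le_mul_of_nonneg_left ?_ (ha.nonneg i u)
        linarith [ha.green_le_effRes hi hu]
      · subst hS
        have : I = ∅ := Finset.subset_empty.1 hI
        simp [pull, this]
    simp only [vertexErr, huW, if_false]
    have := mul_nonneg (by positivity : 0 ≤ 1 + 4 / θ) hnn1
    linarith

end Local

section Local

variable {a : V → V → ℝ} {K θ η ε g : ℝ} {S I : Finset V}

/-- Green function values near `S` are close to those of the complete graph. -/
def GreenApprox (a : V → V → ℝ) (K θ ε g : ℝ) (S : Finset V) : Prop :=
  ∀ u w, u ∉ S → w ∉ S → IsGood a K θ S u → IsGood a K θ S w → dev a u w ≤ θ →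
    |green a S u w - (g + if u = w then 1 / cond a u else 0)| ≤ ε

lemma sum_sum_eq_condSum (a : V → V → ℝ) (S : Finset V) : ∑ u, ∑ i ∈ S, a i u = condSum a S := by
  rw [Finset.sum_comm]; rfl

lemma IsLocal.condSum_le (h : IsLocal a K η S) : condSum a S ≤ S.card * K := by
  rw [← nsmul_eq_mul, ← Finset.sum_const]
  exact Finset.sum_le_sum fun v hv => cond_le_of_mem (h.mem v hv)

lemma IsLocal.sum_pull_le (ha : IsNet a) (h : IsLocal a K η S) (hI : I ⊆ S) :
    ∑ u, pull a S I u ≤ S.card * K :=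
  (Finset.sum_le_sum fun u _ => ha.pull_le hI u).trans
    ((sum_sum_eq_condSum a S).le.trans h.condSum_le)

lemma IsLocal.inv_cond_le (h : IsLocal a K η S) {u : V} (hu : u ∈ S) : 1 / cond a u ≤ 1 := by
  have := one_le_cond_of_mem (h.mem u hu)
  rw [div_le_one (by linarith)]; exact this

lemma IsLocal.abs_trace_sub_le (ha : IsNet a) (h : IsLocal a K η S) (hS : S.Nonempty) (hθ : 0 < θ)
    (hε : 0 ≤ ε) (hI : I ⊆ S) (hg : 0 ≤ g) (hg1 : g ≤ 1) (hG : GreenApprox a K θ ε g S) :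
    |∑ u, pull a S I u * green a S u u -
      (condSum a I * g + ∑ i ∈ I, ∑ u, a i u / cond a u)| ≤
      ε * (S.card * K) + ((1 + 4 / θ) * η + η) + 2 * S.card ^ 2 * η := by
  have e1 : condSum a I * g + ∑ i ∈ I, ∑ u, a i u / cond a u =
      ∑ u, (∑ i ∈ I, a i u) * (g + 1 / cond a u) := by
    rw [← sum_sum_eq_condSum, Finset.sum_mul, Finset.sum_comm (s := I), ← Finset.sum_add_distrib]
    refine Finset.sum_congr rfl fun u _ => ?_
    rw [mul_add, Finset.sum_mul (s := I) (f := fun i => a i u) (a := 1 / cond a u)]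
    congr 1
    exact Finset.sum_congr rfl fun i _ => by ring
  have key : ∀ u, |pull a S I u * green a S u u - (∑ i ∈ I, a i u) * (g + 1 / cond a u)| ≤
      ε * pull a S I u + vertexErr a K θ S u + (if u ∈ S then 2 * S.card * η else 0) := by
    intro u
    have hd := ha.pull_nonneg S I u
    have hE := ha.vertexErr_nonneg (K := K) hθ S u
    by_cases hu : u ∈ S
    · have h1 : ∑ i ∈ I, a i u ≤ S.card * η := by
        rw [← nsmul_eq_mul, ← Finset.sum_const]
        exact (Finset.sum_le_sum_of_subset_of_nonneg hI fun i _ _ => ha.nonneg i u).trans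
          (Finset.sum_le_sum fun i _ => h.small i u)
      have h0 : 0 ≤ ∑ i ∈ I, a i u := Finset.sum_nonneg fun i _ => ha.nonneg i u
      have h2 := h.inv_cond_le hu
      have h3 := one_div_nonneg.2 (ha.cond_nonneg u)
      have hp : pull a S I u = 0 := by simp [pull, hu]
      rw [hp, if_pos hu, zero_mul, zero_sub, abs_neg,
        abs_of_nonneg (mul_nonneg h0 (by linarith))]
      have := mul_le_mul h1 (by linarith : g + 1 / cond a u ≤ 2) (by linarith) (by linarith)
      linarith
    · have hp : pull a S I u = ∑ i ∈ I, a i u := by simp [pull, hu]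
      rw [← hp, ← mul_sub, abs_mul, abs_of_nonneg hd, if_neg hu, add_zero]
      by_cases hgood : IsGood a K θ S u
      · have := hG u u hu hu hgood hgood (by rw [dev_self]; exact hθ.le)
        rw [if_pos rfl] at this
        nlinarith [mul_le_mul_of_nonneg_left this hd]
      · have h1 := h.pull_mul_le ha hθ hI hu hgood
        have h2 : |green a S u u - (g + 1 / cond a u)| ≤ green a S u u + 1 / cond a u + 1 := by
          have := ha.green_pos hS u
          have := one_div_nonneg.2 (ha.cond_nonneg u)
          rw [abs_le]; constructor <;> linarith
        have := mul_le_mul_of_nonneg_left h2 hd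
        have := mul_nonneg hε hd
        linarith
  rw [e1, ← Finset.sum_sub_distrib]
  refine (Finset.abs_sum_le_sum_abs _ _).trans ((Finset.sum_le_sum fun u _ => key u).trans ?_)
  rw [Finset.sum_add_distrib, Finset.sum_add_distrib, ← Finset.mul_sum]
  have h1 := mul_le_mul_of_nonneg_left (h.sum_pull_le ha hI) hε
  have h2 := h.sum_vertexErr_le (K := K) hθ
  have h3 : ∑ u, (if u ∈ S then 2 * (S.card : ℝ) * η else 0) = 2 * S.card ^ 2 * η := by
    rw [Finset.sum_ite_mem, Finset.univ_inter, Finset.sum_const, nsmul_eq_mul]; ring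
  linarith

lemma IsLocal.sum_sq_le (ha : IsNet a) (h : IsLocal a K η S) (hS : S.Nonempty) (hθ : 0 < θ)
    (hε1 : ε ≤ 1) (hη : 0 ≤ η) (hI : I ⊆ S) (hg : 0 ≤ g) (hg1 : g ≤ 1)
    (hG : GreenApprox a K θ ε g S) :
    ∑ u, ∑ w, pull a S I u * pull a S I w * (green a S u w - g) ^ 2 ≤
      2 * ε ^ 2 * (S.card * K) ^ 2 + 2 * (S.card * η) * (S.card * K) + 20 / θ * η +
        4 * ((1 + 4 / θ) * η + η) * (4 * (S.card * K) + ((1 + 4 / θ) * η + η)) := by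
  set d := pull a S I with hd
  set E := vertexErr a K θ S with hE
  set r : V → ℝ := fun u => ∑ i ∈ S, restr a (core a K) i u with hr
  set k : ℝ := (S.card : ℝ) with hk
  have d0 : ∀ u, 0 ≤ d u := ha.pull_nonneg S I
  have E0 : ∀ u, 0 ≤ E u := ha.vertexErr_nonneg (K := K) hθ S
  have r0 : ∀ u, 0 ≤ r u := fun u => Finset.sum_nonneg fun i _ => ha.restr_nonneg _ _ _
  have hic : ∀ u, IsGood a K θ S u → 1 / cond a u ≤ 1 := fun u hu => by
    have := one_le_cond_of_mem hu.1
    rw [div_le_one (by linarith)]; exact this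
  have hdiag : ∀ u, u ∉ S → IsGood a K θ S u → green a S u u ≤ 3 := by
    intro u hu hgood
    have := (abs_le.1 (hG u u hu hu hgood hgood (by rw [dev_self]; exact hθ.le))).2
    rw [if_pos rfl] at this
    linarith [hic u hgood]
  have hEd : ∀ u, u ∉ S → d u * (green a S u u + 1) ≤ 4 * d u + E u := by
    intro u hu
    by_cases hgood : IsGood a K θ S u
    · nlinarith [hdiag u hu hgood, d0 u, E0 u]
    · have h1 := h.pull_mul_le ha hθ hI hu hgood
      have := mul_nonneg (d0 u) (one_div_nonneg.2 (ha.cond_nonneg u))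
      nlinarith [d0 u]
  have hEb : ∀ u, u ∉ S → ¬ IsGood a K θ S u → d u * (green a S u u + 1) ≤ E u := by
    intro u hu hgood
    have h1 := h.pull_mul_le ha hθ hI hu hgood
    have := mul_nonneg (d0 u) (one_div_nonneg.2 (ha.cond_nonneg u))
    nlinarith [d0 u]
  have key : ∀ u w, d u * d w * (green a S u w - g) ^ 2 ≤ 2 * ε ^ 2 * (d u * d w) +
      (if u = w then 2 * (d u * d w) else 0) + 20 / θ * (r u * r w * dev a u w) +
      (2 * (E u * (4 * d w + E w)) + 2 * (E w * (4 * d u + E u))) := by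
    intro u w
    have n1 : 0 ≤ 2 * ε ^ 2 * (d u * d w) :=
      mul_nonneg (by positivity) (mul_nonneg (d0 u) (d0 w))
    have n2 : 0 ≤ (if u = w then 2 * (d u * d w) else 0) := by
      split_ifs
      exacts [mul_nonneg zero_le_two (mul_nonneg (d0 u) (d0 w)), le_rfl]
    have n3 : 0 ≤ 20 / θ * (r u * r w * dev a u w) :=
      mul_nonneg (by positivity) (mul_nonneg (mul_nonneg (r0 u) (r0 w)) (dev_nonneg _ _ _))
    have n4 : 0 ≤ E u * (4 * d w + E w) := mul_nonneg (E0 u) (by linarith [d0 w, E0 w])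
    have n5 : 0 ≤ E w * (4 * d u + E u) := mul_nonneg (E0 w) (by linarith [d0 u, E0 u])
    by_cases huS : u ∈ S
    · have : d u = 0 := by simp [hd, pull, huS]
      have e : d u * d w * (green a S u w - g) ^ 2 = 0 := by rw [this]; ring
      rw [e]; linarith
    by_cases hwS : w ∈ S
    · have : d w = 0 := by simp [hd, pull, hwS]
      have e : d u * d w * (green a S u w - g) ^ 2 = 0 := by rw [this]; ring
      rw [e]; linarith
    have hsq := ha.green_sq_le hS u w
    have p1 := ha.green_pos hS u
    have p2 := ha.green_pos hS w
    have hcr : (green a S u w - g) ^ 2 ≤ 2 * (green a S u u * green a S w w) + 2 := by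
      nlinarith [sq_nonneg (green a S u w + g)]
    have hcr2 : (green a S u w - g) ^ 2 ≤ 2 * ((green a S u u + 1) * (green a S w w + 1)) := by
      nlinarith
    have hdd := mul_nonneg (d0 u) (d0 w)
    by_cases hgu : IsGood a K θ S u
    · by_cases hgw : IsGood a K θ S w
      · rcases le_or_gt (dev a u w) θ with hdev | hdev
        · have h1 := hG u w huS hwS hgu hgw hdev
          have h2 : (green a S u w - g) ^ 2 ≤ 2 * ε ^ 2 + (if u = w then 2 else 0) := by
            split_ifs at h1 ⊢ with huw
            · have h3 := hic u hgu
              have h4 := one_div_nonneg.2 (ha.cond_nonneg u)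
              have h5 := sq_le_sq' (abs_le.1 h1).1 (abs_le.1 h1).2
              set t := 1 / cond a u
              nlinarith [sq_nonneg (green a S u w - (g + t) - t)]
            · rw [add_zero] at h1
              have h5 := sq_le_sq' (abs_le.1 h1).1 (abs_le.1 h1).2
              nlinarith [sq_nonneg ε]
          have h3 := mul_le_mul_of_nonneg_left h2 hdd
          have h4 : d u * d w * (if u = w then (2 : ℝ) else 0) =
              if u = w then 2 * (d u * d w) else 0 := by split_ifs <;> ring
          rw [mul_add, h4] at h3
          linarith
        · have h2 : (green a S u w - g) ^ 2 ≤ 20 / θ * dev a u w := by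
            have h3 := mul_le_mul (hdiag u huS hgu) (hdiag w hwS hgw) p2.le (by norm_num)
            have : 20 ≤ 20 / θ * dev a u w := by
              rw [div_mul_eq_mul_div, le_div_iff₀ hθ]; nlinarith
            linarith
          have h3 := mul_le_mul_of_nonneg_left h2 hdd
          have h4 := mul_le_mul (ha.pull_le_restr h.mem hI hgu.1) (ha.pull_le_restr h.mem hI hgw.1)
            (d0 w) (r0 u)
          have h5 := mul_le_mul_of_nonneg_right h4
            (mul_nonneg (by positivity : 0 ≤ 20 / θ) (dev_nonneg a u w))
          have h6 : d u * d w * (20 / θ * dev a u w) ≤ 20 / θ * (r u * r w * dev a u w) := by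
            linarith
          linarith
      · have h1 := mul_le_mul_of_nonneg_left hcr2 hdd
        have h2 := mul_le_mul (hEb w hwS hgw) (hEd u huS)
          (mul_nonneg (d0 u) (by linarith)) (E0 w)
        linarith
    · have h1 := mul_le_mul_of_nonneg_left hcr2 hdd
      have h2 := mul_le_mul (hEb u huS hgu) (hEd w hwS)
        (mul_nonneg (d0 w) (by linarith)) (E0 u)
      linarith
  refine (Finset.sum_le_sum fun u _ => Finset.sum_le_sum fun w _ => key u w).trans ?_
  simp only [Finset.sum_add_distrib, ← Finset.mul_sum]
  set D := ∑ u, d u with hD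
  set F := ∑ u, E u with hF
  have hD0 : 0 ≤ D := Finset.sum_nonneg fun u _ => d0 u
  have hF0 : 0 ≤ F := Finset.sum_nonneg fun u _ => E0 u
  have hDle : D ≤ k * K := h.sum_pull_le ha hI
  have hFle : F ≤ (1 + 4 / θ) * η + η := h.sum_vertexErr_le (K := K) hθ
  have s1 : ∑ u, d u * D = D * D := by rw [← Finset.sum_mul]
  have s2 : ∑ u, ∑ w, (if u = w then 2 * (d u * d w) else 0) ≤ 2 * (k * η) * D := by
    rw [hD, Finset.mul_sum]
    refine Finset.sum_le_sum fun u _ => ?_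
    rw [Finset.sum_ite_eq, if_pos (Finset.mem_univ u)]
    have : d u ≤ k * η := (ha.pull_le hI u).trans (by
      rw [hk, ← nsmul_eq_mul, ← Finset.sum_const]
      exact Finset.sum_le_sum fun i _ => h.small i u)
    nlinarith [d0 u]
  have s3 : ∑ u, ∑ w, r u * r w * dev a u w ≤ η := by
    refine le_trans (le_of_eq ?_) h.pair
    simp only [hr, Finset.sum_mul_sum]
    simp only [Finset.sum_mul]
    rw [show (∑ u, ∑ w, ∑ i ∈ S, ∑ j ∈ S, restr a (core a K) i u * restr a (core a K) j w *
      dev a u w) = ∑ u, ∑ i ∈ S, ∑ w, ∑ j ∈ S, restr a (core a K) i u * restr a (core a K) j w *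
      dev a u w from Finset.sum_congr rfl fun u _ => Finset.sum_comm]
    rw [Finset.sum_comm]
    refine Finset.sum_congr rfl fun i _ => ?_
    rw [show (∑ u, ∑ w, ∑ j ∈ S, restr a (core a K) i u * restr a (core a K) j w *
      dev a u w) = ∑ u, ∑ j ∈ S, ∑ w, restr a (core a K) i u * restr a (core a K) j w *
      dev a u w from Finset.sum_congr rfl fun u _ => Finset.sum_comm]
    rw [Finset.sum_comm]
  have s4 : ∑ u, E u * (4 * D + F) = F * (4 * D + F) := by rw [← Finset.sum_mul]
  have s5 : ∑ u, ∑ w, E w * (4 * d u + E u) = F * (4 * D + F) := by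
    rw [Finset.sum_comm]
    simp only [← Finset.mul_sum, Finset.sum_add_distrib]
    rw [← Finset.sum_mul]
  rw [s1, s4, s5]
  have t1 : D * D ≤ (k * K) ^ 2 := by rw [sq]; exact mul_le_mul hDle hDle hD0 (hD0.trans hDle)
  have t2 : F * (4 * D + F) ≤ ((1 + 4 / θ) * η + η) * (4 * (k * K) + ((1 + 4 / θ) * η + η)) :=
    mul_le_mul hFle (by linarith) (by linarith) (hF0.trans hFle)
  have t3 := mul_le_mul_of_nonneg_left t1 (by positivity : 0 ≤ 2 * ε ^ 2)
  have t4 := mul_le_mul_of_nonneg_left hDle (by positivity : 0 ≤ 2 * (k * η))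
  have t5 := mul_le_mul_of_nonneg_left s3 (by positivity : 0 ≤ 20 / θ)
  linarith

end Local

lemma eventually_lt_of_continuous {f : ℝ → ℝ} (hf : Continuous f) {t : ℝ} (h : f 0 < t) :
    ∀ᶠ x in nhdsWithin (0 : ℝ) (Set.Ioi 0), f x < t :=
  ((hf.tendsto 0).eventually (gt_mem_nhds h)).filter_mono nhdsWithin_le_nhds

/-- Hitting determinants of a local set with killed transitions. -/
lemma exists_killed_approx (K : ℝ) (hK : 1 ≤ K) (s : ℕ) : ∀ ε > 0, ∃ η > 0,
    ∀ (V : Type) [Fintype V] [DecidableEq V] (a : V → V → ℝ), IsNet a →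
      ∀ Z, 0 < Z → (∀ x, Z = (dirLap a {x}).det) →
      ∀ S I : Finset V, S.card = s + 1 → I ⊆ S → IsLocal a K η S →
        |(dirLap (killed a I) S).det / Z - Real.exp (-∑ i ∈ I, ∑ u, a i u / cond a u) *
          condSum a (S \ I) / ∏ v ∈ S, cond a v| ≤ ε := by
  intro ε' hε'
  set k : ℝ := ((s + 1 : ℕ) : ℝ) with hk
  have hk0 : 0 < k := by rw [hk]; positivity
  set κ := min 1 (ε' / (16 * k)) with hκ
  have hκ0 : 0 < κ := lt_min one_pos (by positivity)
  have hκ1 : κ ≤ 1 := min_le_left _ _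
  have hκk : 8 * κ * k ≤ ε' / 2 := by
    have := min_le_right 1 (ε' / (16 * k))
    rw [← hκ, le_div_iff₀ (by positivity)] at this
    linarith
  set ε := min 1 (κ ^ 2 / (8 * (k * K))) with hε
  have hε0 : 0 < ε := lt_min one_pos (by positivity)
  have hε1 : ε ≤ 1 := min_le_left _ _
  have hεk : ε * (k * K) ≤ κ ^ 2 / 8 := by
    have := min_le_right 1 (κ ^ 2 / (8 * (k * K)))
    rw [← hε, le_div_iff₀ (by positivity)] at this
    linarith
  obtain ⟨θ₁, hθ₁, hgreen⟩ := exists_green_approx K hK s ε hε0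
  obtain ⟨θ₂, hθ₂, hdet⟩ := exists_detRatio_approx K hK s (ε' / 2) (by positivity)
  have ev : ∀ᶠ η in nhdsWithin (0 : ℝ) (Set.Ioi 0), 0 < η ∧ η < θ₁ ∧ η < θ₂ ∧
      ((1 + 4 / θ₁) * η + η) + 2 * k ^ 2 * η < κ ^ 2 / 2 ∧
      2 * (k * η) * (k * K) + 20 / θ₁ * η + 4 * ((1 + 4 / θ₁) * η + η) *
        (4 * (k * K) + ((1 + 4 / θ₁) * η + η)) < (κ ^ 2) ^ 2 / 32 := by
    refine (eventually_mem_nhdsWithin).and ((eventually_lt_of_continuous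
      (f := fun η => η) (by fun_prop) (by simpa)).and
      ((eventually_lt_of_continuous (f := fun η => η) (by fun_prop) (by simpa)).and
      ((eventually_lt_of_continuous (by fun_prop) (by simp; positivity)).and
      (eventually_lt_of_continuous (by fun_prop) (by simp; positivity)))))
  obtain ⟨η, hη, hη1, hη2, hη3, hη4⟩ := ev.exists
  refine ⟨η, hη, ?_⟩
  intro V _ _ a ha Z hZ hZx S I hcard hI h
  have hSne : S.Nonempty := Finset.card_pos.1 (by omega)
  have hcardk : (S.card : ℝ) = k := by rw [hcard]
  have hsp : IsSpread a K θ₂ S := ⟨h.mem, fun u hu v hv => (h.dev_le u hu v hv).trans hη2.le⟩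
  set g := 1 / condSum a S with hgdef
  have hCS := hsp.one_le_condSum hSne
  have hg : 0 ≤ g := one_div_nonneg.2 (by linarith)
  have hg1 : g ≤ 1 := by rw [hgdef, div_le_one (by linarith)]; exact hCS
  have hG : GreenApprox a K θ₁ ε g S := by
    intro u w hu hw hgu hgw hdev
    have hdev' : dev a w u ≤ θ₁ := by rw [ha.dev_comm]; exact hdev
    refine hgreen V a ha S hcard u w hu hw ⟨?_, ?_⟩
    · simp only [Finset.mem_insert]
      rintro v (rfl | rfl | hv)
      exacts [hgu.1, hgw.1, h.mem v hv]
    · simp only [Finset.mem_insert]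
      rintro x (rfl | rfl | hx) y (rfl | rfl | hy)
      · rw [dev_self]; exact hθ₁.le
      · exact hdev
      · rw [ha.dev_comm]; exact hgu.2 y hy
      · exact hdev'
      · rw [dev_self]; exact hθ₁.le
      · rw [ha.dev_comm]; exact hgw.2 y hy
      · exact hgu.2 x hx
      · exact hgw.2 x hx
      · exact (h.dev_le x hx y hy).trans hη1.le
  have htr := h.abs_trace_sub_le ha hSne hθ₁ hε0.le hI hg hg1 hG
  have hQ := h.sum_sq_le ha hSne hθ₁ hε1 hη.le hI hg hg1 hG
  rw [hcardk] at htr hQ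
  have hcI0 : 0 ≤ condSum a I := Finset.sum_nonneg fun v _ => ha.cond_nonneg v
  have hcI : condSum a I ≤ condSum a S :=
    Finset.sum_le_sum_of_subset_of_nonneg hI fun v _ _ => ha.cond_nonneg v
  set b := ∑ i ∈ I, ∑ u, a i u / cond a u with hb
  have hb0 : 0 ≤ b := Finset.sum_nonneg fun i _ => Finset.sum_nonneg fun u _ =>
    div_nonneg (ha.nonneg i u) (ha.cond_nonneg u)
  have hs0 : 0 ≤ condSum a I * g := mul_nonneg hcI0 hg
  have hs1 : condSum a I * g ≤ 1 := by
    rw [hgdef, mul_one_div, div_le_one (by linarith)]; exact hcI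
  have hpull : condSum a I - k ^ 2 * η ≤ ∑ u, pull a S I u ∧
      ∑ u, pull a S I u ≤ condSum a I := by
    have e : condSum a I - ∑ u, pull a S I u = ∑ u ∈ S, ∑ i ∈ I, a i u := by
      rw [← sum_sum_eq_condSum, ← Finset.sum_sub_distrib, ← Finset.sum_filter_add_sum_filter_not
        univ (· ∈ S)]
      have : ∑ u ∈ univ.filter (· ∉ S), (∑ i ∈ I, a i u - pull a S I u) = 0 :=
        Finset.sum_eq_zero fun u hu => by
          rw [Finset.mem_filter] at hu
          simp [pull, hu.2]
      rw [this, add_zero]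
      simp only [Finset.filter_mem_eq_inter, Finset.univ_inter]
      exact Finset.sum_congr rfl fun u hu => by simp [pull, hu]
    have e1 : 0 ≤ ∑ u ∈ S, ∑ i ∈ I, a i u :=
      Finset.sum_nonneg fun u _ => Finset.sum_nonneg fun i _ => ha.nonneg i u
    have e2 : ∑ u ∈ S, ∑ i ∈ I, a i u ≤ k ^ 2 * η := by
      calc ∑ u ∈ S, ∑ i ∈ I, a i u ≤ ∑ u ∈ S, ∑ i ∈ S, η := Finset.sum_le_sum fun u _ =>
            (Finset.sum_le_sum_of_subset_of_nonneg hI fun i _ _ => ha.nonneg i u).trans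
              (Finset.sum_le_sum fun i _ => h.small i u)
        _ = k ^ 2 * η := by
            simp only [Finset.sum_const, nsmul_eq_mul, hcardk]; ring
    constructor <;> linarith
  have hkη : 0 ≤ k ^ 2 * η := by positivity
  have hθη : 0 ≤ (1 + 4 / θ₁) * η + η := by positivity
  have hdetN := ha.abs_det_one_sub_pullMat_sub_le hSne hI (g := g) (s := condSum a I * g) (b := b)
    (κ := κ) hg hs0 hs1 hb0 hκ0.le hκ1
    (by rw [mul_comm]; exact mul_le_mul_of_nonneg_right hpull.2 hg)
    (by
      have h1 := mul_le_mul_of_nonneg_right hpull.1 hg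
      have h2 := mul_le_mul_of_nonneg_left hg1 hkη
      linarith)
    (htr.trans (by linarith [sq_nonneg κ]))
    (hQ.trans (by
      have h1 : (ε * (k * K)) ^ 2 ≤ (κ ^ 2 / 8) ^ 2 := pow_le_pow_left₀ (by positivity) hεk 2
      have e1 : 2 * ε ^ 2 * (k * K) ^ 2 = 2 * (ε * (k * K)) ^ 2 := by ring
      have e2 : (κ ^ 2 / 8) ^ 2 = (κ ^ 2) ^ 2 / 64 := by ring
      have e3 : (κ ^ 2 / 4) ^ 2 = (κ ^ 2) ^ 2 / 16 := by ring
      linarith))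
  have hτ := hdet V a ha Z hZ hZx S hcard hsp
  have hτ1 := condSum_div_prod_le hsp
  rw [hcardk] at hτ1
  have hprod : 0 < ∏ v ∈ S, cond a v := Finset.prod_pos fun v hv =>
    zero_lt_one.trans_le (one_le_cond_of_mem (h.mem v hv))
  have hmem := ha.det_one_sub_pullMat_mem hSne hI
  have e1 : (dirLap (killed a I) S).det / Z = detRatio a Z S * (1 - pullMat a S I).det := by
    rw [ha.det_dirLap_killed hSne hI, detRatio]; ring
  have e2 : Real.exp (-b) * condSum a (S \ I) / ∏ v ∈ S, cond a v =
      (condSum a S / ∏ v ∈ S, cond a v) * ((1 - condSum a I * g) * Real.exp (-b)) := by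
    have : condSum a (S \ I) = condSum a S * (1 - condSum a I * g) := by
      have h1 : condSum a (S \ I) + condSum a I = condSum a S := Finset.sum_sdiff hI
      rw [hgdef, mul_sub, mul_one, ← h1]
      have : condSum a (S \ I) + condSum a I ≠ 0 := by rw [h1]; linarith
      field_simp; ring
    rw [this]; ring
  rw [e1, e2]
  set τ := detRatio a Z S
  set τ₀ := condSum a S / ∏ v ∈ S, cond a v
  set X := (1 - pullMat a S I).det
  set Y := (1 - condSum a I * g) * Real.exp (-b)
  have hτ0 : 0 ≤ τ₀ := div_nonneg (by linarith) hprod.le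
  have e3 : τ * X - τ₀ * Y = (τ - τ₀) * X + τ₀ * (X - Y) := by ring
  rw [e3]
  refine (abs_add_le _ _).trans ?_
  rw [abs_mul, abs_mul, abs_of_nonneg hmem.1, abs_of_nonneg hτ0]
  have h1 := mul_le_mul hτ hmem.2 hmem.1 (by positivity)
  have h2 := mul_le_mul hτ1 hdetN (abs_nonneg _) hk0.le
  linarith

/-! ### The matrix-tree theorem for rooted forests -/

/-- A map whose functional graph is a forest rooted at `S`. -/
def IsForest (S : Finset V) (f : V → V) : Prop :=
  (∀ s ∈ S, f s = s) ∧ ∀ v, ∃ m, f^[m] v ∈ S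

/-- The Laplacian of a functional graph with Dirichlet boundary condition on `S`. -/
def funLap (S : Finset V) (f : V → V) : Matrix V V ℝ :=
  Matrix.of fun u v => (if u = v then 1 else 0) - if u ∉ S ∧ v ∉ S ∧ f u = v then 1 else 0

/-- The number of steps needed to reach the roots of a forest. -/
def hitTime (S : Finset V) (f : V → V) (v : V) : ℕ :=
  if h : ∃ m, f^[m] v ∈ S then Nat.find h else 0

lemma hitTime_lt {S : Finset V} {f : V → V} (hf : IsForest S f) {u : V} (hu : u ∉ S) :
    hitTime S f (f u) < hitTime S f u := by
  unfold hitTime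
  rw [dif_pos (hf.2 u), dif_pos (hf.2 (f u))]
  have h1 := Nat.find_spec (hf.2 u)
  set m := Nat.find (hf.2 u) with hm
  cases hm' : m with
  | zero => rw [hm'] at h1; exact absurd h1 hu
  | succ j =>
    rw [hm', Function.iterate_succ_apply] at h1
    exact (Nat.find_min' (hf.2 (f u)) h1).trans_lt (Nat.lt_succ_self j)

lemma det_funLap_of_isForest {S : Finset V} {f : V → V} (hf : IsForest S f) :
    (funLap S f).det = 1 := by
  have htri : (funLap S f).BlockTriangular (fun v => OrderDual.toDual (hitTime S f v)) := by
    intro i j hij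
    have hij' : hitTime S f i < hitTime S f j := hij
    have h1 : i ≠ j := by rintro rfl; exact lt_irrefl _ hij'
    have h2 : ¬ (i ∉ S ∧ j ∉ S ∧ f i = j) := by
      rintro ⟨hi, -, rfl⟩
      exact lt_asymm hij' (hitTime_lt hf hi)
    simp [funLap, h1, h2]
  rw [htri.det]
  refine Finset.prod_eq_one fun k _ => ?_
  have : (funLap S f).toSquareBlock (fun v => OrderDual.toDual (hitTime S f v)) k = 1 := by
    ext i j
    have h2 : ¬ ((i : V) ∉ S ∧ (j : V) ∉ S ∧ f i = j) := by
      rintro ⟨hi, -, h⟩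
      have := hitTime_lt hf hi
      rw [h] at this
      have e : hitTime S f i = hitTime S f j := by
        have := i.2.trans j.2.symm
        exact this
      omega
    simp only [Matrix.toSquareBlock_def, funLap, Matrix.of_apply, h2, if_false, sub_zero,
      Matrix.one_apply, Subtype.ext_iff]
  rw [this, Matrix.det_one]

lemma det_funLap_of_not_isForest {S : Finset V} {f : V → V} (hf : ¬ ∀ v, ∃ m, f^[m] v ∈ S) :
    (funLap S f).det = 0 := by
  rw [← Matrix.exists_mulVec_eq_zero_iff]
  refine ⟨fun v => if ∃ m, f^[m] v ∈ S then 0 else 1, ?_, ?_⟩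
  · intro h
    apply hf
    intro v
    by_contra hv
    have := congrFun h v
    simp [hv] at this
  · funext u
    simp only [Matrix.mulVec, dotProduct, funLap, Matrix.of_apply, sub_mul, ite_mul, one_mul,
      zero_mul, Finset.sum_sub_distrib, Finset.sum_ite_eq, Finset.mem_univ, if_true, Pi.zero_apply]
    by_cases hu : u ∈ S
    · have : ∃ m, f^[m] u ∈ S := ⟨0, hu⟩
      simp [hu, this]
    · have h1 : (∃ m, f^[m] u ∈ S) ↔ ∃ m, f^[m] (f u) ∈ S := by
        constructor
        · rintro ⟨m, hm⟩
          cases m with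
          | zero => exact absurd hm hu
          | succ m => exact ⟨m, by rwa [← Function.iterate_succ_apply]⟩
        · rintro ⟨m, hm⟩
          exact ⟨m + 1, by rwa [Function.iterate_succ_apply]⟩
      rw [Finset.sum_eq_single (f u)]
      · by_cases hfu : f u ∈ S
        · have : ∃ m, f^[m] (f u) ∈ S := ⟨0, hfu⟩
          simp [h1, this]
        · simp [hu, hfu, h1]
      · intro v _ hv
        simp [Ne.symm hv]
      · simp

/-- The determinant of the Dirichlet Laplacian counts weighted forests rooted at the boundary. -/
lemma det_dirLap_eq_sum (w : V → V → ℝ) (S : Finset V) :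
    (dirLap w S).det = ∑ f ∈ univ.filter (IsForest S), ∏ v ∈ univ.filter (· ∉ S), w v (f v) := by
  set ω : V → V → ℝ := fun u x => if u ∈ S then (if x = u then 1 else 0) else w u x with hω
  set ρ : V → V → V → ℝ := fun u x v =>
    (if u = v then 1 else 0) - if u ∉ S ∧ v ∉ S ∧ x = v then 1 else 0 with hρ
  have hρ' : ∀ u x v, ρ u x v = (if u = v then 1 else 0) - if u ∉ S ∧ v ∉ S ∧ x = v then 1 else 0 :=
    fun _ _ _ => rfl
  have hrow : dirLap w S = fun u => ∑ x, ω u x • (if u ∉ S then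
      (fun v => if v ∈ S then 0 else ρ u x v) else ρ u x) := by
    funext u v
    rw [Finset.sum_apply]
    simp only [Pi.smul_apply, smul_eq_mul, dirLap, Matrix.of_apply]
    by_cases hu : u ∈ S
    · simp [hω, hρ', hu]
    by_cases hv : v ∈ S
    · have : u ≠ v := by rintro rfl; exact hu hv
      simp [hu, hv, this]
    · simp only [hω, hρ', hu, hv, or_self, if_false, not_false_eq_true, true_and, if_true,
        mul_sub, Finset.sum_sub_distrib, mul_ite, mul_one, mul_zero, Finset.sum_ite_eq',
        Finset.mem_univ]
      congr 1
      split_ifs <;> simp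
  have hdet : (dirLap w S).det = ∑ f : V → V, (∏ v, ω v (f v)) * (funLap S f).det := by
    have h1 := (Matrix.detRowAlternating (n := V) (R := ℝ)).toMultilinearMap.map_sum
      (fun u x => ω u x • (if u ∉ S then (fun v => if v ∈ S then 0 else ρ u x v) else ρ u x))
    have h2 : (dirLap w S).det = (Matrix.detRowAlternating (n := V) (R := ℝ)).toMultilinearMap
        (fun u => ∑ x, ω u x • (if u ∉ S then
          (fun v => if v ∈ S then 0 else ρ u x v) else ρ u x)) := by
      rw [← hrow]; rfl
    rw [h2, h1]
    refine Finset.sum_congr rfl fun f _ => ?_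
    rw [MultilinearMap.map_smul_univ, smul_eq_mul]
    congr 1
    have : (funLap S f) = fun u => (if u ∉ S then
        (fun v => if v ∈ S then 0 else ρ u (f u) v) else ρ u (f u)) := by
      funext u v
      simp only [funLap, Matrix.of_apply]
      by_cases hu : u ∈ S
      · simp [hu, hρ']
      · by_cases hv : v ∈ S
        · have : u ≠ v := by rintro rfl; exact hu hv
          simp [hu, hv, this]
        · simp [hu, hv, hρ']
    rw [this]; rfl
  rw [hdet, Finset.sum_filter]
  refine Finset.sum_congr rfl fun f _ => ?_
  by_cases h1 : ∀ s ∈ S, f s = s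
  · have hprod : ∏ v, ω v (f v) = ∏ v ∈ univ.filter (· ∉ S), w v (f v) := by
      rw [Finset.prod_filter]
      refine Finset.prod_congr rfl fun v _ => ?_
      by_cases hv : v ∈ S
      · simp [hω, hv, h1 v hv]
      · simp [hω, hv]
    by_cases h2 : ∀ v, ∃ m, f^[m] v ∈ S
    · rw [if_pos ⟨h1, h2⟩, det_funLap_of_isForest ⟨h1, h2⟩, hprod, mul_one]
    · rw [if_neg (fun h => h2 h.2), det_funLap_of_not_isForest h2, mul_zero]
  · rw [if_neg (fun h => h1 h.1)]
    push Not at h1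
    obtain ⟨s, hs, hfs⟩ := h1
    rw [Finset.prod_eq_zero (Finset.mem_univ s) (by simp [hω, hs, hfs]), zero_mul]

/-! ### Spanning trees as rooted forests -/

/-- The edges of the tree on `V` rooted at `x` with parent map `f`. -/
def edgesOf (x : V) (f : V → V) : Finset (Sym2 V) :=
  (univ.filter (· ≠ x)).image fun v => s(v, f v)

/-- The weights of the network `(G, c)`, as a function of pairs of vertices. -/
def netOf (G : SimpleGraph V) (c : Sym2 V → ℝ) (u v : V) : ℝ := if G.Adj u v then c s(u, v) else 0

lemma mem_edgesOf {x : V} {f : V → V} {u v : V} :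
    s(u, v) ∈ edgesOf x f ↔ (u ≠ x ∧ f u = v) ∨ (v ≠ x ∧ f v = u) := by
  simp only [edgesOf, mem_image, mem_filter, mem_univ, true_and, Sym2.eq_iff]
  constructor
  · rintro ⟨w, hw, ⟨rfl, h⟩ | ⟨rfl, h⟩⟩
    · exact Or.inl ⟨hw, h⟩
    · exact Or.inr ⟨hw, h⟩
  · rintro (⟨hu, h⟩ | ⟨hv, h⟩)
    · exact ⟨u, hu, Or.inl ⟨rfl, h⟩⟩
    · exact ⟨v, hv, Or.inr ⟨rfl, h⟩⟩

namespace IsForest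

variable {x : V} {f g : V → V}

lemma hitTime_lt' (hf : IsForest {x} f) {u : V} (hu : u ≠ x) :
    hitTime {x} f (f u) < hitTime {x} f u :=
  hitTime_lt hf (by simpa using hu)

lemma apply_ne (hf : IsForest {x} f) {u : V} (hu : u ≠ x) : f u ≠ u := fun h => by
  have := hf.hitTime_lt' hu
  rw [h] at this
  exact lt_irrefl _ this

lemma apply_apply_ne (hf : IsForest {x} f) {u : V} (hu : u ≠ x) (hfu : f u ≠ x) :
    f (f u) ≠ u := fun h => by
  have h1 := hf.hitTime_lt' hu
  have h2 := hf.hitTime_lt' hfu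
  rw [h] at h2
  exact lt_asymm h1 h2

lemma adj_iff (hf : IsForest {x} f) {u v : V} :
    (SimpleGraph.fromEdgeSet (↑(edgesOf x f) : Set (Sym2 V))).Adj u v ↔
      (u ≠ x ∧ f u = v) ∨ (v ≠ x ∧ f v = u) := by
  rw [SimpleGraph.fromEdgeSet_adj, mem_coe, mem_edgesOf]
  constructor
  · exact fun h => h.1
  · intro h
    refine ⟨h, ?_⟩
    rintro rfl
    rcases h with h | h <;> exact hf.apply_ne h.1 h.2

lemma injOn_edges (hf : IsForest {x} f) :
    Set.InjOn (fun v => s(v, f v)) (↑(univ.filter (· ≠ x)) : Set V) := by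
  intro u hu v hv h
  simp only [coe_filter, mem_univ, true_and, Set.mem_ofPred_eq] at hu hv
  rcases Sym2.eq_iff.1 h with h | h
  · exact h.1
  · exact absurd (by rw [h.2]; exact h.1.symm) (hf.apply_apply_ne hu (h.2 ▸ hv))

lemma card_edgesOf (hf : IsForest {x} f) : (edgesOf x f).card + 1 = Fintype.card V := by
  rw [edgesOf, card_image_of_injOn hf.injOn_edges, filter_ne', card_erase_of_mem (mem_univ _),
    card_univ]
  have : 0 < Fintype.card V := Fintype.card_pos_iff.2 ⟨x⟩
  omega

lemma isTree (hf : IsForest {x} f) :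
    (SimpleGraph.fromEdgeSet (↑(edgesOf x f) : Set (Sym2 V))).IsTree := by
  have hreach : ∀ m, ∀ v, hitTime {x} f v = m →
      (SimpleGraph.fromEdgeSet (↑(edgesOf x f) : Set (Sym2 V))).Reachable v x := by
    intro m
    induction m using Nat.strong_induction_on with
    | _ m ih =>
      intro v hv
      by_cases hvx : v = x
      · rw [hvx]
      · have h1 := hf.hitTime_lt' hvx
        exact (SimpleGraph.Adj.reachable (hf.adj_iff.2 (Or.inl ⟨hvx, rfl⟩))).trans
          (ih _ (hv ▸ h1) _ rfl)
  rw [SimpleGraph.isTree_iff_connected_and_card]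
  have : Nonempty V := ⟨x⟩
  refine ⟨⟨fun u v => (hreach _ u rfl).trans (hreach _ v rfl).symm⟩, ?_⟩
  have hdiag : (↑(edgesOf x f) : Set (Sym2 V)) \ Sym2.diagSet = ↑(edgesOf x f) := by
    rw [sdiff_eq_left, Set.disjoint_left]
    intro e
    induction e using Sym2.ind with
    | _ u v =>
      intro h h'
      rw [mem_coe, mem_edgesOf] at h
      have h2 : u = v := by simpa using h'
      subst h2
      rcases h with h | h <;> exact hf.apply_ne h.1 h.2
  rw [SimpleGraph.edgeSet_fromEdgeSet, hdiag, Nat.card_eq_fintype_card, Nat.card_eq_fintype_card]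
  simpa using hf.card_edgesOf

lemma eq_of_edgesOf_eq (hf : IsForest {x} f) (hg : IsForest {x} g)
    (h : edgesOf x f = edgesOf x g) : f = g := by
  by_contra hne
  obtain ⟨v, hv⟩ := Function.ne_iff.1 hne
  have hstep : ∀ v, (v ≠ x ∧ f v ≠ g v) → (f v ≠ x ∧ f (f v) ≠ g (f v)) := by
    rintro v ⟨hvx, hv⟩
    have h1 : s(v, f v) ∈ edgesOf x g := h ▸ mem_edgesOf.2 (Or.inl ⟨hvx, rfl⟩)
    rcases mem_edgesOf.1 h1 with h1 | h1
    · exact absurd h1.2.symm hv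
    · exact ⟨h1.1, fun h2 => hf.apply_apply_ne hvx h1.1 (h2.trans h1.2)⟩
  have hvx : v ≠ x := by
    rintro rfl
    exact hv ((hf.1 v (mem_singleton_self v)).trans (hg.1 v (mem_singleton_self v)).symm)
  have hall : ∀ m, f^[m] v ≠ x ∧ f (f^[m] v) ≠ g (f^[m] v) := by
    intro m
    induction m with
    | zero => exact ⟨hvx, hv⟩
    | succ m ih => rw [Function.iterate_succ_apply']; exact hstep _ ih
  obtain ⟨m, hm⟩ := hf.2 v
  exact (hall m).1 (mem_singleton.1 hm)

end IsForest

lemma exists_isForest_of_isTree {T : Finset (Sym2 V)} (hd : ∀ e ∈ T, ¬ e.IsDiag)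
    (hT : (SimpleGraph.fromEdgeSet (↑T : Set (Sym2 V))).IsTree) (x : V) :
    ∃ f, IsForest {x} f ∧ edgesOf x f = T := by
  set H := SimpleGraph.fromEdgeSet (↑T : Set (Sym2 V)) with hH
  have hnext : ∀ v, ∃ w, (v = x → w = x) ∧ (v ≠ x → H.Adj v w ∧ H.dist w x < H.dist v x) := by
    intro v
    by_cases hv : v = x
    · exact ⟨x, fun _ => rfl, fun h => absurd hv h⟩
    obtain ⟨q, hq⟩ := (hT.connected v x).exists_walk_length_eq_dist
    cases q with
    | nil => exact absurd rfl hv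
    | cons h q' =>
      refine ⟨_, fun h => absurd h hv, fun _ => ⟨h, ?_⟩⟩
      rw [← hq, SimpleGraph.Walk.length_cons]
      exact Nat.lt_succ_of_le (SimpleGraph.dist_le q')
  choose f hf1 hf2 using hnext
  have hfor : IsForest {x} f := by
    refine ⟨fun s hs => (hf1 s (mem_singleton.1 hs)).trans (mem_singleton.1 hs).symm, ?_⟩
    have : ∀ m v, H.dist v x = m → ∃ j, f^[j] v ∈ ({x} : Finset V) := by
      intro m
      induction m using Nat.strong_induction_on with
      | _ m ih =>
        intro v hv
        by_cases hvx : v = x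
        · exact ⟨0, mem_singleton.2 hvx⟩
        · obtain ⟨j, hj⟩ := ih _ (hv ▸ (hf2 v hvx).2) _ rfl
          exact ⟨j + 1, by rwa [Function.iterate_succ_apply]⟩
    exact fun v => this _ v rfl
  refine ⟨f, hfor, Finset.eq_of_subset_of_card_le ?_ ?_⟩
  · intro e he
    simp only [edgesOf, mem_image, mem_filter, mem_univ, true_and] at he
    obtain ⟨v, hv, rfl⟩ := he
    exact (SimpleGraph.fromEdgeSet_adj (s := (↑T : Set (Sym2 V)))).1 (hf2 v hv).1 |>.1
  · have h1 := (SimpleGraph.isTree_iff_connected_and_card.1 hT).2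
    have hdiag : (↑T : Set (Sym2 V)) \ Sym2.diagSet = ↑T := by
      rw [sdiff_eq_left, Set.disjoint_left]
      exact fun e he h => hd e he (by simpa using h)
    rw [hH, SimpleGraph.edgeSet_fromEdgeSet, hdiag, Nat.card_eq_fintype_card,
      Nat.card_eq_fintype_card] at h1
    have h2 := hfor.card_edgesOf
    have h3 : Fintype.card ↑(↑T : Set (Sym2 V)) = T.card := by simp
    omega

/-- A sum over spanning trees is a sum over maps to the parent with respect to a root `x`. -/
lemma sum_spanningTrees (G : SimpleGraph V) (c : Sym2 V → ℝ) (x : V)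
    (Pr : SimpleGraph V → Prop) :
    ∑ T ∈ spanningTrees G,
      (if Pr (SimpleGraph.fromEdgeSet (↑T : Set (Sym2 V))) then treeWeight c T else 0) =
    ∑ f ∈ univ.filter (IsForest {x}),
      if Pr (SimpleGraph.fromEdgeSet (↑(edgesOf x f) : Set (Sym2 V))) then
        ∏ v ∈ univ.filter (· ∉ ({x} : Finset V)), netOf G c v (f v) else 0 := by
  have himg : spanningTrees G = ((univ.filter (IsForest {x})).filter
      fun f => ∀ v, v ≠ x → G.Adj v (f v)).image (edgesOf x) := by
    ext T
    simp only [spanningTrees, mem_filter, mem_univ, true_and, mem_image]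
    constructor
    · rintro ⟨hT, htree⟩
      obtain ⟨f, hf, rfl⟩ := exists_isForest_of_isTree
        (fun e he => G.not_isDiag_of_mem_edgeSet (hT he)) htree x
      refine ⟨f, ⟨hf, fun v hv => ?_⟩, rfl⟩
      exact hT (mem_coe.2 (mem_edgesOf.2 (Or.inl ⟨hv, rfl⟩)))
    · rintro ⟨f, ⟨hf, hadj⟩, rfl⟩
      refine ⟨?_, hf.isTree⟩
      intro e he
      simp only [edgesOf, coe_image, Set.mem_image, coe_filter, mem_univ, true_and,
        Set.mem_ofPred_eq] at he
      obtain ⟨v, hv, rfl⟩ := he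
      exact hadj v hv
  rw [himg, sum_image]
  · rw [sum_filter]
    refine sum_congr rfl fun f hf => ?_
    have hf' := (mem_filter.1 hf).2
    have hset : univ.filter (· ∉ ({x} : Finset V)) = univ.filter (· ≠ x) := by
      ext; simp
    by_cases hadj : ∀ v, v ≠ x → G.Adj v (f v)
    · rw [if_pos hadj]
      congr 1
      rw [treeWeight, edgesOf, prod_image hf'.injOn_edges, hset]
      refine prod_congr rfl fun v hv => ?_
      rw [netOf, if_pos (hadj v (mem_filter.1 hv).2)]
    · rw [if_neg hadj]
      push Not at hadj
      obtain ⟨v, hv, hva⟩ := hadj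
      rw [prod_eq_zero (i := v) (by simpa using hv) (by simp [netOf, hva])]
      simp
  · intro f hf g hg h
    simp only [coe_filter, Set.mem_ofPred_eq, mem_filter, mem_univ, true_and] at hf hg
    exact hf.1.eq_of_edgesOf_eq hg.1 h

/-- The matrix-tree theorem. -/
lemma partZ_eq_det (G : SimpleGraph V) (c : Sym2 V → ℝ) (x : V) :
    partZ G c = (dirLap (netOf G c) {x}).det := by
  have := sum_spanningTrees G c x (fun _ => True)
  simp only [if_true] at this
  rw [partZ, this, det_dirLap_eq_sum]

/-! ### Probability that a given tree appears locally -/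

/-- The tuple `vv` embeds the tree encoded by `p` into `H`, and the `H`-neighbours of the entries
with index in `I` are entries of the tuple. -/
def LocalAt (H : SimpleGraph V) {k : ℕ} (p : Fin k → Fin k) (root : Fin k) (I : Finset (Fin k))
    (vv : Fin k → V) : Prop :=
  Function.Injective vv ∧ (∀ j, j ≠ root → H.Adj (vv (p j)) (vv j)) ∧
    ∀ j ∈ I, ∀ u, H.Adj (vv j) u → u ∈ univ.image vv

section Local

variable {k : ℕ} {p : Fin k → Fin k} {root : Fin k} {I : Finset (Fin k)} {vv : Fin k → V}

lemma IsForest.localAt_iff {f : V → V} (hp : ∀ j, j ≠ root → p j < j)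
    (hv : Function.Injective vv) (hf : IsForest {vv root} f) :
    LocalAt (SimpleGraph.fromEdgeSet (↑(edgesOf (vv root) f) : Set (Sym2 V))) p root I vv ↔
      (∀ j, j ≠ root → f (vv j) = vv (p j)) ∧ ∀ u, u ∉ univ.image vv → f u ∉ I.image vv := by
  constructor
  · rintro ⟨-, hadj, hI⟩
    constructor
    · intro j
      induction j using WellFoundedLT.induction with
      | _ j ih =>
        intro hj
        rcases hf.adj_iff.1 (hadj j hj) with ⟨h1, h2⟩ | ⟨h1, h2⟩
        · have hpj : p j ≠ root := fun h => h1 (by rw [h])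
          rw [ih _ (hp j hj) hpj] at h2
          have := (hp _ hpj).trans (hp j hj)
          rw [hv h2] at this
          exact absurd this (lt_irrefl _)
        · exact h2
    · intro u hu h
      obtain ⟨j, hj, hju⟩ := mem_image.1 h
      refine hu (hI j hj u (hf.adj_iff.2 (Or.inr ⟨?_, hju.symm⟩)))
      rintro rfl
      exact hu (mem_image_of_mem _ (mem_univ _))
  · rintro ⟨h1, h2⟩
    refine ⟨hv, fun j hj => hf.adj_iff.2 (Or.inr ⟨hv.ne hj, h1 j hj⟩), ?_⟩
    intro j hj u hu
    rcases hf.adj_iff.1 hu with ⟨h3, h4⟩ | ⟨h3, h4⟩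
    · have : j ≠ root := fun h => h3 (by rw [h])
      rw [← h4, h1 j this]
      exact mem_image_of_mem _ (mem_univ _)
    · by_contra hu'
      exact h2 u hu' (h4 ▸ mem_image_of_mem _ hj)

/-- The map sending the image of `j` to the image of its parent. -/
def parentMap (p : Fin k → Fin k) (vv : Fin k → V) (v : V) : V :=
  if h : ∃ j, vv j = v then vv (p h.choose) else v

lemma parentMap_apply (hv : Function.Injective vv) (j : Fin k) :
    parentMap p vv (vv j) = vv (p j) := by
  have h : ∃ i, vv i = vv j := ⟨j, rfl⟩
  rw [parentMap, dif_pos h, hv h.choose_spec]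

lemma isForest_glue_iff (hp : ∀ j, j ≠ root → p j < j) (hroot : p root = root) {f g : V → V}
    (hf : ∀ j, f (vv j) = vv (p j)) (hg : ∀ j, g (vv j) = vv j)
    (hfg : ∀ u, u ∉ univ.image vv → f u = g u) :
    IsForest {vv root} f ↔ IsForest (univ.image vv) g := by
  constructor
  · rintro ⟨-, h⟩
    refine ⟨by simpa using hg, fun v => ?_⟩
    obtain ⟨m, hm⟩ := h v
    induction m generalizing v with
    | zero =>
      exact ⟨0, by
        have : v = vv root := by simpa using hm
        simp [this]⟩
    | succ m ih =>
      by_cases hvS : v ∈ univ.image vv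
      · exact ⟨0, hvS⟩
      · rw [Function.iterate_succ_apply] at hm
        obtain ⟨j, hj⟩ := ih (f v) hm
        exact ⟨j + 1, by rwa [Function.iterate_succ_apply, ← hfg v hvS]⟩
  · rintro ⟨-, h⟩
    refine ⟨by simp [hf, hroot], fun v => ?_⟩
    have hbase : ∀ j, ∃ m, f^[m] (vv j) ∈ ({vv root} : Finset V) := by
      intro j
      induction j using WellFoundedLT.induction with
      | _ j ih =>
        by_cases hj : j = root
        · exact ⟨0, by simp [hj]⟩
        · obtain ⟨m, hm⟩ := ih _ (hp j hj)
          exact ⟨m + 1, by rwa [Function.iterate_succ_apply, hf]⟩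
    obtain ⟨m, hm⟩ := h v
    induction m generalizing v with
    | zero =>
      obtain ⟨j, -, rfl⟩ := mem_image.1 hm
      exact hbase j
    | succ m ih =>
      by_cases hvS : v ∈ univ.image vv
      · obtain ⟨j, -, rfl⟩ := mem_image.1 hvS
        exact hbase j
      · rw [Function.iterate_succ_apply, ← hfg v hvS] at hm
        obtain ⟨j, hj⟩ := ih (f v) hm
        exact ⟨j + 1, by rwa [Function.iterate_succ_apply]⟩

/-- The weight of spanning trees that look like a given tree near given vertices. -/
lemma sum_localAt (G : SimpleGraph V) (c : Sym2 V → ℝ) (hp : ∀ j, j ≠ root → p j < j)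
    (hroot : p root = root) (hv : Function.Injective vv) :
    ∑ T ∈ spanningTrees G, (if LocalAt (SimpleGraph.fromEdgeSet (↑T : Set (Sym2 V))) p root I vv
      then treeWeight c T else 0) =
    (∏ j ∈ univ.filter (· ≠ root), netOf G c (vv j) (vv (p j))) *
      (dirLap (killed (netOf G c) (I.image vv)) (univ.image vv)).det := by
  set S := univ.image vv with hS
  have hvS : ∀ j, vv j ∈ S := fun j => mem_image_of_mem _ (mem_univ _)
  rw [sum_spanningTrees G c (vv root) (fun H => LocalAt H p root I vv), det_dirLap_eq_sum,
    ← sum_filter, mul_sum]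
  have hR : ∑ g ∈ univ.filter (IsForest S),
      (∏ j ∈ univ.filter (· ≠ root), netOf G c (vv j) (vv (p j))) *
        ∏ v ∈ univ.filter (· ∉ S), killed (netOf G c) (I.image vv) v (g v) =
      ∑ g ∈ (univ.filter (IsForest S)).filter (fun g => ∀ u, u ∉ S → g u ∉ I.image vv),
      (∏ j ∈ univ.filter (· ≠ root), netOf G c (vv j) (vv (p j))) *
        ∏ v ∈ univ.filter (· ∉ S), netOf G c v (g v) := by
    rw [sum_filter (s := univ.filter (IsForest S))]
    refine sum_congr rfl fun g _ => ?_
    split_ifs with h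
    · congr 1
      refine prod_congr rfl fun u hu => ?_
      rw [killed, if_neg (h u (mem_filter.1 hu).2)]
    · push Not at h
      obtain ⟨u, hu, hgu⟩ := h
      rw [prod_eq_zero (i := u) (by simpa using hu) (by rw [killed, if_pos hgu]), mul_zero]
  rw [hR]
  have hfilt : ∀ f, f ∈ (univ.filter (IsForest {vv root})).filter (fun f =>
      LocalAt (SimpleGraph.fromEdgeSet (↑(edgesOf (vv root) f) : Set (Sym2 V))) p root I vv) ↔
      IsForest {vv root} f ∧ (∀ j, f (vv j) = vv (p j)) ∧ ∀ u, u ∉ S → f u ∉ I.image vv := by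
    intro f
    simp only [mem_filter, mem_univ, true_and]
    refine and_congr_right fun hf => ?_
    rw [hf.localAt_iff hp hv]
    refine and_congr_left fun _ => ⟨fun h j => ?_, fun h j _ => h j⟩
    by_cases hj : j = root
    · rw [hj, hroot]
      exact hf.1 _ (mem_singleton_self _)
    · exact h j hj
  refine sum_bij' (fun f _ v => if v ∈ S then v else f v)
    (fun g _ v => if v ∈ S then parentMap p vv v else g v) ?_ ?_ ?_ ?_ ?_
  · intro f hf
    obtain ⟨h1, h2, h3⟩ := (hfilt f).1 hf
    simp only [mem_filter, mem_univ, true_and]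
    refine ⟨(isForest_glue_iff hp hroot h2 ?_ ?_).1 h1, ?_⟩
    · intro j; rw [if_pos (hvS j)]
    · intro u hu; rw [if_neg hu]
    · intro u hu; rw [if_neg hu]; exact h3 u hu
  · intro g hg
    simp only [mem_filter, mem_univ, true_and] at hg
    refine (hfilt _).2 ⟨(isForest_glue_iff hp hroot (g := g) ?_ ?_ ?_).2 hg.1, ?_, ?_⟩
    · intro j; rw [if_pos (hvS j), parentMap_apply hv]
    · intro j; exact hg.1.1 _ (hvS j)
    · intro u hu; rw [if_neg hu]
    · intro j; rw [if_pos (hvS j), parentMap_apply hv]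
    · intro u hu; rw [if_neg hu]; exact hg.2 u hu
  · intro f hf
    obtain ⟨h1, h2, h3⟩ := (hfilt f).1 hf
    funext v
    by_cases hvS' : v ∈ S
    · obtain ⟨j, -, rfl⟩ := mem_image.1 hvS'
      simp [hvS j, parentMap_apply hv, h2]
    · simp [hvS']
  · intro g hg
    simp only [mem_filter, mem_univ, true_and] at hg
    funext v
    by_cases hvS' : v ∈ S
    · simp [hvS', hg.1.1 v hvS']
    · simp [hvS']
  · intro f hf
    obtain ⟨h1, h2, h3⟩ := (hfilt f).1 hf
    have hsplit : univ.filter (· ∉ ({vv root} : Finset V)) =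
        (univ.filter (· ≠ root)).image vv ∪ univ.filter (· ∉ S) := by
      ext v
      simp only [mem_filter, mem_univ, true_and, mem_singleton, mem_union, mem_image]
      constructor
      · intro h
        by_cases hvS' : v ∈ S
        · obtain ⟨j, -, rfl⟩ := mem_image.1 hvS'
          exact Or.inl ⟨j, fun e => h (by rw [e]), rfl⟩
        · exact Or.inr hvS'
      · rintro (⟨j, hj, rfl⟩ | h)
        · exact hv.ne hj
        · rintro rfl; exact h (hvS root)
    have hdisj : Disjoint ((univ.filter (· ≠ root)).image vv) (univ.filter (· ∉ S)) := by
      rw [disjoint_left]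
      intro v h1 h2
      obtain ⟨j, -, rfl⟩ := mem_image.1 h1
      exact (mem_filter.1 h2).2 (hvS j)
    rw [hsplit, prod_union hdisj, prod_image (hv.injOn)]
    congr 1
    · exact prod_congr rfl fun j _ => by rw [h2]
    · refine prod_congr rfl fun v hv => ?_
      simp only [if_neg (mem_filter.1 hv).2]

end Local

/-! ### Balls in spanning trees -/

section Ball

variable {k : ℕ} {p : Fin k → Fin k} {root : Fin k}

lemma depthAux_succ (hp : ∀ j, j ≠ root → p j < j) (n : ℕ) (j : Fin k) (hj : (j : ℕ) < n) :
    depthAux p root (n + 1) j = depthAux p root n j := by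
  induction n generalizing j with
  | zero => exact absurd hj (Nat.not_lt_zero _)
  | succ n ih =>
    by_cases h : j = root
    · simp [depthAux, h]
    · have h1 : (p j : ℕ) < j := hp j h
      have h2 : ∀ m, depthAux p root (m + 1) j = depthAux p root m (p j) + 1 := fun m => by
        rw [depthAux, if_neg h]
      rw [h2, h2, ih (p j) (by omega)]

lemma depth_root (root : Fin k) : depth p root root = 0 := by
  obtain _ | k := k
  · exact root.elim0
  · simp [depth, depthAux]

lemma depth_of_ne (hp : ∀ j, j ≠ root → p j < j) {j : Fin k} (hj : j ≠ root) :
    depth p root j = depth p root (p j) + 1 := by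
  obtain _ | k := k
  · exact j.elim0
  · have h1 : (p j : ℕ) < j := hp j hj
    have h2 := j.2
    rw [depth, depthAux, if_neg hj, depth, depthAux_succ hp k (p j) (by omega)]

lemma treeAdj_ne (hp : ∀ j, j ≠ root → p j < j) {i j : Fin k} (h : treeAdj p root i j) :
    i ≠ j := by
  rintro rfl
  rcases h with h | h <;> exact absurd (hp _ h.1) (by simp [h.2])

lemma treeGraph_adj (hp : ∀ j, j ≠ root → p j < j) {i j : Fin k} :
    (treeGraph p root).Adj i j ↔ treeAdj p root i j := by
  rw [treeGraph, SimpleGraph.fromRel_adj]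
  constructor
  · rintro ⟨-, h | h⟩
    · exact Or.inr h
    · exact Or.inl h
  · intro h
    exact ⟨treeAdj_ne hp h, h.symm⟩

lemma depth_le_of_treeAdj (hp : ∀ j, j ≠ root → p j < j) {i j : Fin k} (h : treeAdj p root i j) :
    depth p root j ≤ depth p root i + 1 := by
  rcases h with ⟨h1, h2⟩ | ⟨h1, h2⟩
  · have := depth_of_ne hp h1
    rw [h2] at this
    omega
  · rw [depth_of_ne hp h1, h2]

/-- The tuple `vv` is an isomorphism from the tree encoded by `p` onto a ball of `H`. -/
def BallEmb (H : SimpleGraph V) (p : Fin k → Fin k) (root : Fin k) (r : ℕ) (vv : Fin k → V) :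
    Prop :=
  Function.Injective vv ∧ Set.range vv = ballSet H (vv root) r ∧
    ∀ i j, H.Adj (vv i) (vv j) ↔ treeAdj p root i j

lemma ballIso_iff (H : SimpleGraph V) (hp : ∀ j, j ≠ root → p j < j) (r : ℕ) (x : V) :
    BallIso H x r (treeGraph p root) root ↔
      ∃ vv : Fin k → V, vv root = x ∧ BallEmb H p root r vv := by
  constructor
  · rintro ⟨φ, hφ⟩
    have hx : ((φ.symm root : ballSet H x r) : V) = x :=
      congrArg Subtype.val ((RelIso.symm_apply_eq φ).2 hφ.symm)
    refine ⟨fun i => (φ.symm i : ballSet H x r), hx, ?_, ?_, ?_⟩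
    · exact Subtype.val_injective.comp φ.symm.injective
    · simp only [hx]
      ext y
      constructor
      · rintro ⟨i, rfl⟩
        exact (φ.symm i).2
      · intro hy
        exact ⟨φ ⟨y, hy⟩, by simp⟩
    · intro i j
      rw [← treeGraph_adj hp, ← φ.symm.map_rel_iff]
      rfl
  · rintro ⟨vv, rfl, hinj, hrange, hadj⟩
    have hmem : ∀ i, vv i ∈ ballSet H (vv root) r := fun i => by
      rw [← hrange]; exact Set.mem_range_self i
    let e : Fin k ≃ ballSet H (vv root) r := Equiv.ofBijective (fun i => ⟨vv i, hmem i⟩)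
      ⟨fun i j h => hinj (congrArg Subtype.val h), fun y => by
        obtain ⟨i, hi⟩ : (y : V) ∈ Set.range vv := by rw [hrange]; exact y.2
        exact ⟨i, Subtype.ext hi⟩⟩
    let φ : treeGraph p root ≃g SimpleGraph.induce (ballSet H (vv root) r) H :=
      ⟨e, by
        intro i j
        rw [treeGraph_adj hp, ← hadj]
        rfl⟩
    refine ⟨φ.symm, ?_⟩
    have : φ root = ⟨vv root, mem_ballSet_self H (vv root) r⟩ := rfl
    rw [← this]
    simp

lemma card_ballEmb (H : SimpleGraph V) (r : ℕ) (x : V)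
    (h : ∃ vv : Fin k → V, vv root = x ∧ BallEmb H p root r vv) :
    (univ.filter fun vv : Fin k → V => vv root = x ∧ BallEmb H p root r vv).card =
      stabCard p root := by
  obtain ⟨v0, rfl, hinj, hrange, hadj⟩ := h
  rw [stabCard, ← Fintype.card_subtype, ← Nat.card_eq_fintype_card]
  symm
  refine Nat.card_congr (Equiv.ofBijective (fun φ => ⟨v0 ∘ φ.1, ?_, ?_, ?_, ?_⟩) ⟨?_, ?_⟩)
  · simp [φ.2.1]
  · exact hinj.comp φ.1.injective
  · rw [Set.range_comp, φ.1.surjective.range_eq, Set.image_univ, hrange]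
    simp [φ.2.1]
  · intro i j
    rw [φ.2.2, ← hadj]
    rfl
  · intro φ ψ h
    apply Subtype.ext
    ext i
    have := congrFun (congrArg Subtype.val h) i
    exact congrArg Fin.val (hinj this)
  · rintro ⟨vv, hroot, hinj', hrange', hadj'⟩
    rw [hroot] at hrange'
    have hex : ∀ i, ∃ j, v0 j = vv i := by
      intro i
      have : vv i ∈ Set.range v0 := by rw [hrange, ← hrange']; exact Set.mem_range_self i
      exact this
    choose φ hφ using hex
    have hφi : Function.Injective φ := fun i j h => hinj' (by rw [← hφ, ← hφ, h])
    let e : Equiv.Perm (Fin k) := Equiv.ofBijective φ (Finite.injective_iff_bijective.1 hφi)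
    refine ⟨⟨e, ?_, ?_⟩, ?_⟩
    · exact hinj ((hφ root).trans hroot)
    · intro i j
      rw [← hadj' i j, ← hadj (e i) (e j)]
      change _ ↔ H.Adj (v0 (φ i)) (v0 (φ j))
      rw [hφ, hφ]
    · apply Subtype.ext
      funext i
      exact hφ i

lemma stabCard_pos (p : Fin k → Fin k) (root : Fin k) : 0 < stabCard p root := by
  rw [stabCard, Nat.card_pos_iff]
  exact ⟨⟨⟨1, by simp⟩⟩, inferInstance⟩

lemma dist_le_depth {H : SimpleGraph V} {vv : Fin k → V} (hp : ∀ j, j ≠ root → p j < j)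
    (hadj : ∀ j, j ≠ root → H.Adj (vv (p j)) (vv j)) (j : Fin k) :
    H.Reachable (vv root) (vv j) ∧ H.dist (vv root) (vv j) ≤ depth p root j := by
  have : ∃ q : H.Walk (vv root) (vv j), q.length = depth p root j := by
    induction j using WellFoundedLT.induction with
    | _ j ih =>
      by_cases hj : j = root
      · subst hj
        exact ⟨SimpleGraph.Walk.nil, by simp [depth_root]⟩
      · obtain ⟨q, hq⟩ := ih _ (hp j hj)
        exact ⟨q.concat (hadj j hj), by
          rw [SimpleGraph.Walk.length_concat, hq, depth_of_ne hp hj]⟩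
  obtain ⟨q, hq⟩ := this
  exact ⟨q.reachable, hq ▸ SimpleGraph.dist_le q⟩

lemma ballEmb_iff_localAt {G : SimpleGraph V} {T : Finset (Sym2 V)} (hT : T ∈ spanningTrees G)
    (hp : ∀ j, j ≠ root → p j < j) (r : ℕ) (hr : ∀ j, depth p root j ≤ r) (vv : Fin k → V) :
    BallEmb (SimpleGraph.fromEdgeSet (↑T : Set (Sym2 V))) p root r vv ↔
      LocalAt (SimpleGraph.fromEdgeSet (↑T : Set (Sym2 V))) p root
        (univ.filter fun j => depth p root j < r) vv := by
  obtain ⟨hTG, htree⟩ := (mem_filter.1 hT).2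
  constructor
  · rintro ⟨hinj, hrange, hadj⟩
    have h1 : ∀ j, j ≠ root →
        (SimpleGraph.fromEdgeSet (↑T : Set (Sym2 V))).Adj (vv (p j)) (vv j) :=
      fun j hj => (hadj _ _).2 (Or.inr ⟨hj, rfl⟩)
    refine ⟨hinj, h1, fun j hj u hu => ?_⟩
    have hj' := (mem_filter.1 hj).2
    obtain ⟨hreach, hd⟩ := dist_le_depth hp h1 j
    have : u ∈ ballSet (SimpleGraph.fromEdgeSet (↑T : Set (Sym2 V))) (vv root) r := by
      refine ⟨hreach.trans hu.reachable, ?_⟩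
      obtain ⟨q, hq⟩ := hreach.exists_walk_length_eq_dist
      have := SimpleGraph.dist_le (q.concat hu)
      rw [SimpleGraph.Walk.length_concat, hq] at this
      omega
    rw [← hrange] at this
    simpa using this
  · intro h
    obtain ⟨f, hf, rfl⟩ := exists_isForest_of_isTree
      (fun e he => G.not_isDiag_of_mem_edgeSet (hTG he)) htree (vv root)
    obtain ⟨hinj, hadj, hI⟩ := h
    have hpar := ((hf.localAt_iff hp hinj).1 ⟨hinj, hadj, hI⟩).1
    set H := SimpleGraph.fromEdgeSet (↑(edgesOf (vv root) f) : Set (Sym2 V)) with hH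
    have hiff : ∀ i j, H.Adj (vv i) (vv j) ↔ treeAdj p root i j := by
      intro i j
      have key : ∀ i j, (vv i ≠ vv root ∧ f (vv i) = vv j) ↔ (i ≠ root ∧ p i = j) := by
        intro i j
        refine (and_congr_left' hinj.ne_iff).trans (and_congr_right fun hi => ?_)
        rw [hpar i hi, hinj.eq_iff]
      rw [hH, hf.adj_iff, key, key, treeAdj]
    refine ⟨hinj, ?_, hiff⟩
    ext y
    constructor
    · rintro ⟨j, rfl⟩
      obtain ⟨h1, h2⟩ := dist_le_depth hp hadj j
      exact ⟨h1, h2.trans (hr j)⟩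
    · rintro ⟨hreach, hd⟩
      have hwalk : ∀ (u y : V) (q : H.Walk u y) (j : Fin k), u = vv j →
          depth p root j + q.length ≤ r → y ∈ Set.range vv := by
        intro u y q
        induction q with
        | nil => rintro j rfl -; exact ⟨j, rfl⟩
        | cons hadj' q ih =>
          rintro j rfl hle
          rw [SimpleGraph.Walk.length_cons] at hle
          obtain ⟨i, -, hi⟩ := mem_image.1 (hI j (mem_filter.2 ⟨mem_univ _, by omega⟩) _ hadj')
          refine ih i hi.symm ?_
          have := depth_le_of_treeAdj hp ((hiff j i).1 (hi ▸ hadj'))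
          omega
      obtain ⟨q, hq⟩ := hreach.exists_walk_length_eq_dist
      exact hwalk _ _ q root rfl (by rw [depth_root, hq]; omega)

/-- The probability of seeing a given tree as a ball around a uniform vertex, as a sum over the
possible embeddings of this tree. -/
lemma wstBallProb_eq_sum (G : SimpleGraph V) (c : Sym2 V → ℝ) (hp : ∀ j, j ≠ root → p j < j)
    (r : ℕ) (hr : ∀ j, depth p root j ≤ r) :
    wstBallProb G c r (treeGraph p root) root =
      ((Fintype.card V : ℝ) * stabCard p root)⁻¹ * ∑ vv : Fin k → V,
        (∑ T ∈ spanningTrees G, if LocalAt (SimpleGraph.fromEdgeSet (↑T : Set (Sym2 V))) p root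
          (univ.filter fun j => depth p root j < r) vv then treeWeight c T else 0) / partZ G c := by
  have hs : (stabCard p root : ℝ) ≠ 0 := by exact_mod_cast (stabCard_pos p root).ne'
  rw [wstBallProb, mul_inv, mul_assoc]
  congr 1
  simp only [← sum_div]
  rw [← mul_div_assoc]
  congr 1
  rw [sum_comm, sum_comm (s := univ) (t := spanningTrees G), mul_sum]
  refine sum_congr rfl fun T hT => ?_
  rw [← sum_fiberwise (s := (univ : Finset (Fin k → V))) (g := fun vv => vv root), mul_sum]
  refine sum_congr rfl fun x _ => ?_
  have h1 : ∑ vv ∈ univ.filter (fun vv : Fin k → V => vv root = x),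
      (if LocalAt (SimpleGraph.fromEdgeSet (↑T : Set (Sym2 V))) p root
          (univ.filter fun j => depth p root j < r) vv then treeWeight c T else 0) =
      ((univ.filter fun vv : Fin k → V => vv root = x ∧
        BallEmb (SimpleGraph.fromEdgeSet (↑T : Set (Sym2 V))) p root r vv).card : ℝ) *
        treeWeight c T := by
    rw [← sum_filter, filter_filter, ← nsmul_eq_mul, ← sum_const]
    refine sum_congr ?_ fun _ _ => rfl
    ext vv
    simp only [mem_filter, mem_univ, true_and, ballEmb_iff_localAt hT hp r hr]
  rw [h1]
  by_cases hb : BallIso (SimpleGraph.fromEdgeSet (↑T : Set (Sym2 V))) x r (treeGraph p root) root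
  · rw [if_pos hb, card_ballEmb _ _ _ ((ballIso_iff _ hp r x).1 hb), ← mul_assoc,
      inv_mul_cancel₀ hs, one_mul]
  · rw [if_neg hb, filter_eq_empty_iff.2]
    · simp
    · intro vv _ h
      exact hb ((ballIso_iff _ hp r x).2 ⟨vv, h⟩)

end Ball

/-! ### The average local error -/

/-- A version of `Spread.extend` in which the parameters have been chosen. -/
lemma exists_extend (K : ℝ) (hK : 1 ≤ K) (M : ℝ) (hM : 0 < M) : ∀ η > 0, ∃ ω > 0, ∃ δ₀ > 0,
    ∀ (V : Type) [Fintype V] [DecidableEq V] [Nonempty V] (a : V → V → ℝ) (δ : ℝ), δ ≤ δ₀ →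
      IsBal a K δ → ∀ (Ω ι : Type) [Fintype Ω] (μ : Ω → ℝ) (X : ι → Ω → V),
      Spread a (core a K) μ X M ω → ∀ j,
      Spread a (core a K) (fun z : Ω × V => μ z.1 * restr a (core a K) (X j z.1) z.2)
        (fun (o : Option ι) z => o.elim z.2 fun i => X i z.1) (M * K) η := by
  intro η hη
  have hK0 : 0 < K := by linarith
  set t := η / (4 * K * M) with ht
  have htp : 0 < t := by positivity
  refine ⟨min (η / (8 * K)) (η * t / 24), lt_min (by positivity) (by positivity),
    min (η / (48 * M * K)) (t * η / (64 * M)), lt_min (by positivity) (by positivity), ?_⟩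
  intro V _ _ _ a δ hδ ha Ω ι _ μ X h j
  refine (h.extend ha hK hM.le j htp).mono ?_
  have hδ2 := hδ.trans (min_le_left _ _)
  have hδ3 := hδ.trans (min_le_right _ _)
  set ω := min (η / (8 * K)) (η * t / 24) with hω
  have e1 : K * ω ≤ η / 8 := by
    have := min_le_left (η / (8 * K)) (η * t / 24)
    rw [← hω, le_div_iff₀ (by positivity)] at this
    linarith
  have e2 : 3 * ω / t ≤ η / 8 := by
    have := min_le_right (η / (8 * K)) (η * t / 24)
    rw [← hω] at this
    rw [div_le_iff₀ htp]
    linarith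
  have e3 : M * (12 * K * δ) ≤ η / 4 := by
    rw [le_div_iff₀ (by positivity)] at hδ2
    linarith
  have e4 : 16 * δ * M / t ≤ η / 4 := by
    rw [le_div_iff₀ (by positivity)] at hδ3
    rw [div_le_iff₀ htp]
    linarith
  have e5 : t * K * M = η / 4 := by
    rw [ht]; field_simp
  rw [add_div]
  linarith

/-- The weight of the edges at `v` leaving the core, with a penalty. -/
def farSum (a : V → V → ℝ) (K : ℝ) (v : V) : ℝ :=
  ∑ u, if u ∈ core a K then 0 else a v u * (effRes a v u + 1 / cond a u + 1)

lemma IsNet.farSum_nonneg {a : V → V → ℝ} (ha : IsNet a) (K : ℝ) (v : V) : 0 ≤ farSum a K v := by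
  refine sum_nonneg fun u _ => ?_
  split_ifs
  · exact le_rfl
  · have h1 := ha.effRes_nonneg v u
    have h2 := one_div_nonneg.2 (ha.cond_nonneg u)
    exact mul_nonneg (ha.nonneg _ _) (by linarith)

lemma IsBal.card_compl_le {a : V → V → ℝ} {K δ : ℝ} (ha : IsBal a K δ) :
    ((univ.filter fun v => v ∉ core a K).card : ℝ) ≤ δ * Fintype.card V := by
  have h1 := ha.card_core
  have h2 : ((core a K).card : ℝ) + (univ.filter fun v => v ∉ core a K).card = Fintype.card V := by
    have := card_filter_add_card_filter_not (s := (univ : Finset V)) (fun v => v ∈ core a K)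
    rw [filter_mem_eq_inter, univ_inter, card_univ] at this
    exact_mod_cast this
  linarith

lemma IsBal.sum_farSum_le [Nonempty V] {a : V → V → ℝ} {K δ : ℝ} (ha : IsBal a K δ) (hK : 1 ≤ K) :
    ∑ v ∈ core a K, farSum a K v ≤ 14 * K * δ * Fintype.card V := by
  set n : ℝ := (Fintype.card V : ℝ) with hn
  have hnet := ha.toIsNet
  have hδ := ha.delta_nonneg
  have hn0 : 0 ≤ n := Nat.cast_nonneg _
  have e1 : ∑ v ∈ core a K, farSum a K v =
      ∑ v ∈ core a K, ∑ u ∈ univ.filter (fun u => u ∉ core a K), a v u * effRes a v u +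
      ∑ v ∈ core a K, ∑ u ∈ univ.filter (fun u => u ∉ core a K), a v u * (1 / cond a u) +
      ∑ v ∈ core a K, ∑ u ∈ univ.filter (fun u => u ∉ core a K), a v u := by
    rw [← sum_add_distrib, ← sum_add_distrib]
    refine sum_congr rfl fun v _ => ?_
    rw [farSum, ← sum_add_distrib, ← sum_add_distrib, sum_filter]
    refine sum_congr rfl fun u _ => ?_
    by_cases hu : u ∈ core a K
    · simp [hu]
    · simp only [hu, if_false, not_false_eq_true, if_true]; ring
  have b1 : ∑ v ∈ core a K, ∑ u ∈ univ.filter (fun u => u ∉ core a K), a v u * effRes a v u ≤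
      12 * K * δ * n := by
    refine le_trans ?_ (ha.sum_defect_le hK)
    have hnn : ∀ u v, 0 ≤ (if u ∈ core a K ∧ v ∈ core a K then a u v * dev a u v
        else a u v * effRes a u v) := by
      intro u v
      split_ifs
      · exact mul_nonneg (hnet.nonneg _ _) (dev_nonneg _ _ _)
      · exact mul_nonneg (hnet.nonneg _ _) (hnet.effRes_nonneg _ _)
    refine (sum_le_sum fun v _ => ?_).trans
      (sum_le_sum_of_subset_of_nonneg (subset_univ (core a K))
        fun u _ _ => sum_nonneg fun v _ => hnn u v)
    refine (sum_le_sum fun u hu => ?_).trans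
      (sum_le_sum_of_subset_of_nonneg (subset_univ (univ.filter (fun u => u ∉ core a K)))
        fun u _ _ => hnn v u)
    rw [if_neg (fun h => (mem_filter.1 hu).2 h.2)]
  have b2 : ∑ v ∈ core a K, ∑ u ∈ univ.filter (fun u => u ∉ core a K), a v u * (1 / cond a u) ≤
      δ * n := by
    rw [sum_comm]
    refine le_trans (sum_le_sum fun u _ => ?_) (b := ∑ u ∈ univ.filter (fun u => u ∉ core a K),
      (1 : ℝ)) ?_
    · rw [← sum_mul, mul_one_div]
      refine div_le_one_of_le₀ ?_ (hnet.cond_nonneg u)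
      rw [cond]
      refine (sum_le_sum_of_subset_of_nonneg (subset_univ _) fun v _ _ => hnet.nonneg v u).trans ?_
      exact (sum_congr rfl fun v _ => hnet.symm v u).le
    · rw [sum_const, nsmul_eq_mul, mul_one]
      exact ha.card_compl_le
  have b3 := ha.sum_cross_le
  rw [← hn] at b3
  have : δ * n ≤ K * (δ * n) := le_mul_of_one_le_left (by positivity) hK
  rw [e1]
  linarith

/-- The quantity controlling the local approximation at a tuple. -/
def locErr (a : V → V → ℝ) (K : ℝ) {ι : Type} [Fintype ι] (vv : ι → V) : ℝ :=
  ∑ i, ∑ j, dev a (vv i) (vv j) +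
    ∑ i, ∑ j, ∑ u, restr a (core a K) (vv i) u * dev a (vv j) u +
    ∑ i, farSum a K (vv i) +
    ∑ i, ∑ j, ∑ u, ∑ w, restr a (core a K) (vv i) u * restr a (core a K) (vv j) w * dev a u w

lemma Spread.sum_mul_near_le {a : V → V → ℝ} {W : Finset V} {Ω ι : Type} [Fintype Ω]
    {μ : Ω → ℝ} {X : ι → Ω → V} {M η : ℝ} {i j : ι}
    (h : Spread a W (fun z : Ω × V => μ z.1 * restr a W (X i z.1) z.2)
      (fun (o : Option ι) z => o.elim z.2 fun i => X i z.1) M η) :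
    ∑ z, μ z * ∑ u, restr a W (X i z) u * dev a (X j z) u ≤ η * Fintype.card V := by
  have := h.dev_le (some j) none
  rw [Fintype.sum_prod_type] at this
  refine le_trans (le_of_eq ?_) this
  refine sum_congr rfl fun z _ => ?_
  rw [mul_sum]
  exact sum_congr rfl fun u _ => (mul_assoc _ _ _).symm

lemma Spread.sum_mul_pair_le {a : V → V → ℝ} {W : Finset V} {Ω ι : Type} [Fintype Ω]
    {μ : Ω → ℝ} {X : ι → Ω → V} {M η : ℝ} {i j : ι}
    (h : Spread a W (fun z : (Ω × V) × V =>
        (μ z.1.1 * restr a W (X i z.1.1) z.1.2) * restr a W (X j z.1.1) z.2)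
      (fun (o : Option (Option ι)) z => o.elim z.2 fun o => o.elim z.1.2 fun i => X i z.1.1) M η) :
    ∑ z, μ z * ∑ u, ∑ w, restr a W (X i z) u * restr a W (X j z) w * dev a u w ≤
      η * Fintype.card V := by
  have := h.dev_le (some none) none
  rw [Fintype.sum_prod_type, Fintype.sum_prod_type] at this
  refine le_trans (le_of_eq ?_) this
  refine sum_congr rfl fun z _ => ?_
  rw [mul_sum]
  refine sum_congr rfl fun u _ => ?_
  rw [mul_sum]
  refine sum_congr rfl fun w _ => ?_
  simp only [Option.elim]
  ring

/-- In an almost balanced network, a random embedded tree has a small local error. -/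
lemma exists_locErr_le (K : ℝ) (hK : 1 ≤ K) (m : ℕ) : ∀ η > 0, ∃ δ₀ > 0,
    ∀ (V : Type) [Fintype V] [DecidableEq V] [Nonempty V] (a : V → V → ℝ) (δ : ℝ), δ ≤ δ₀ →
      IsBal a K δ → ∀ (P : ℕ → ℕ) (hP : ∀ j, P j ≤ j),
      ∑ vv : Fin (m + 1) → V, coreWeight a (core a K) P hP m vv * locErr a K vv ≤
        η * Fintype.card V := by
  intro η hη
  have hK0 : 0 < K := by linarith
  set N : ℝ := (m + 1 : ℝ) with hN
  have hNp : 0 < N := by positivity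
  set e := η / (4 * N * N) with he
  have hep : 0 < e := by positivity
  obtain ⟨ω₂, hω₂, δ₂, hδ₂, h₂⟩ := exists_extend K hK (K ^ m * K) (by positivity) e hep
  obtain ⟨ω₁, hω₁, δ₁, hδ₁, h₁⟩ := exists_extend K hK (K ^ m) (by positivity) (min e ω₂)
    (lt_min hep hω₂)
  obtain ⟨δ₃, hδ₃, h₃⟩ := exists_spread K hK m (min e ω₁) (lt_min hep hω₁)
  refine ⟨min (min δ₁ δ₂) (min δ₃ (η / (4 * N) / (K ^ m * (14 * K)))),
    lt_min (lt_min hδ₁ hδ₂) (lt_min hδ₃ (by positivity)), ?_⟩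
  intro V _ _ _ a δ hδ ha P hP
  have d1 : δ ≤ δ₁ := (hδ.trans (min_le_left _ _)).trans (min_le_left _ _)
  have d2 : δ ≤ δ₂ := (hδ.trans (min_le_left _ _)).trans (min_le_right _ _)
  have d3 : δ ≤ δ₃ := (hδ.trans (min_le_right _ _)).trans (min_le_left _ _)
  have d4 : δ ≤ η / (4 * N) / (K ^ m * (14 * K)) :=
    (hδ.trans (min_le_right _ _)).trans (min_le_right _ _)
  set n : ℝ := (Fintype.card V : ℝ) with hn
  have hn0 : 0 ≤ n := Nat.cast_nonneg _
  have s0 := h₃ V a δ d3 ha P hP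
  have s1 := h₁ V a δ d1 ha _ _ _ _ (s0.mono (min_le_right _ _))
  have s2 := fun i j => h₂ V a δ d2 ha _ _ _ _ ((s1 i).mono (min_le_right _ _)) (some j)
  have hsum : ∀ g : Fin (m + 1) → Fin (m + 1) → (Fin (m + 1) → V) → ℝ,
      (∀ i j, ∑ vv, coreWeight a (core a K) P hP m vv * g i j vv ≤ e * n) →
      ∑ vv, coreWeight a (core a K) P hP m vv * ∑ i, ∑ j, g i j vv ≤ η / 4 * n := by
    intro g hg
    have : ∑ vv, coreWeight a (core a K) P hP m vv * ∑ i, ∑ j, g i j vv =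
        ∑ i, ∑ j, ∑ vv, coreWeight a (core a K) P hP m vv * g i j vv := by
      simp only [mul_sum]
      rw [sum_comm]
      refine sum_congr rfl fun i _ => ?_
      rw [sum_comm]
    rw [this]
    refine (sum_le_sum fun i _ => sum_le_sum fun j _ => hg i j).trans (le_of_eq ?_)
    simp only [sum_const, card_univ, Fintype.card_fin, nsmul_eq_mul]
    rw [he]
    push_cast
    rw [← hN]
    field_simp
  have b1 := hsum (fun i j vv => dev a (vv i) (vv j)) fun i j =>
    (s0.mono (min_le_left _ _)).dev_le i j
  have b2 := hsum (fun i j vv => ∑ u, restr a (core a K) (vv i) u * dev a (vv j) u) fun i j =>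
    Spread.sum_mul_near_le (W := core a K) (μ := coreWeight a (core a K) P hP m)
      (X := fun i vv => vv i) (i := i) (j := j) ((s1 i).mono (min_le_left _ _))
  have b4 := hsum (fun i j vv => ∑ u, ∑ w, restr a (core a K) (vv i) u *
    restr a (core a K) (vv j) w * dev a u w) fun i j =>
    Spread.sum_mul_pair_le (W := core a K) (μ := coreWeight a (core a K) P hP m)
      (X := fun i vv => vv i) (i := i) (j := j) (s2 i j)
  have b3 : ∑ vv, coreWeight a (core a K) P hP m vv * ∑ i, farSum a K (vv i) ≤ η / 4 * n := by
    have e1 : ∑ vv, coreWeight a (core a K) P hP m vv * ∑ i, farSum a K (vv i) =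
        ∑ i, ∑ vv, coreWeight a (core a K) P hP m vv * farSum a K (vv i) := by
      simp only [mul_sum]
      rw [sum_comm]
    have e2 : ∀ i, ∑ vv, coreWeight a (core a K) P hP m vv * farSum a K (vv i) ≤
        η / (4 * N) * n := by
      intro i
      refine (s0.marg i (farSum a K) (ha.farSum_nonneg K)).trans ?_
      refine (mul_le_mul_of_nonneg_left (ha.sum_farSum_le hK) (by positivity)).trans ?_
      rw [le_div_iff₀ (by positivity)] at d4
      rw [← hn]
      calc K ^ m * (14 * K * δ * n) = δ * (K ^ m * (14 * K)) * n := by ring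
        _ ≤ _ := mul_le_mul_of_nonneg_right d4 hn0
    rw [e1]
    refine (sum_le_sum fun i _ => e2 i).trans (le_of_eq ?_)
    simp only [sum_const, card_univ, Fintype.card_fin, nsmul_eq_mul]
    push_cast
    rw [← hN]
    field_simp
  simp only [locErr, mul_add, sum_add_distrib]
  linarith

/-! ### Approximation of the probability of embedded trees -/

section Embedded

variable {m : ℕ}

/-- The conditional factor in the probability that the embedded tree `vv` is a local piece of a
spanning tree. -/
def embDet (a : V → V → ℝ) (I : Finset (Fin (m + 1))) (Z : ℝ) (vv : Fin (m + 1) → V) : ℝ :=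
  (dirLap (killed a (I.image vv)) (univ.image vv)).det / Z

/-- The limiting form of `embDet`. -/
def embLim (a : V → V → ℝ) (I : Finset (Fin (m + 1))) (vv : Fin (m + 1) → V) : ℝ :=
  Real.exp (-∑ j ∈ I, ∑ u, a (vv j) u / cond a u) * (∑ j ∈ univ.filter (· ∉ I), cond a (vv j)) /
    ∏ j, cond a (vv j)

/-- The parent of the vertex `j + 1`. -/
def par (P : ℕ → ℕ) (hP : ∀ j, P j ≤ j) (j : Fin m) : Fin (m + 1) :=
  ⟨P j, ((hP j).trans_lt j.2).trans (Nat.lt_succ_self m)⟩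

variable {a : V → V → ℝ} {K : ℝ}

lemma IsNet.locErr_nonneg (ha : IsNet a) (K : ℝ) (vv : Fin (m + 1) → V) : 0 ≤ locErr a K vv := by
  have h1 : 0 ≤ ∑ i, ∑ j, dev a (vv i) (vv j) :=
    sum_nonneg fun i _ => sum_nonneg fun j _ => dev_nonneg _ _ _
  have h2 : 0 ≤ ∑ i, ∑ j, ∑ u, restr a (core a K) (vv i) u * dev a (vv j) u :=
    sum_nonneg fun i _ => sum_nonneg fun j _ => sum_nonneg fun u _ =>
      mul_nonneg (ha.restr_nonneg _ _ _) (dev_nonneg _ _ _)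
  have h3 : 0 ≤ ∑ i, farSum a K (vv i) := sum_nonneg fun i _ => ha.farSum_nonneg _ _
  have h4 : 0 ≤ ∑ i, ∑ j, ∑ u, ∑ w,
      restr a (core a K) (vv i) u * restr a (core a K) (vv j) w * dev a u w :=
    sum_nonneg fun i _ => sum_nonneg fun j _ => sum_nonneg fun u _ => sum_nonneg fun w _ =>
      mul_nonneg (mul_nonneg (ha.restr_nonneg _ _ _) (ha.restr_nonneg _ _ _)) (dev_nonneg _ _ _)
  rw [locErr]
  linarith

lemma IsNet.dev_le_locErr (ha : IsNet a) (K : ℝ) (vv : Fin (m + 1) → V) (i j : Fin (m + 1)) :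
    dev a (vv i) (vv j) ≤ locErr a K vv := by
  have h1 : dev a (vv i) (vv j) ≤ ∑ i, ∑ j, dev a (vv i) (vv j) :=
    (single_le_sum (f := fun j => dev a (vv i) (vv j)) (fun j _ => dev_nonneg _ _ _)
      (mem_univ j)).trans (single_le_sum (f := fun i => ∑ j, dev a (vv i) (vv j))
        (fun i _ => sum_nonneg fun j _ => dev_nonneg _ _ _) (mem_univ i))
  have h2 : 0 ≤ ∑ i, ∑ j, ∑ u, restr a (core a K) (vv i) u * dev a (vv j) u :=
    sum_nonneg fun i _ => sum_nonneg fun j _ => sum_nonneg fun u _ =>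
      mul_nonneg (ha.restr_nonneg _ _ _) (dev_nonneg _ _ _)
  have h3 : 0 ≤ ∑ i, farSum a K (vv i) := sum_nonneg fun i _ => ha.farSum_nonneg _ _
  have h4 : 0 ≤ ∑ i, ∑ j, ∑ u, ∑ w,
      restr a (core a K) (vv i) u * restr a (core a K) (vv j) w * dev a u w :=
    sum_nonneg fun i _ => sum_nonneg fun j _ => sum_nonneg fun u _ => sum_nonneg fun w _ =>
      mul_nonneg (mul_nonneg (ha.restr_nonneg _ _ _) (ha.restr_nonneg _ _ _)) (dev_nonneg _ _ _)
  rw [locErr]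
  linarith

lemma IsNet.isLocal_of_locErr_le (ha : IsNet a) {vv : Fin (m + 1) → V}
    (hv : Function.Injective vv) (hcore : ∀ i, vv i ∈ core a K) {η : ℝ} (hη : ∀ u v, a u v ≤ η)
    (h : locErr a K vv ≤ η) : IsLocal a K η (univ.image vv) := by
  have h1 : 0 ≤ ∑ i, ∑ j, dev a (vv i) (vv j) :=
    sum_nonneg fun i _ => sum_nonneg fun j _ => dev_nonneg _ _ _
  have h2 : 0 ≤ ∑ i, ∑ j, ∑ u, restr a (core a K) (vv i) u * dev a (vv j) u :=
    sum_nonneg fun i _ => sum_nonneg fun j _ => sum_nonneg fun u _ =>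
      mul_nonneg (ha.restr_nonneg _ _ _) (dev_nonneg _ _ _)
  have h3 : 0 ≤ ∑ i, farSum a K (vv i) := sum_nonneg fun i _ => ha.farSum_nonneg _ _
  have h4 : 0 ≤ ∑ i, ∑ j, ∑ u, ∑ w,
      restr a (core a K) (vv i) u * restr a (core a K) (vv j) w * dev a u w :=
    sum_nonneg fun i _ => sum_nonneg fun j _ => sum_nonneg fun u _ => sum_nonneg fun w _ =>
      mul_nonneg (mul_nonneg (ha.restr_nonneg _ _ _) (ha.restr_nonneg _ _ _)) (dev_nonneg _ _ _)
  have himg : ∀ g : V → ℝ, ∑ v ∈ univ.image vv, g v = ∑ i, g (vv i) :=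
    fun g => sum_image hv.injOn
  have h' := h
  rw [locErr] at h'
  constructor
  · simpa using hcore
  · simp only [mem_image, mem_univ, true_and]
    rintro _ ⟨i, rfl⟩ _ ⟨j, rfl⟩
    exact (ha.dev_le_locErr K vv i j).trans h
  · exact hη
  · simp only [himg]; linarith
  · simp only [himg]; exact (by linarith : ∑ i, farSum a K (vv i) ≤ η)
  · simp only [himg]; linarith

/-- The quantitative approximation of `embDet`. -/
lemma exists_embDet_approx (K : ℝ) (hK : 1 ≤ K) (m : ℕ) : ∀ ε > 0, ∃ η > 0,
    ∀ (V : Type) [Fintype V] [DecidableEq V] (a : V → V → ℝ), IsNet a →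
      ∀ Z, 0 < Z → (∀ x, Z = (dirLap a {x}).det) → ∀ (I : Finset (Fin (m + 1)))
      (vv : Fin (m + 1) → V), Function.Injective vv → (∀ i, vv i ∈ core a K) →
      (∀ u v, a u v ≤ η) → locErr a K vv ≤ η → |embDet a I Z vv - embLim a I vv| ≤ ε := by
  intro ε hε
  obtain ⟨η, hη, h⟩ := exists_killed_approx K hK m ε hε
  refine ⟨η, hη, ?_⟩
  intro V _ _ a ha Z hZ hZx I vv hv hcore hsmall herr
  have h1 := h V a ha Z hZ hZx (univ.image vv) (I.image vv)
    (by rw [card_image_of_injective _ hv, card_univ, Fintype.card_fin])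
    (image_subset_image (subset_univ _)) (ha.isLocal_of_locErr_le hv hcore hsmall herr)
  have e1 : univ.image vv \ I.image vv = (univ.filter (· ∉ I)).image vv := by
    rw [← image_sdiff _ _ hv]
    congr 1
    ext; simp
  rw [e1, condSum, sum_image hv.injOn, sum_image hv.injOn, prod_image hv.injOn] at h1
  exact h1

lemma embLim_nonneg (ha : IsNet a) (I : Finset (Fin (m + 1))) (vv : Fin (m + 1) → V) :
    0 ≤ embLim a I vv :=
  div_nonneg (mul_nonneg (Real.exp_pos _).le (sum_nonneg fun _ _ => ha.cond_nonneg _))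
    (prod_nonneg fun _ _ => ha.cond_nonneg _)

lemma embLim_le (ha : IsNet a) (I : Finset (Fin (m + 1))) {vv : Fin (m + 1) → V}
    (hcore : ∀ i, vv i ∈ core a K) : embLim a I vv ≤ m + 1 := by
  have hpos : ∀ i, 1 ≤ cond a (vv i) := fun i => one_le_cond_of_mem (hcore i)
  have hprod : 0 < ∏ i, cond a (vv i) := prod_pos fun i _ => zero_lt_one.trans_le (hpos i)
  rw [embLim, div_le_iff₀ hprod]
  have h1 : Real.exp (-∑ j ∈ I, ∑ u, a (vv j) u / cond a u) ≤ 1 := by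
    rw [Real.exp_le_one_iff, neg_nonpos]
    exact sum_nonneg fun _ _ => sum_nonneg fun _ _ => div_nonneg (ha.nonneg _ _) (ha.cond_nonneg _)
  have h2 : ∀ j, cond a (vv j) ≤ ∏ i, cond a (vv i) := by
    intro j
    rw [← mul_prod_erase univ _ (mem_univ j)]
    exact le_mul_of_one_le_right (ha.cond_nonneg _) (one_le_prod_of_one_le _ _ fun i _ => hpos i)
  have h3 : ∑ j ∈ univ.filter (· ∉ I), cond a (vv j) ≤ (m + 1) * ∏ i, cond a (vv i) := by
    refine (sum_le_sum_of_subset_of_nonneg (subset_univ _)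
      fun j _ _ => ha.cond_nonneg (vv j)).trans ?_
    refine (sum_le_sum fun j _ => h2 j).trans (le_of_eq ?_)
    simp
  refine le_trans ?_ h3
  exact mul_le_of_le_one_left (sum_nonneg fun _ _ => ha.cond_nonneg _) h1

lemma IsNet.effRes_root_le (ha : IsNet a) {P : ℕ → ℕ} (hP : ∀ j, P j ≤ j) {vv : Fin (m + 1) → V}
    (hv : Function.Injective vv) (hcore : ∀ i, vv i ∈ core a K)
    (hdev : ∀ j : Fin m, dev a (vv (par P hP j)) (vv j.succ) ≤ 1) (j : Fin (m + 1)) :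
    effRes a (vv 0) (vv j) ≤ 6 * 2 ^ (j : ℕ) - 6 := by
  induction j using WellFoundedLT.induction with
  | _ j ih =>
    cases j using Fin.cases with
    | zero => simp [effRes]
    | succ j =>
      have hlt : par P hP j < j.succ := by
        rw [Fin.lt_def]
        exact Nat.lt_succ_of_le (hP j)
      have h1 := ih _ hlt
      have h2 : effRes a (vv (par P hP j)) (vv j.succ) ≤ 3 :=
        (effRes_le_dev_add (hv.ne hlt.ne) (hcore _) (hcore _)).trans (by linarith [hdev j])
      have h3 := ha.effRes_le_two_mul (vv 0) (vv (par P hP j)) (vv j.succ)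
      have h4 : (2 : ℝ) ^ ((par P hP j : Fin (m + 1)) : ℕ) ≤ 2 ^ (j : ℕ) :=
        pow_le_pow_right₀ one_le_two (hP j)
      rw [Fin.val_succ, pow_succ]
      linarith

lemma IsNet.embDet_mem (ha : IsNet a) {Z : ℝ} (hZ : 0 < Z) (hZx : ∀ x, Z = (dirLap a {x}).det)
    (I : Finset (Fin (m + 1))) {P : ℕ → ℕ} (hP : ∀ j, P j ≤ j) {vv : Fin (m + 1) → V}
    (hv : Function.Injective vv) (hcore : ∀ i, vv i ∈ core a K)
    (hdev : ∀ j : Fin m, dev a (vv (par P hP j)) (vv j.succ) ≤ 1) :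
    embDet a I Z vv ∈ Set.Icc 0 ((6 * 2 ^ m : ℝ) ^ m) := by
  have hne : (univ.image vv).Nonempty := ⟨vv 0, mem_image_of_mem _ (mem_univ _)⟩
  have hsub : I.image vv ⊆ univ.image vv := image_subset_image (subset_univ _)
  have hdet : embDet a I Z vv =
      detRatio a Z (univ.image vv) * (1 - pullMat a (univ.image vv) (I.image vv)).det := by
    rw [embDet, ha.det_dirLap_killed hne hsub, detRatio]
    ring
  obtain ⟨h0, h1⟩ := ha.det_one_sub_pullMat_mem hne hsub
  have hr := ha.detRatio_nonneg hZ hne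
  have h2 : (1 : ℝ) ≤ 2 ^ m := one_le_pow₀ one_le_two
  have hB : (1 : ℝ) ≤ 6 * 2 ^ m := by linarith
  have hins : univ.image vv = insert (vv 0) (univ.image fun j : Fin m => vv j.succ) := by
    ext x
    simp only [mem_image, mem_univ, true_and, mem_insert, Fin.exists_fin_succ]
    exact or_congr_left ⟨Eq.symm, Eq.symm⟩
  have hnot : vv 0 ∉ univ.image fun j : Fin m => vv j.succ := by
    simp only [mem_image, mem_univ, true_and, not_exists]
    exact fun j h => Fin.succ_ne_zero j (hv h)
  have hle : detRatio a Z (univ.image vv) ≤ (6 * 2 ^ m : ℝ) ^ m := by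
    rw [hins]
    refine (ha.detRatio_le hZ (hZx (vv 0)) hB _ hnot ?_).trans (le_of_eq ?_)
    · intro u hu
      obtain ⟨j, -, rfl⟩ := mem_image.1 hu
      have h3 := ha.effRes_root_le hP hv hcore hdev j.succ
      have h4 : (2 : ℝ) ^ ((j.succ : Fin (m + 1)) : ℕ) ≤ 2 ^ m :=
        pow_le_pow_right₀ one_le_two (Nat.lt_succ_iff.1 j.succ.2)
      linarith
    · rw [card_image_of_injective (f := fun j : Fin m => vv j.succ) _
        (hv.comp (Fin.succ_injective m)), card_univ, Fintype.card_fin]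
  rw [hdet]
  exact ⟨mul_nonneg hr h0, (mul_le_of_le_one_right hr h1).trans hle⟩

/-- Replacing `embDet` by its limit, and discarding tuples with a bad edge, costs little. -/
lemma exists_sum_embDet_approx (K : ℝ) (hK : 1 ≤ K) (m : ℕ) : ∀ ε > 0, ∃ δ₀ > 0,
    ∀ (V : Type) [Fintype V] [DecidableEq V] [Nonempty V] (a : V → V → ℝ) (δ : ℝ), δ ≤ δ₀ →
      IsBal a K δ → ∀ Z, 0 < Z → (∀ x, Z = (dirLap a {x}).det) →
      ∀ (P : ℕ → ℕ) (hP : ∀ j, P j ≤ j) (I : Finset (Fin (m + 1))),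
      ∑ vv : Fin (m + 1) → V, (if Function.Injective vv ∧ ∀ i, vv i ∈ core a K then
        treeProd P hP (fun _ => a) m vv * |(if ∀ j : Fin m, dev a (vv (par P hP j)) (vv j.succ) ≤ 1
          then embDet a I Z vv else 0) - embLim a I vv| else 0) ≤ ε * Fintype.card V := by
  intro ε hε
  have hK0 : 0 < K := by linarith
  obtain ⟨η, hη, h⟩ := exists_embDet_approx K hK m (ε / (2 * K ^ m)) (by positivity)
  set C : ℝ := ((6 * 2 ^ m : ℝ) ^ m + (m + 1)) / η + (m + 1) with hC
  have hCp : 0 < C := by positivity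
  obtain ⟨δ₁, hδ₁, h₁⟩ := exists_locErr_le K hK m (ε / (2 * C)) (by positivity)
  obtain ⟨δ₂, hδ₂, h₂⟩ := exists_spread K hK m 1 one_pos
  refine ⟨min η (min δ₁ δ₂), lt_min hη (lt_min hδ₁ hδ₂), ?_⟩
  intro V _ _ _ a δ hδ ha Z hZ hZx P hP I
  have d1 : δ ≤ δ₁ := (hδ.trans (min_le_right _ _)).trans (min_le_left _ _)
  have d2 : δ ≤ δ₂ := (hδ.trans (min_le_right _ _)).trans (min_le_right _ _)
  have d3 : ∀ u v, a u v ≤ η := fun u v => (ha.le u v).trans (hδ.trans (min_le_left _ _))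
  have hnet := ha.toIsNet
  have hsp := h₂ V a δ d2 ha P hP
  have hbound : ∀ vv : Fin (m + 1) → V,
      (if Function.Injective vv ∧ ∀ i, vv i ∈ core a K then
        treeProd P hP (fun _ => a) m vv * |(if ∀ j : Fin m, dev a (vv (par P hP j)) (vv j.succ) ≤ 1
          then embDet a I Z vv else 0) - embLim a I vv| else 0) ≤
      coreWeight a (core a K) P hP m vv * (ε / (2 * K ^ m)) +
        C * (coreWeight a (core a K) P hP m vv * locErr a K vv) := by
    intro vv
    have hL := hnet.locErr_nonneg K vv
    have hcw := hsp.nonneg vv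
    by_cases hvv : Function.Injective vv ∧ ∀ i, vv i ∈ core a K
    · rw [if_pos hvv]
      obtain ⟨hinj, hcore⟩ := hvv
      have hcwe : treeProd P hP (fun _ => a) m vv = coreWeight a (core a K) P hP m vv := by
        rw [coreWeight, if_pos (hcore 0), one_mul, treeProd, treeProd]
        refine prod_congr rfl fun j _ => ?_
        rw [restr, if_pos ⟨hcore _, hcore _⟩]
      rw [hcwe]
      have key : |(if ∀ j : Fin m, dev a (vv (par P hP j)) (vv j.succ) ≤ 1
          then embDet a I Z vv else 0) - embLim a I vv| ≤ ε / (2 * K ^ m) + C * locErr a K vv := by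
        have q0 := embLim_nonneg hnet I vv
        have q1 := embLim_le hnet I hcore
        have hε' : 0 ≤ ε / (2 * K ^ m) := by positivity
        have hC1 : ((6 * 2 ^ m : ℝ) ^ m + (m + 1)) / η ≤ C := by
          rw [hC]; linarith [(by positivity : (0 : ℝ) ≤ m + 1)]
        have hC2 : (m + 1 : ℝ) ≤ C := by
          rw [hC]
          linarith [(by positivity : (0 : ℝ) ≤ ((6 * 2 ^ m : ℝ) ^ m + (m + 1)) / η)]
        by_cases hdev : ∀ j : Fin m, dev a (vv (par P hP j)) (vv j.succ) ≤ 1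
        · rw [if_pos hdev]
          by_cases hloc : locErr a K vv ≤ η
          · refine (h V a hnet Z hZ hZx I vv hinj hcore d3 hloc).trans ?_
            have := mul_nonneg hCp.le hL
            linarith
          · obtain ⟨e0, e1⟩ := hnet.embDet_mem hZ hZx I hP hinj hcore hdev
            have e2 : |embDet a I Z vv - embLim a I vv| ≤ (6 * 2 ^ m : ℝ) ^ m + (m + 1) := by
              rw [abs_le]; constructor <;> linarith
            have e3 : ((6 * 2 ^ m : ℝ) ^ m + (m + 1)) =
                ((6 * 2 ^ m : ℝ) ^ m + (m + 1)) / η * η := by field_simp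
            have e4 : ((6 * 2 ^ m : ℝ) ^ m + (m + 1)) / η * η ≤ C * locErr a K vv :=
              mul_le_mul hC1 (not_le.1 hloc).le hη.le hCp.le
            linarith
        · rw [if_neg hdev]
          push Not at hdev
          obtain ⟨j, hj⟩ := hdev
          have e1 := hnet.dev_le_locErr K vv (par P hP j) j.succ
          have e2 : C * 1 ≤ C * locErr a K vv := mul_le_mul_of_nonneg_left (by linarith) hCp.le
          rw [zero_sub, abs_neg, abs_of_nonneg q0]
          linarith
      calc _ ≤ coreWeight a (core a K) P hP m vv * (ε / (2 * K ^ m) + C * locErr a K vv) :=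
            mul_le_mul_of_nonneg_left key hcw
        _ = _ := by ring
    · rw [if_neg hvv]
      have h1 := mul_nonneg hCp.le (mul_nonneg hcw hL)
      have h2 : 0 ≤ coreWeight a (core a K) P hP m vv * (ε / (2 * K ^ m)) :=
        mul_nonneg hcw (by positivity)
      linarith
  refine (sum_le_sum fun vv _ => hbound vv).trans ?_
  rw [sum_add_distrib, ← sum_mul, ← mul_sum]
  have t1 := hsp.sum_le (by positivity) 0
  have t2 := h₁ V a δ d1 ha P hP
  set n : ℝ := (Fintype.card V : ℝ) with hn
  calc _ ≤ K ^ m * n * (ε / (2 * K ^ m)) + C * (ε / (2 * C) * n) :=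
        add_le_add (mul_le_mul_of_nonneg_right t1 (by positivity))
          (mul_le_mul_of_nonneg_left t2 hCp.le)
    _ = ε * n := by field_simp; ring

end Embedded

/-! ### Tuples with a bad edge contribute little -/

section Bad

variable {m : ℕ}

lemma sum_localAt_mul_le (H : SimpleGraph V) {P : ℕ → ℕ} (hP : ∀ j, P j ≤ j)
    {p : Fin (m + 1) → Fin (m + 1)} (hp : ∀ j : Fin m, p j.succ = par P hP j)
    {I : Finset (Fin (m + 1))} (hI : ∀ j : Fin m, par P hP j ∈ I) {i : Fin (m + 1)}
    (hi : i = 0 ∨ i ∈ I) (ψ : V → ℝ) (hψ : ∀ v, 0 ≤ ψ v) :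
    ∑ vv : Fin (m + 1) → V, (if LocalAt H p 0 I vv then ψ (vv i) else 0) ≤
      ((m : ℝ) + 1) ^ m * ∑ v, ψ v := by
  set deg : V → ℕ := fun v => (univ.filter fun u => H.Adj v u).card with hdeg
  set J : ℕ → Prop := fun j => ∃ h : j < m + 1, (⟨j, h⟩ : Fin (m + 1)) ∈ I with hJ
  set w : ℕ → V → V → ℝ := fun j u v =>
    if H.Adj u v ∧ deg u ≤ m + 1 ∧ (J (j + 1) → deg v ≤ m + 1) then 1 else 0 with hw
  have hw0 : ∀ j u v, 0 ≤ w j u v := fun j u v => by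
    simp only [hw]; split_ifs <;> norm_num
  have hrow : ∀ j u, ∑ v, w j u v ≤ (m : ℝ) + 1 := by
    intro j u
    by_cases hu : deg u ≤ m + 1
    · calc ∑ v, w j u v ≤ ∑ v, (if H.Adj u v then (1 : ℝ) else 0) := by
            refine sum_le_sum fun v _ => ?_
            simp only [hw]
            split_ifs with h1 h2 h2
            · exact le_rfl
            · exact absurd h1.1 h2
            · exact zero_le_one
            · exact le_rfl
        _ = (deg u : ℝ) := by rw [sum_boole]
        _ ≤ m + 1 := by exact_mod_cast hu
    · rw [sum_eq_zero fun v _ => if_neg fun h => hu h.2.1]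
      positivity
  have hcol : ∀ j, J (j + 1) → ∀ v, ∑ u, w j u v ≤ (m : ℝ) + 1 := by
    intro j hj v
    by_cases hv : deg v ≤ m + 1
    · calc ∑ u, w j u v ≤ ∑ u, (if H.Adj v u then (1 : ℝ) else 0) := by
            refine sum_le_sum fun u _ => ?_
            simp only [hw]
            split_ifs with h1 h2 h2
            · exact le_rfl
            · exact absurd h1.1.symm h2
            · exact zero_le_one
            · exact le_rfl
        _ = (deg v : ℝ) := by rw [sum_boole]
        _ ≤ m + 1 := by exact_mod_cast hv
    · rw [sum_eq_zero fun u _ => if_neg fun h => hv (h.2.2 hj)]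
      positivity
  have hmain := sum_treeProd_mul_le P hP hw0 (by positivity) (fun j => j = 0 ∨ J j)
    (fun j hj => by
      rcases hj with hj | ⟨hj, -⟩
      · exact absurd hj (Nat.succ_ne_zero j)
      · exact Or.inr ⟨_, hI ⟨j, Nat.lt_of_succ_lt_succ hj⟩⟩)
    hrow (fun j hj v => hcol j (hj.resolve_left (Nat.succ_ne_zero j)) v) m i
    (hi.imp (fun h => by rw [h]; rfl) fun h => ⟨i.2, h⟩) ψ hψ
  refine le_trans (sum_le_sum fun vv _ => ?_) hmain
  have hprod : 0 ≤ treeProd P hP w m vv := prod_nonneg fun j _ => hw0 _ _ _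
  split_ifs with hl
  · obtain ⟨hinj, hadj, hloc⟩ := hl
    have hd : ∀ j ∈ I, deg (vv j) ≤ m + 1 := by
      intro j hj
      calc deg (vv j) ≤ (univ.image vv).card :=
            card_le_card fun u hu => hloc j hj u (mem_filter.1 hu).2
        _ ≤ m + 1 := card_image_le.trans (by simp)
    have h1 : treeProd P hP w m vv = 1 := by
      refine prod_eq_one fun j _ => if_pos ⟨?_, hd _ (hI j), fun hj => ?_⟩
      · have := hadj j.succ (Fin.succ_ne_zero j)
        rwa [hp] at this
      · obtain ⟨h, hj⟩ := hj
        exact hd _ hj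
    rw [h1, one_mul]
  · exact mul_nonneg hprod (hψ _)

/-- A tuple is good if it lies in the core and no edge of the tree joins vertices with large
effective resistance. -/
def Good (a : V → V → ℝ) (K : ℝ) (P : ℕ → ℕ) (hP : ∀ j, P j ≤ j) (vv : Fin (m + 1) → V) : Prop :=
  (∀ i, vv i ∈ core a K) ∧ ∀ j : Fin m, dev a (vv (par P hP j)) (vv j.succ) ≤ 1

/-- A pair of vertices which may not appear as an edge of a good tuple. -/
def BadPair (a : V → V → ℝ) (K : ℝ) (y z : V) : Prop :=
  ¬ (y ∈ core a K ∧ z ∈ core a K ∧ dev a y z ≤ 1)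

lemma sum_localAt_not_good_le (H : SimpleGraph V) (a : V → V → ℝ) (K : ℝ) {P : ℕ → ℕ}
    (hP : ∀ j, P j ≤ j) {p : Fin (m + 1) → Fin (m + 1)} (hp : ∀ j : Fin m, p j.succ = par P hP j)
    {I : Finset (Fin (m + 1))} (hI : ∀ j : Fin m, par P hP j ∈ I) :
    ∑ vv : Fin (m + 1) → V, (if LocalAt H p 0 I vv ∧ ¬ Good a K P hP vv then (1 : ℝ) else 0) ≤
      ((m : ℝ) + 1) ^ m * ((univ.filter fun v => v ∉ core a K).card +
        m * ∑ y, ∑ z, if H.Adj y z ∧ BadPair a K y z then (1 : ℝ) else 0) := by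
  set ψ₀ : V → ℝ := fun v => if v ∉ core a K then 1 else 0 with hψ₀
  set ψ : V → ℝ := fun y => ∑ z, if H.Adj y z ∧ BadPair a K y z then (1 : ℝ) else 0 with hψ
  have h0 : ∀ v, 0 ≤ ψ₀ v := fun v => by simp only [hψ₀]; split_ifs <;> norm_num
  have h1 : ∀ v, 0 ≤ ψ v := fun v => sum_nonneg fun z _ => by split_ifs <;> norm_num
  have hpt : ∀ vv : Fin (m + 1) → V,
      (if LocalAt H p 0 I vv ∧ ¬ Good a K P hP vv then (1 : ℝ) else 0) ≤
      (if LocalAt H p 0 I vv then ψ₀ (vv 0) else 0) +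
        ∑ j : Fin m, if LocalAt H p 0 I vv then ψ (vv (par P hP j)) else 0 := by
    intro vv
    by_cases hl : LocalAt H p 0 I vv
    · simp only [hl, true_and, if_true]
      have hs : 0 ≤ ∑ j : Fin m, ψ (vv (par P hP j)) := sum_nonneg fun j _ => h1 _
      by_cases hg : Good a K P hP vv
      · rw [if_neg (not_not.2 hg)]
        exact add_nonneg (h0 _) hs
      rw [if_pos hg]
      by_cases hv0 : vv 0 ∈ core a K
      · have hex : ∃ j : Fin m, BadPair a K (vv (par P hP j)) (vv j.succ) := by
          by_contra! hno
          simp only [BadPair, not_not] at hno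
          exact hg ⟨Fin.cases hv0 fun j => (hno j).2.1, fun j => (hno j).2.2⟩
        obtain ⟨j, hj⟩ := hex
        have hadj := hl.2.1 j.succ (Fin.succ_ne_zero j)
        rw [hp] at hadj
        have h2 : (1 : ℝ) ≤ ψ (vv (par P hP j)) := by
          have := single_le_sum (f := fun z => if H.Adj (vv (par P hP j)) z ∧
            BadPair a K (vv (par P hP j)) z then (1 : ℝ) else 0)
            (fun z _ => by split_ifs <;> norm_num) (mem_univ (vv j.succ))
          rwa [if_pos ⟨hadj, hj⟩] at this
        have h3 := single_le_sum (f := fun j : Fin m => ψ (vv (par P hP j)))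
          (fun z _ => h1 _) (mem_univ j)
        have := h0 (vv 0)
        linarith
      · have h4 : ψ₀ (vv 0) = 1 := if_pos hv0
        linarith
    · simp [hl]
  refine (sum_le_sum fun vv _ => hpt vv).trans ?_
  rw [sum_add_distrib, sum_comm]
  have e0 := sum_localAt_mul_le H hP hp hI (Or.inl rfl) ψ₀ h0
  have e1 : ∀ j : Fin m, _ := fun j => sum_localAt_mul_le H hP hp hI (Or.inr (hI j)) ψ h1
  have e2 := sum_le_sum fun j (_ : j ∈ (univ : Finset (Fin m))) => e1 j
  rw [sum_const, card_univ, Fintype.card_fin, nsmul_eq_mul] at e2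
  have e3 : ∑ v, ψ₀ v = ((univ.filter fun v => v ∉ core a K).card : ℝ) := by
    rw [sum_boole]
  rw [e3] at e0
  linarith

/-- The probability that an edge belongs to the weighted spanning tree. -/
lemma sum_spanningTrees_adj (G : SimpleGraph V) (c : Sym2 V → ℝ) (ha : IsNet (netOf G c))
    (y z : V) :
    ∑ T ∈ spanningTrees G, (if (SimpleGraph.fromEdgeSet (↑T : Set (Sym2 V))).Adj y z
      then treeWeight c T else 0) = partZ G c * (netOf G c y z * effRes (netOf G c) y z) := by
  rcases eq_or_ne y z with rfl | hyz
  · simp [effRes]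
  have hv : Function.Injective ![y, z] := by
    intro i j h
    fin_cases i <;> fin_cases j <;> simp_all
  have h := sum_localAt (p := fun _ : Fin 2 => 0) (root := 0) (I := ∅) (vv := ![y, z]) G c
    (fun j hj => Fin.pos_iff_ne_zero.2 hj) rfl hv
  have hiff : ∀ H : SimpleGraph V, LocalAt H (fun _ : Fin 2 => 0) 0 ∅ ![y, z] ↔ H.Adj y z := by
    intro H
    refine ⟨fun h => h.2.1 1 one_ne_zero, fun h => ⟨hv, ?_, by simp⟩⟩
    intro j hj
    fin_cases j
    · exact absurd rfl hj
    · exact h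
  simp only [hiff] at h
  rw [h]
  have e1 : (univ.filter fun j : Fin 2 => j ≠ 0) = {1} := by decide
  have e2 : univ.image ![y, z] = insert z {y} := by
    ext x
    simp [Fin.exists_fin_two, eq_comm, or_comm]
  have e3 : killed (netOf G c) ((∅ : Finset (Fin 2)).image ![y, z]) = netOf G c := by
    ext u w; simp [killed]
  rw [e1, e2, e3, prod_singleton, ha.det_dirLap_insert (singleton_nonempty y), ← partZ_eq_det,
    effRes, if_neg hyz, ha.symm y z]
  simp only [Matrix.cons_val_one, Matrix.cons_val_zero]
  ring

lemma sum_bad_le [Nonempty V] {a : V → V → ℝ} {K δ : ℝ} (ha : IsBal a K δ) (hK : 1 ≤ K) :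
    ∑ y, ∑ z, (if BadPair a K y z then a y z * effRes a y z else 0) ≤
      36 * K * δ * Fintype.card V := by
  have h := ha.sum_defect_le hK
  have hb : ∀ y z, (if BadPair a K y z then a y z * effRes a y z else 0) ≤
      3 * (if y ∈ core a K ∧ z ∈ core a K then a y z * dev a y z else a y z * effRes a y z) := by
    intro y z
    have hnn := ha.nonneg y z
    have h1 : 0 ≤ a y z * dev a y z := mul_nonneg hnn (dev_nonneg _ _ _)
    have h2 : 0 ≤ a y z * effRes a y z := mul_nonneg hnn (ha.toIsNet.effRes_nonneg _ _)
    by_cases hc : y ∈ core a K ∧ z ∈ core a K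
    · rw [if_pos hc]
      split_ifs with hbad
      · have hd : 1 < dev a y z := by
          by_contra! hd
          exact hbad ⟨hc.1, hc.2, hd⟩
        rcases eq_or_ne y z with rfl | hyz
        · simp [ha.loop]
        have := mul_le_mul_of_nonneg_left (effRes_le_dev_add hyz hc.1 hc.2) hnn
        have := mul_le_mul_of_nonneg_left hd.le hnn
        linarith
      · linarith
    · rw [if_neg hc]
      split_ifs <;> linarith
  calc _ ≤ ∑ y, ∑ z, 3 * (if y ∈ core a K ∧ z ∈ core a K then a y z * dev a y z
        else a y z * effRes a y z) := sum_le_sum fun y _ => sum_le_sum fun z _ => hb y z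
    _ ≤ _ := by simp only [← mul_sum]; linarith

lemma sum_not_good_le [Nonempty V] (G : SimpleGraph V) (c : Sym2 V → ℝ)
    (hc : ∀ e ∈ G.edgeSet, 0 < c e) {K δ : ℝ} (ha : IsBal (netOf G c) K δ) (hK : 1 ≤ K)
    (hZ : 0 < partZ G c) {P : ℕ → ℕ} (hP : ∀ j, P j ≤ j) {p : Fin (m + 1) → Fin (m + 1)}
    (hp : ∀ j : Fin m, p j.succ = par P hP j)
    {I : Finset (Fin (m + 1))} (hI : ∀ j : Fin m, par P hP j ∈ I) :
    ∑ vv : Fin (m + 1) → V, (if ¬ Good (netOf G c) K P hP vv then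
      (∑ T ∈ spanningTrees G, if LocalAt (SimpleGraph.fromEdgeSet (↑T : Set (Sym2 V))) p 0 I vv
        then treeWeight c T else 0) / partZ G c else 0) ≤
      ((m : ℝ) + 1) ^ m * (1 + 36 * m * K) * δ * Fintype.card V := by
  set a := netOf G c with hadef
  set n : ℝ := (Fintype.card V : ℝ) with hn
  set N : ℝ := ((univ.filter fun v => v ∉ core a K).card : ℝ) with hN
  set M : ℝ := ((m : ℝ) + 1) ^ m with hM
  have hM0 : 0 ≤ M := by positivity
  have hwt : ∀ T ∈ spanningTrees G, 0 ≤ treeWeight c T := fun T hT =>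
    prod_nonneg fun e he => (hc e ((mem_filter.1 hT).2.1 he)).le
  set H : Finset (Sym2 V) → SimpleGraph V :=
    fun T => SimpleGraph.fromEdgeSet (↑T : Set (Sym2 V)) with hH
  have e1 : ∑ vv : Fin (m + 1) → V, (if ¬ Good a K P hP vv then
      (∑ T ∈ spanningTrees G, if LocalAt (H T) p 0 I vv
        then treeWeight c T else 0) / partZ G c else 0) =
      (∑ T ∈ spanningTrees G, treeWeight c T * ∑ vv : Fin (m + 1) → V,
        if LocalAt (H T) p 0 I vv ∧ ¬ Good a K P hP vv then (1 : ℝ) else 0) / partZ G c := by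
    simp only [mul_sum]
    rw [sum_comm, sum_div]
    refine sum_congr rfl fun vv _ => ?_
    by_cases hg : Good a K P hP vv <;> simp [hg]
  have e2 : ∑ T ∈ spanningTrees G, treeWeight c T * (∑ y, ∑ z,
      if (H T).Adj y z ∧ BadPair a K y z then (1 : ℝ) else 0) =
      partZ G c * ∑ y, ∑ z, (if BadPair a K y z then a y z * effRes a y z else 0) := by
    simp only [mul_sum]
    rw [sum_comm]
    refine sum_congr rfl fun y _ => ?_
    rw [sum_comm]
    refine sum_congr rfl fun z _ => ?_
    by_cases hb : BadPair a K y z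
    · have := sum_spanningTrees_adj G c ha.toIsNet y z
      simp only [hb, and_true, if_true, mul_ite, mul_one, mul_zero]
      exact this
    · simp [hb]
  rw [e1, div_le_iff₀ hZ]
  calc _ ≤ ∑ T ∈ spanningTrees G, treeWeight c T * (M * (N + m * ∑ y, ∑ z,
        if (H T).Adj y z ∧ BadPair a K y z then (1 : ℝ) else 0)) :=
        sum_le_sum fun T hT => mul_le_mul_of_nonneg_left
          ((sum_localAt_not_good_le (H T) a K hP hp hI).trans (le_of_eq (by congr!))) (hwt T hT)
    _ = M * (N * partZ G c + m * ∑ T ∈ spanningTrees G, treeWeight c T * (∑ y, ∑ z,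
        if (H T).Adj y z ∧ BadPair a K y z then (1 : ℝ) else 0)) := by
        rw [partZ, mul_sum, mul_sum, ← sum_add_distrib, mul_sum]
        exact sum_congr rfl fun T _ => by ring
    _ = M * (N + m * ∑ y, ∑ z, (if BadPair a K y z then a y z * effRes a y z else 0)) *
        partZ G c := by rw [e2]; ring
    _ ≤ M * (δ * n + m * (36 * K * δ * n)) * partZ G c := by
        refine mul_le_mul_of_nonneg_right (mul_le_mul_of_nonneg_left (add_le_add ha.card_compl_le
          (mul_le_mul_of_nonneg_left (sum_bad_le ha hK) (Nat.cast_nonneg m))) hM0) hZ.le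
    _ = _ := by ring

end Bad

/-! ### Local statistics of normalised networks -/

section Normalised

variable {m : ℕ}

lemma prod_filter_ne_zero (f : Fin (m + 1) → ℝ) :
    ∏ j ∈ univ.filter (· ≠ 0), f j = ∏ j : Fin m, f j.succ := by
  rw [prod_filter, Fin.prod_univ_succ]
  simp [Fin.succ_ne_zero]

lemma partZ_pos [Nonempty V] (G : SimpleGraph V) (c : Sym2 V → ℝ) (ha : IsNet (netOf G c)) :
    0 < partZ G c := by
  rw [partZ_eq_det G c (Classical.arbitrary V)]
  exact (ha.dirLap_posDef (singleton_nonempty _)).det_pos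

/-- The quantitative form of the local statistics, for almost balanced networks at scale one. -/
lemma exists_localStat_approx (K : ℝ) (hK : 1 ≤ K) (m : ℕ) : ∀ ε > 0, ∃ δ₀ > 0,
    ∀ (V : Type) [Fintype V] [DecidableEq V] [Nonempty V] (G : SimpleGraph V) (c : Sym2 V → ℝ)
      (δ : ℝ), δ ≤ δ₀ → (∀ e ∈ G.edgeSet, 0 < c e) → IsBal (netOf G c) K δ →
      ∀ (P : ℕ → ℕ) (hP : ∀ j, P j ≤ j) (p : Fin (m + 1) → Fin (m + 1)), p 0 = 0 →
      (∀ j : Fin m, p j.succ = par P hP j) →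
      ∀ I : Finset (Fin (m + 1)), (∀ j : Fin m, par P hP j ∈ I) →
      |∑ vv : Fin (m + 1) → V, (∑ T ∈ spanningTrees G,
          if LocalAt (SimpleGraph.fromEdgeSet (↑T : Set (Sym2 V))) p 0 I vv
          then treeWeight c T else 0) / partZ G c -
        ∑ vv : Fin (m + 1) → V, (if Function.Injective vv ∧ ∀ i, vv i ∈ core (netOf G c) K then
          treeProd P hP (fun _ => netOf G c) m vv * embLim (netOf G c) I vv else 0)| ≤
        ε * Fintype.card V := by
  intro ε hε
  have hK0 : 0 < K := by linarith
  obtain ⟨δ₁, hδ₁, h⟩ := exists_sum_embDet_approx K hK m (ε / 2) (by positivity)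
  set C : ℝ := ((m : ℝ) + 1) ^ m * (1 + 36 * m * K) with hC
  have hCp : 0 < C := by positivity
  refine ⟨min δ₁ (ε / (2 * C)), lt_min hδ₁ (by positivity), ?_⟩
  intro V _ _ _ G c δ hδ hc ha P hP p hp0 hp I hI
  have hZ := partZ_pos G c ha.toIsNet
  have hp' : ∀ j, j ≠ 0 → p j < j := by
    intro j hj
    obtain ⟨i, rfl⟩ := Fin.exists_succ_eq.2 hj
    rw [hp, Fin.lt_def]
    exact Nat.lt_succ_of_le (hP i)
  have h1 := h V _ δ (hδ.trans (min_le_left _ _)) ha _ hZ (partZ_eq_det G c) P hP I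
  have h2 := sum_not_good_le G c hc ha hK hZ hP hp hI
  set a := netOf G c with hadef
  set pr : (Fin (m + 1) → V) → ℝ := fun vv => (∑ T ∈ spanningTrees G,
    if LocalAt (SimpleGraph.fromEdgeSet (↑T : Set (Sym2 V))) p 0 I vv
      then treeWeight c T else 0) / partZ G c with hpr
  have hpr0 : ∀ vv, 0 ≤ pr vv := by
    intro vv
    refine div_nonneg (sum_nonneg fun T hT => ?_) hZ.le
    split_ifs
    · exact prod_nonneg fun e he => (hc e ((mem_filter.1 hT).2.1 he)).le
    · exact le_rfl
  have hprne : ∀ vv, ¬ Function.Injective vv → pr vv = 0 := by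
    intro vv hv
    simp only [hpr]
    rw [sum_eq_zero fun T _ => if_neg fun h => hv h.1, zero_div]
  have hpri : ∀ vv, Function.Injective vv →
      pr vv = treeProd P hP (fun _ => a) m vv * embDet a I (partZ G c) vv := by
    intro vv hv
    simp only [hpr]
    rw [sum_localAt G c hp' hp0 hv, prod_filter_ne_zero, embDet, mul_div_assoc]
    congr 1
    refine prod_congr rfl fun j _ => ?_
    rw [hp]
    exact ha.symm _ _
  have hpt : ∀ vv : Fin (m + 1) → V,
      |pr vv - (if Function.Injective vv ∧ ∀ i, vv i ∈ core a K then
        treeProd P hP (fun _ => a) m vv * embLim a I vv else 0)| ≤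
      (if ¬ Good a K P hP vv then pr vv else 0) +
      (if Function.Injective vv ∧ ∀ i, vv i ∈ core a K then
        treeProd P hP (fun _ => a) m vv * |(if ∀ j : Fin m, dev a (vv (par P hP j)) (vv j.succ) ≤ 1
          then embDet a I (partZ G c) vv else 0) - embLim a I vv| else 0) := by
    intro vv
    have ht : 0 ≤ treeProd P hP (fun _ => a) m vv := prod_nonneg fun j _ => ha.nonneg _ _
    by_cases hv : Function.Injective vv
    · by_cases hcore : ∀ i, vv i ∈ core a K
      · have hvc : Function.Injective vv ∧ ∀ i, vv i ∈ core a K := ⟨hv, hcore⟩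
        rw [if_pos hvc, if_pos hvc]
        by_cases hd : ∀ j : Fin m, dev a (vv (par P hP j)) (vv j.succ) ≤ 1
        · have hg : Good a K P hP vv := ⟨hcore, hd⟩
          rw [if_neg (not_not.2 hg), if_pos hd, hpri vv hv, ← mul_sub, abs_mul,
            abs_of_nonneg ht, zero_add]
        · rw [if_pos fun hg : Good a K P hP vv => hd hg.2, if_neg hd, zero_sub, abs_neg,
            abs_of_nonneg (embLim_nonneg ha.toIsNet I vv)]
          have := hpr0 vv
          have := mul_nonneg ht (embLim_nonneg ha.toIsNet I vv)
          rw [abs_le]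
          constructor <;> linarith
      · have hvc : ¬ (Function.Injective vv ∧ ∀ i, vv i ∈ core a K) := fun h => hcore h.2
        rw [if_neg hvc, if_neg hvc,
          if_pos fun hg : Good a K P hP vv => hcore hg.1, sub_zero, add_zero,
          abs_of_nonneg (hpr0 vv)]
    · have hvc : ¬ (Function.Injective vv ∧ ∀ i, vv i ∈ core a K) := fun h => hv h.1
      rw [if_neg hvc, if_neg hvc, hprne vv hv]
      simp
  rw [← sum_sub_distrib]
  refine (abs_sum_le_sum_abs _ _).trans ((sum_le_sum fun vv _ => hpt vv).trans ?_)
  rw [sum_add_distrib]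
  have h3 : C * δ ≤ ε / 2 := by
    calc C * δ ≤ C * (ε / (2 * C)) :=
          mul_le_mul_of_nonneg_left (hδ.trans (min_le_right _ _)) hCp.le
      _ = ε / 2 := by field_simp
  have h4 : C * δ * Fintype.card V ≤ ε / 2 * Fintype.card V :=
    mul_le_mul_of_nonneg_right h3 (Nat.cast_nonneg _)
  linarith

end Normalised

/-! ### Rescaling the conductances -/

section Rescale

lemma card_of_mem_spanningTrees {G : SimpleGraph V} {T : Finset (Sym2 V)}
    (hT : T ∈ spanningTrees G) : T.card + 1 = Fintype.card V := by
  obtain ⟨hsub, htree⟩ := (mem_filter.1 hT).2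
  rw [← htree.card_edgeFinset]
  congr 2
  ext e
  rw [SimpleGraph.mem_edgeFinset, SimpleGraph.edgeSet_fromEdgeSet]
  exact ⟨fun h => ⟨h, G.not_isDiag_of_mem_edgeSet (hsub h)⟩, fun h => h.1⟩

lemma treeWeight_mul {G : SimpleGraph V} {T : Finset (Sym2 V)} (hT : T ∈ spanningTrees G)
    (c : Sym2 V → ℝ) (s : ℝ) :
    treeWeight (fun e => s * c e) T = s ^ (Fintype.card V - 1) * treeWeight c T := by
  rw [treeWeight, prod_mul_distrib, prod_const, ← card_of_mem_spanningTrees hT,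
    Nat.add_sub_cancel, treeWeight]

lemma wstBallProb_mul (G : SimpleGraph V) (c : Sym2 V → ℝ) (r : ℕ) {W : Type} (H : SimpleGraph W)
    (w : W) {s : ℝ} (hs : s ≠ 0) :
    wstBallProb G (fun e => s * c e) r H w = wstBallProb G c r H w := by
  have h : ∀ Q : Finset (Sym2 V) → Prop,
      ∑ T ∈ spanningTrees G, (if Q T then treeWeight (fun e => s * c e) T else 0) =
        s ^ (Fintype.card V - 1) * ∑ T ∈ spanningTrees G, if Q T then treeWeight c T else 0 := by
    intro Q
    rw [mul_sum]
    refine sum_congr rfl fun T hT => ?_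
    rw [treeWeight_mul hT, mul_ite, mul_zero]
  have hZ := h fun _ => True
  simp only [if_true] at hZ
  rw [wstBallProb, wstBallProb]
  congr 1
  refine sum_congr rfl fun x _ => ?_
  rw [h, partZ, hZ, partZ, mul_div_mul_left _ _ (pow_ne_zero _ hs)]

lemma cond_netOf_mul (G : SimpleGraph V) [DecidableRel G.Adj] (c : Sym2 V → ℝ) (s : ℝ) (v : V) :
    cond (netOf G fun e => s * c e) v = s * vertCond G c v := by
  rw [cond, vertCond, mul_sum, SimpleGraph.neighborFinset_eq_filter, sum_filter]
  refine sum_congr rfl fun u _ => ?_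
  rw [netOf, Sym2.eq_swap]
  congr

lemma sum_div_cond_netOf_mul (G : SimpleGraph V) [DecidableRel G.Adj] (c : Sym2 V → ℝ) {s : ℝ}
    (hs : s ≠ 0) (v : V) :
    ∑ u, netOf G (fun e => s * c e) v u / cond (netOf G fun e => s * c e) u = bFun G c v := by
  rw [bFun, SimpleGraph.neighborFinset_eq_filter, sum_filter]
  refine sum_congr rfl fun u _ => ?_
  rw [netOf, cond_netOf_mul, Sym2.eq_swap]
  by_cases h : G.Adj v u
  · rw [if_pos h, if_pos h, mul_div_mul_left _ _ hs]
  · rw [if_neg h, if_neg h, zero_div]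

lemma isNet_netOf {G : SimpleGraph V} (hG : G.Connected) {c : Sym2 V → ℝ}
    (hc : ∀ e ∈ G.edgeSet, 0 < c e) : IsNet (netOf G c) where
  symm u v := by
    rw [netOf, netOf, Sym2.eq_swap, G.adj_comm]
  nonneg u v := by
    rw [netOf]
    split_ifs with h
    · exact (hc _ h).le
    · exact le_rfl
  loop v := if_neg (G.loopless.irrefl v)
  conn f hf u v := by
    obtain ⟨w⟩ := hG.preconnected u v
    induction w with
    | nil => rfl
    | cons h _ ih =>
      refine (hf _ _ ?_).trans ih
      rw [netOf, if_pos h]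
      exact hc _ h

lemma core_netOf {G : SimpleGraph V} [DecidableRel G.Adj] {c : Sym2 V → ℝ} {K γ : ℝ} (hγ : 0 < γ) :
    core (netOf G fun e => γ⁻¹ * c e) K =
      univ.filter fun v => vertCond G c v ∈ Set.Icc γ (K * γ) := by
  ext v
  rw [core, mem_filter, mem_filter, cond_netOf_mul, Set.mem_Icc, Set.mem_Icc,
    inv_mul_le_iff₀ hγ, le_inv_mul_iff₀ hγ, mul_one, mul_comm K]

lemma isBal_netOf {G : SimpleGraph V} [DecidableRel G.Adj] (hG : G.Connected) {c : Sym2 V → ℝ}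
    (hc : ∀ e ∈ G.edgeSet, 0 < c e) {K γ δ : ℝ} (hγ : 0 < γ)
    (hW : ((univ.filter fun v : V => vertCond G c v ∈ Set.Icc γ (K * γ)).card : ℝ) ≥
      (1 - δ) * (Fintype.card V : ℝ))
    (hWsum : ∑ v ∈ univ.filter (fun v : V => vertCond G c v ∉ Set.Icc γ (K * γ)),
      vertCond G c v ≤ δ * γ * (Fintype.card V : ℝ))
    (hle : ∀ e ∈ G.edgeSet, c e ≤ δ * γ) :
    IsBal (netOf G fun e => γ⁻¹ * c e) K |δ| where
  toIsNet := isNet_netOf hG fun e he => mul_pos (inv_pos.2 hγ) (hc e he)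
  le u v := by
    rw [netOf]
    split_ifs with h
    · rw [inv_mul_le_iff₀ hγ, mul_comm]
      exact (hle _ h).trans (mul_le_mul_of_nonneg_right (le_abs_self δ) hγ.le)
    · exact abs_nonneg δ
  card_core := by
    rw [core_netOf hγ]
    refine le_trans (mul_le_mul_of_nonneg_right ?_ (Nat.cast_nonneg _)) hW
    linarith [le_abs_self δ]
  sum_cond := by
    simp only [core_netOf hγ, mem_filter, mem_univ, true_and, cond_netOf_mul]
    rw [← mul_sum, inv_mul_le_iff₀ hγ]
    refine hWsum.trans ?_
    calc δ * γ * (Fintype.card V : ℝ) ≤ |δ| * γ * Fintype.card V :=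
          mul_le_mul_of_nonneg_right (mul_le_mul_of_nonneg_right (le_abs_self δ) hγ.le)
            (Nat.cast_nonneg _)
      _ = _ := by ring

end Rescale

/-! ### Conclusion -/

section Conclusion

variable {m : ℕ}

lemma Ffun_mul_prod (G : SimpleGraph V) [DecidableRel G.Adj] (c : Sym2 V → ℝ) {γ : ℝ} (hγ : 0 < γ)
    {P : ℕ → ℕ} (hP : ∀ j, P j ≤ j) {p : Fin (m + 1) → Fin (m + 1)}
    (hp : ∀ j : Fin m, p j.succ = par P hP j) (r : ℕ) {vv : Fin (m + 1) → V}
    (hadj : ∀ j, j ≠ 0 → G.Adj (vv (p j)) (vv j)) :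
    Ffun G c p 0 r vv / (stabCard p 0 : ℝ) *
      ∏ j ∈ univ.filter (fun j => j ≠ 0), c s(vv (p j), vv j) =
    ((Fintype.card V : ℝ) * stabCard p 0)⁻¹ *
      (treeProd P hP (fun _ => netOf G fun e => γ⁻¹ * c e) m vv *
        embLim (netOf G fun e => γ⁻¹ * c e) (univ.filter fun j => depth p 0 j < r) vv) := by
  have hs : γ⁻¹ ≠ 0 := (inv_pos.2 hγ).ne'
  have h1 : treeProd P hP (fun _ => netOf G fun e => γ⁻¹ * c e) m vv =
      γ⁻¹ ^ m * ∏ j ∈ univ.filter (fun j => j ≠ 0), c s(vv (p j), vv j) := by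
    rw [prod_filter_ne_zero, treeProd]
    calc _ = ∏ j : Fin m, (γ⁻¹ * c s(vv (p j.succ), vv j.succ)) := by
          refine prod_congr rfl fun j _ => ?_
          have := hadj j.succ (Fin.succ_ne_zero j)
          rw [hp] at this ⊢
          exact if_pos this
      _ = _ := by rw [prod_mul_distrib, prod_const, card_univ, Fintype.card_fin]
  have h2 : (univ.filter fun j => j ∉ univ.filter fun j => depth p 0 j < r) =
      univ.filter fun j => ¬ depth p 0 j < r := by
    ext; simp
  have h3 : embLim (netOf G fun e => γ⁻¹ * c e) (univ.filter fun j => depth p 0 j < r) vv =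
      Real.exp (-∑ j ∈ univ.filter (fun j => depth p 0 j < r), bFun G c (vv j)) *
        (γ⁻¹ * ∑ j ∈ univ.filter (fun j => ¬ depth p 0 j < r), vertCond G c (vv j)) /
          (γ⁻¹ ^ (m + 1) * ∏ j, vertCond G c (vv j)) := by
    rw [embLim, h2]
    simp only [sum_div_cond_netOf_mul G c hs]
    simp only [cond_netOf_mul, prod_mul_distrib, prod_const, card_univ, Fintype.card_fin,
      ← mul_sum]
  rw [h1, h3, Ffun]
  generalize Real.exp _ = E
  generalize ∏ j, vertCond G c (vv j) = Q
  generalize ∑ j ∈ univ.filter (fun j => ¬ depth p 0 j < r), vertCond G c (vv j) = S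
  generalize ∏ j ∈ univ.filter (fun j => j ≠ 0), c s(vv (p j), vv j) = R
  calc _ = ((Fintype.card V : ℝ) * stabCard p 0)⁻¹ * (R * (E * S / Q)) := by
        simp only [div_eq_mul_inv, mul_inv]; ring
    _ = ((Fintype.card V : ℝ) * stabCard p 0)⁻¹ *
        (R * (γ⁻¹ ^ (m + 1) * (E * S) / (γ⁻¹ ^ (m + 1) * Q))) := by
        rw [mul_div_mul_left _ _ (pow_ne_zero _ hs)]
    _ = _ := by rw [pow_succ]; ring

/-- The quantitative form of the local statistics. -/
lemma exists_wstBallProb_approx (K : ℝ) (hK : 1 ≤ K) (r : ℕ) (p : Fin (m + 1) → Fin (m + 1))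
    (hp0 : p 0 = 0) (hp : ∀ j, j ≠ 0 → p j < j) (hr : ∀ j, depth p 0 j ≤ r) :
    ∀ ε > 0, ∃ δ₀ > 0, ∀ (V : Type) [Fintype V] [DecidableEq V] (G : SimpleGraph V)
      [DecidableRel G.Adj] (c : Sym2 V → ℝ) (γ δ : ℝ), |δ| ≤ δ₀ → G.Connected →
      (∀ e ∈ G.edgeSet, 0 < c e) → 0 < γ →
      ((univ.filter fun v : V => vertCond G c v ∈ Set.Icc γ (K * γ)).card : ℝ) ≥
        (1 - δ) * (Fintype.card V : ℝ) →
      ∑ v ∈ univ.filter (fun v : V => vertCond G c v ∉ Set.Icc γ (K * γ)),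
        vertCond G c v ≤ δ * γ * (Fintype.card V : ℝ) →
      (∀ e ∈ G.edgeSet, c e ≤ δ * γ) →
      |wstBallProb G c r (treeGraph p 0) 0 -
        ∑ vv ∈ univ.filter (fun vv : Fin (m + 1) → V =>
            Compatible G p 0 {v | vertCond G c v ∈ Set.Icc γ (K * γ)} vv),
          (Ffun G c p 0 r vv / (stabCard p 0 : ℝ)) *
            ∏ j ∈ univ.filter (fun j => j ≠ 0), c s(vv (p j), vv j)| ≤ ε := by
  intro ε hε
  obtain ⟨δ₀, hδ₀, h⟩ := exists_localStat_approx K hK m ε hε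
  refine ⟨δ₀, hδ₀, ?_⟩
  intro V _ _ G _ c γ δ hδ hG hc hγ hW hWsum hle
  have := hG.nonempty
  set P : ℕ → ℕ := fun j => if h : j < m then p ⟨j + 1, Nat.succ_lt_succ h⟩ else 0 with hPdef
  have hP : ∀ j, P j ≤ j := by
    intro j
    simp only [hPdef]
    split_ifs with hj
    · have := hp ⟨j + 1, Nat.succ_lt_succ hj⟩ (fun h => Nat.succ_ne_zero j (congrArg Fin.val h))
      exact Nat.lt_succ_iff.1 (Fin.lt_def.1 this)
    · exact Nat.zero_le j
  have hpP : ∀ j : Fin m, p j.succ = par P hP j := by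
    intro j
    ext
    simp only [par, hPdef, dif_pos j.2]
    rfl
  have hI : ∀ j : Fin m, par P hP j ∈ univ.filter fun j => depth p 0 j < r := by
    intro j
    rw [← hpP, mem_filter]
    have h1 := hr j.succ
    rw [depth_of_ne hp (Fin.succ_ne_zero j)] at h1
    exact ⟨mem_univ _, h1⟩
  set c' : Sym2 V → ℝ := fun e => γ⁻¹ * c e with hc'
  have hs : γ⁻¹ ≠ 0 := (inv_pos.2 hγ).ne'
  have hbal : IsBal (netOf G c') K |δ| := isBal_netOf hG hc hγ hW hWsum hle
  have key := h V G c' |δ| hδ (fun e he => mul_pos (inv_pos.2 hγ) (hc e he)) hbal P hP p hp0 hpP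
    _ hI
  have hstab : (1 : ℝ) ≤ stabCard p 0 := by exact_mod_cast stabCard_pos p 0
  have hn : (0 : ℝ) < Fintype.card V := by exact_mod_cast Fintype.card_pos
  have e1 : ∑ vv ∈ univ.filter (fun vv : Fin (m + 1) → V =>
      Compatible G p 0 {v | vertCond G c v ∈ Set.Icc γ (K * γ)} vv),
        (Ffun G c p 0 r vv / (stabCard p 0 : ℝ)) *
          ∏ j ∈ univ.filter (fun j => j ≠ 0), c s(vv (p j), vv j) =
      ((Fintype.card V : ℝ) * stabCard p 0)⁻¹ *
        ∑ vv : Fin (m + 1) → V, (if Function.Injective vv ∧ ∀ i, vv i ∈ core (netOf G c') K then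
          treeProd P hP (fun _ => netOf G c') m vv *
            embLim (netOf G c') (univ.filter fun j => depth p 0 j < r) vv else 0) := by
    rw [sum_filter, mul_sum]
    refine sum_congr rfl fun vv _ => ?_
    by_cases hcomp : Compatible G p 0 {v | vertCond G c v ∈ Set.Icc γ (K * γ)} vv
    · obtain ⟨hinj, hadj, hcore⟩ := hcomp
      have hcore' : ∀ i, vv i ∈ core (netOf G c') K := fun i => by
        rw [hc', core_netOf hγ, mem_filter]
        exact ⟨mem_univ _, hcore i⟩
      rw [if_pos ⟨hinj, hadj, hcore⟩, if_pos ⟨hinj, hcore'⟩, Ffun_mul_prod G c hγ hP hpP r hadj]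
    · rw [if_neg hcomp]
      split_ifs with hvc
      · obtain ⟨hinj, hcore⟩ := hvc
        have hno : ∃ j : Fin m, ¬ G.Adj (vv (par P hP j)) (vv j.succ) := by
          by_contra! hall
          refine hcomp ⟨hinj, fun j hj => ?_, fun i => ?_⟩
          · obtain ⟨i, rfl⟩ := Fin.exists_succ_eq.2 hj
            rw [hpP]
            exact hall i
          · have := hcore i
            rw [hc', core_netOf hγ, mem_filter] at this
            exact this.2
        obtain ⟨j, hj⟩ := hno
        have h0 : treeProd P hP (fun _ => netOf G c') m vv = 0 :=
          prod_eq_zero (mem_univ j) (if_neg hj)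
        rw [h0, zero_mul, mul_zero]
      · rw [mul_zero]
  have e2 := wstBallProb_eq_sum G c' hp r hr
  rw [hc', wstBallProb_mul G c r _ _ hs, ← hc'] at e2
  rw [e1, e2, ← mul_sub, abs_mul, abs_of_nonneg (by positivity), inv_mul_le_iff₀ (by positivity)]
  refine key.trans ?_
  have : ε * (Fintype.card V : ℝ) * 1 ≤ ε * Fintype.card V * stabCard p 0 :=
    mul_le_mul_of_nonneg_left hstab (by positivity)
  linarith

end Conclusion

open scoped Classical in
/-- local statistics of `WST` on high degree almost balanced networks.
Suppose `(Gₙ, cₙ)`, `K > 1`, `γₙ > 0`, `δₙ → 0` satisfy Assumption (LL), with `Gₙ` simple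
and `cₙ` connected.  Then for `X` uniform on `V(Gₙ)`, every radius `r` and every finite
rooted tree `(T, root)` of height `r` with `k` vertices (encoded by a parent map `p` with
`p j < j` for `j ≠ root`),
`|P(B_{WST(cₙ)}(X,r) ≅ T) − Σ_{v_k ∈ C^T(Wₙ^{(tc)})} (F_{cₙ}(T(v_k))/|Stab_T|)·
  ∏_{j ≠ root} c(v_{p(j)}, v_j)| = o(1)`. -/
theorem local_statistics_balanced
    (V : ℕ → Type) [∀ n, Fintype (V n)] [∀ n, DecidableEq (V n)]
    (G : ∀ n, SimpleGraph (V n)) [∀ n, DecidableRel (G n).Adj]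
    (c : ∀ n, Sym2 (V n) → ℝ) (K : ℝ) (γ : ℕ → ℝ) (δ : ℕ → ℝ)
    (hconn : ∀ n, (G n).Connected)
    (hpos : ∀ n, ∀ e ∈ (G n).edgeSet, 0 < c n e)
    (hK : 1 < K)
    (hγ : ∀ n, 0 < γ n)
    (hδ : Tendsto δ atTop (nhds 0))
    -- Assumption (LL)(i): |Wₙ^{(tc)}| ≥ (1-δₙ)|V(Gₙ)| for all large n
    (hW : ∀ᶠ n in atTop,
      (((Finset.univ.filter fun v : V n =>
          vertCond (G n) (c n) v ∈ Set.Icc (γ n) (K * γ n)).card : ℝ))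
        ≥ (1 - δ n) * (Fintype.card (V n) : ℝ))
    -- Assumption (LL)(ii): Σ_{v ∉ Wₙ^{(tc)}} C_v ≤ δₙ·γₙ·|V(Gₙ)| for all large n
    (hWsum : ∀ᶠ n in atTop,
      (∑ v ∈ Finset.univ.filter (fun v : V n =>
          vertCond (G n) (c n) v ∉ Set.Icc (γ n) (K * γ n)), vertCond (G n) (c n) v)
        ≤ δ n * γ n * (Fintype.card (V n) : ℝ))
    -- Assumption (LL)(iii): cₙ(e) ≤ δₙ·γₙ for all edges, for all large n
    (hc : ∀ᶠ n in atTop, ∀ e ∈ (G n).edgeSet, c n e ≤ δ n * γ n)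
    -- a rooted tree with `k ≥ 1` vertices encoded by a parent map, of height exactly `r`
    (r k : ℕ) (hk : 0 < k) (p : Fin k → Fin k) (root : Fin k)
    (hroot : p root = root)
    (hp : ∀ j, j ≠ root → p j < j)
    (hheight : (∀ j, depth p root j ≤ r) ∧ ∃ j, depth p root j = r) :
    Tendsto (fun n =>
      |wstBallProb (G n) (c n) r (treeGraph p root) root -
        ∑ vv ∈ Finset.univ.filter (fun vv : Fin k → V n =>
            Compatible (G n) p root
              {v | vertCond (G n) (c n) v ∈ Set.Icc (γ n) (K * γ n)} vv),
          (Ffun (G n) (c n) p root r vv / (stabCard p root : ℝ)) *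
            ∏ j ∈ Finset.univ.filter (fun j => j ≠ root), c n s(vv (p j), vv j)|)
      atTop (nhds 0) := by
  obtain ⟨m, rfl⟩ : ∃ m, k = m + 1 := ⟨k - 1, by omega⟩
  have hroot0 : root = 0 := by
    by_contra h
    exact absurd (hp 0 fun h0 => h h0.symm) (Fin.not_lt_zero _)
  subst hroot0
  refine tendsto_order.2 ⟨fun b hb => Eventually.of_forall fun n => hb.trans_le (abs_nonneg _),
    fun b hb => ?_⟩
  obtain ⟨δ₀, hδ₀, h⟩ :=
    exists_wstBallProb_approx K hK.le r p hroot hp hheight.1 (b / 2) (half_pos hb)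
  have hsmall : ∀ᶠ n in atTop, |δ n| < δ₀ := by
    have := (hδ.abs).eventually_lt_const (by simpa using hδ₀)
    exact this
  filter_upwards [hW, hWsum, hc, hsmall] with n h1 h2 h3 h4
  exact (h (V n) (G n) (c n) (γ n) (δ n) h4.le (hconn n) (hpos n) (hγ n) h1 h2 h3).trans_lt
    (half_lt_self hb)

end WSTPaper
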